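/- There is a K-algebra isomorphism θ : T(K[x_{ij}][y_1^{±1};σ_1]) → K[z_{ij}][y_2^{±1};σ_2] sending x'_{ij} to z_{ij} and y_1' to y_2, where T denotes the twist by the 2-cocycle c; that is, the twist of the dehomogenisation of O_q(G(m,n)) at M_1 is isomorphic to the dehomogenisation of O_q(G(m,n)) at M_2. -/

import Mathlib

open scoped BigOperators

namespace QG

variable (K : Type*) [Field K]

/-- The defining relations of the quantum matrix algebra `O_q(M_{m,n})`. -/
inductive QMatRel (q : K) (m n : ℕ) :
    FreeAlgebra K (Fin m × Fin n) → FreeAlgebra K (Fin m × Fin n) → Prop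
  | row : ∀ (i : Fin m) (j l : Fin n), j < l →
      QMatRel q m n (FreeAlgebra.ι K (i, j) * FreeAlgebra.ι K (i, l))
        (q • (FreeAlgebra.ι K (i, l) * FreeAlgebra.ι K (i, j)))
  | col : ∀ (i k : Fin m) (j : Fin n), i < k →
      QMatRel q m n (FreeAlgebra.ι K (i, j) * FreeAlgebra.ι K (k, j))
        (q • (FreeAlgebra.ι K (k, j) * FreeAlgebra.ι K (i, j)))
  | comm : ∀ (i k : Fin m) (j l : Fin n), k < i → j < l →
      QMatRel q m n (FreeAlgebra.ι K (i, j) * FreeAlgebra.ι K (k, l))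
        (FreeAlgebra.ι K (k, l) * FreeAlgebra.ι K (i, j))
  | qrel : ∀ (i k : Fin m) (j l : Fin n), i < k → j < l →
      QMatRel q m n
        (FreeAlgebra.ι K (i, j) * FreeAlgebra.ι K (k, l) -
          FreeAlgebra.ι K (k, l) * FreeAlgebra.ι K (i, j))
        ((q - q⁻¹) • (FreeAlgebra.ι K (i, l) * FreeAlgebra.ι K (k, j)))

/-- The quantum matrix algebra `O_q(M_{m,n})`. -/
abbrev QMat (q : K) (m n : ℕ) := RingQuot (QMatRel K q m n)

/-- The generator `X_{ij}` of `O_q(M_{m,n})`. -/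
noncomputable def X (q : K) {m n : ℕ} (i : Fin m) (j : Fin n) : QMat K q m n :=
  RingQuot.mkAlgHom K (QMatRel K q m n) (FreeAlgebra.ι K (i, j))

/-- The number of inversions (Coxeter length) of a permutation of `Fin t`. -/
def invCount {t : ℕ} (σ : Equiv.Perm (Fin t)) : ℕ :=
  ((Finset.univ : Finset (Fin t × Fin t)).filter fun p => p.1 < p.2 ∧ σ p.2 < σ p.1).card

/-- The quantum minor `Σ_σ (-q)^{ℓ(σ)} x_{σ(1)1} ⋯ x_{σ(t)t}` of a `t × t`
matrix of elements of a `K`-algebra. -/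
noncomputable def qMinor {A : Type*} [Ring A] [Algebra K A] (q : K) (t : ℕ)
    (x : Fin t → Fin t → A) : A :=
  ∑ σ : Equiv.Perm (Fin t), ((-q) ^ invCount σ) • (List.ofFn fun k => x (σ k) k).prod

/-- The maximal (`m × m`) quantum minor `[J]` of `O_q(M_{m,n})`, with column index set `J`
(columns taken in increasing order, rows `1,…,m`).  (Defined to be `0` if `J` does not
have exactly `m` elements.) -/
noncomputable def grMinor (q : K) (m : ℕ) {n : ℕ} (J : Finset (Fin n)) : QMat K q m n :=
  if h : J.card = m then
    qMinor K q m (fun i k => X K q i (J.orderEmbOfFin h k)) else 0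

/-- The set of maximal quantum minors of `O_q(M_{m,n})`. -/
def grGenSet (q : K) (m n : ℕ) : Set (QMat K q m n) :=
  {a | ∃ J : Finset (Fin n), a = grMinor K q m J}

/-- The quantum grassmannian `O_q(G(m,n))`: the subalgebra of `O_q(M_{m,n})`
generated by the maximal quantum minors. -/
noncomputable def qGrass (q : K) (m n : ℕ) : Subalgebra K (QMat K q m n) :=
  Algebra.adjoin K (grGenSet K q m n)

/-- The maximal quantum minor `[J]` viewed as an element of the quantum grassmannian. -/
noncomputable def grE (q : K) (m : ℕ) {n : ℕ} (J : Finset (Fin n)) : ↥(qGrass K q m n) :=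
  ⟨grMinor K q m J, Algebra.subset_adjoin ⟨J, rfl⟩⟩

/-- Reduction of a natural number modulo `n`, landing in `Fin n` (this encodes the
paper's convention that a column index is read modulo `n`; indices here are 0-based). -/
def fmod (n : ℕ) (hn : 0 < n) (k : ℕ) : Fin n := ⟨k % n, Nat.mod_lt k hn⟩

/-- The index set `{α, α+1, …, α+m-1}` (read modulo `n`) of a consecutive quantum minor
(0-based indices). -/
def consecSet {n : ℕ} (hn : 0 < n) (m : ℕ) (α : ℕ) : Finset (Fin n) :=
  (Finset.range m).image fun k => fmod n hn (α + k)

end QG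
namespace QG

variable (K : Type*) [Field K]

/-- Localisation of a `K`-algebra `A` at the powers of a normal element `u`:
an algebra `B` together with an injective map `A → B` inverting `u`, such that every
element of `B` has the form `a·u^{-k}`. -/
structure NormalLoc (A : Type*) [Ring A] [Algebra K A]
    (B : Type*) [Ring B] [Algebra K B] (u : A) where
  emb : A →ₐ[K] B
  inj : Function.Injective emb
  isUnit : IsUnit (emb u)
  surj : ∀ b : B, ∃ (a : A) (k : ℕ), b = emb a * ↑(isUnit.unit⁻¹ ^ k)

/-- The index set (0-based) of the quantum minor defining the dehomogenisation
generator `x_{ij}` at the consecutive minor starting at `α`: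
`M_α ∪ {~(α+m+j)} ∖ {~(α+(m-1-i))}`. -/
def JxSet {n : ℕ} (hn : 0 < n) (m : ℕ) (α : ℕ) (i : Fin m) (j : Fin (n - m)) :
    Finset (Fin n) :=
  insert (fmod n hn (α + m + j)) ((consecSet hn m α).erase (fmod n hn (α + (m - 1 - i))))

/-- The generator `x_{ij} = [M_α ∪ {~(α+m+j)} ∖ {~(α+(m-1-i))}]·M_α^{-1}` of the
dehomogenisation of the quantum grassmannian at the consecutive minor `M_α`. -/
noncomputable def xElt (q : K) (m n : ℕ) (hn : 0 < n) (α : ℕ)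
    {B : Type*} [Ring B] [Algebra K B]
    (L : NormalLoc K (↥(qGrass K q m n)) B (grE K q m (consecSet hn m α)))
    (i : Fin m) (j : Fin (n - m)) : B :=
  L.emb (grE K q m (JxSet hn m α i j)) * ↑(L.isUnit.unit⁻¹)

/-- `B` is a skew-Laurent extension `R[y^{±1};σ]` of the subalgebra `R`, where `σ` is
conjugation by the unit `y`:  `R` is stable under conjugation by `y` and `B` is free as a
left `R`-module with basis the (integer) powers of `y`. -/
def IsSkewLaurent {B : Type*} [Ring B] [Algebra K B] (R : Subalgebra K B) (y : Bˣ) : Prop :=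
  (∀ r ∈ R, (y : B) * r * ((y⁻¹ : Bˣ) : B) ∈ R) ∧
    ∀ b : B, ∃! f : ℤ →₀ ↥R, b = f.sum fun k r => (r : B) * ((y ^ k : Bˣ) : B)

/-- The quantum minor of a matrix of elements with row index set `R` and column index
set `C` (rows and columns taken in increasing order); `0` if the cardinalities differ. -/
noncomputable def finsetMinor {B : Type*} [Ring B] [Algebra K B] (q : K) {m c : ℕ}
    (x : Fin m → Fin c → B) (R : Finset (Fin m)) (C : Finset (Fin c)) : B :=
  if h : C.card = R.card then
    qMinor K q R.card (fun a b => x (R.orderEmbOfFin rfl a) (C.orderEmbOfFin h b))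
  else 0

/-- The row set `(α+m) − (M_α ∖ I_r)` (0-based) of the image of the maximal minor `[I]`
under the dehomogenisation at `M_α`. -/
def rowSetOf {n : ℕ} (hn : 0 < n) (m : ℕ) (α : ℕ) (I : Finset (Fin n)) : Finset (Fin m) :=
  (Finset.univ.filter fun k : Fin m => fmod n hn (α + k) ∉ I).image Fin.rev

/-- The column set `I_c − (α+m−1)` (0-based) of the image of the maximal minor `[I]`
under the dehomogenisation at `M_α`. -/
def colSetOf {n : ℕ} (hn : 0 < n) (m : ℕ) (α : ℕ) (I : Finset (Fin n)) :
    Finset (Fin (n - m)) :=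
  Finset.univ.filter fun d : Fin (n - m) => fmod n hn (α + m + d) ∈ I

/-- The last index (0-based, corresponding to the paper's index `n`). -/
def lastIdx (n : ℕ) (hn : 0 < n) : Fin n := ⟨n - 1, by omega⟩

/-- The 2-cocycle `c((s_1,…,s_n),(t_1,…,t_n)) = ∏_{j ≠ n} p^{s_n t_j}` on `ℤ^n`. -/
noncomputable def cmap {n : ℕ} (hn : 0 < n) (p : K) :
    (Fin n → ℤ) → (Fin n → ℤ) → K := fun s t =>
  ∏ j ∈ Finset.univ.filter (fun j : Fin n => j ≠ lastIdx n hn),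
    p ^ (s (lastIdx n hn) * t j)

/-- The content `ε(j+m) − ε(m+1−i)` of the dehomogenisation generator `x_{ij}`
(0-based: `ε(m+j) − ε(m-1-i)`). -/
def xContent (m n : ℕ) (i : Fin m) (j : Fin (n - m)) : Fin n → ℤ := fun l =>
  (if (l : ℕ) = m + j then 1 else 0) - (if (l : ℕ) = m - 1 - i then 1 else 0)

/-- The content `ε(1) + ⋯ + ε(m)` of `y` (equivalently, of a consecutive minor `M_1`). -/
def yContent (m n : ℕ) : Fin n → ℤ := fun l => if (l : ℕ) < m then 1 else 0

/-- The content `Σ_{i ∈ I} ε(i)` of a maximal quantum minor `[I]`. -/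
def contentOf {n : ℕ} (I : Finset (Fin n)) : Fin n → ℤ := fun l => if l ∈ I then 1 else 0

/-- A realization of the twist `T(A)` of a `ℤ^n`-graded `K`-algebra `A` by a
2-cocycle `c`: a `K`-algebra `T` together with a `K`-linear isomorphism `τ : A ≃ T`
(the twist map `a ↦ a'`) satisfying `a'b' = c(s,t)·(ab)'` on homogeneous elements. -/
structure CocycleTwist {n : ℕ} (A : Type*) [Ring A] [Algebra K A]
    (𝒜 : (Fin n → ℤ) → Submodule K A) (c : (Fin n → ℤ) → (Fin n → ℤ) → K)
    (T : Type*) [Ring T] [Algebra K T] where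
  τ : A ≃ₗ[K] T
  mul_tw : ∀ (s t : Fin n → ℤ) (a b : A), a ∈ 𝒜 s → b ∈ 𝒜 t →
    τ a * τ b = c s t • τ (a * b)

/-- The image of an index set under the cycle `(1 2 … n)` (0-based). -/
def shiftSet {n : ℕ} (hn : 0 < n) (I : Finset (Fin n)) : Finset (Fin n) :=
  I.image fun a : Fin n => fmod n hn (a.val + 1)

end QG
set_option linter.unusedSimpArgs false
set_option linter.unusedVariables false
namespace QG
section ExtGeneric
variable {K : Type*} [Field K] {C : Type*} [Ring C] [Algebra K C]
variable {ι : Type*} [LinearOrder ι]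

/-- ordered product over a finset -/
noncomputable def op (a : ι → C) (J : Finset ι) : C := ((J.sort (· ≤ ·)).map a).prod

/-- q-exterior type relations -/
structure QExt (c : K) (a : ι → C) : Prop where
  sq : ∀ i, a i * a i = 0
  sw : ∀ i j, i < j → a j * a i = c • (a i * a j)

@[simp] lemma op_empty (a : ι → C) : op a ∅ = 1 := by simp [op]

lemma op_insert_min (a : ι → C) {i : ι} {J : Finset ι} (h : ∀ j ∈ J, i < j) :
    op a (insert i J) = a i * op a J := by
  unfold op
  rw [Finset.sort_insert (r := (· ≤ ·)) (fun b hb => (h b hb).le) (fun hi => lt_irrefl _ (h i hi))]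
  simp

/-- number of elements of J below j -/
def lo (J : Finset ι) (j : ι) : ℕ := (J.filter (· < j)).card
def hi (J : Finset ι) (j : ι) : ℕ := (J.filter (j < ·)).card

lemma lo_insert {J : Finset ι} {i j : ι} (h : i ∉ J) :
    lo (insert i J) j = lo J j + if i < j then 1 else 0 := by
  unfold lo
  rw [Finset.filter_insert]
  split_ifs with h1
  · rw [Finset.card_insert_of_notMem (by simp [h])]
  · simp

lemma hi_insert {J : Finset ι} {i j : ι} (h : i ∉ J) :
    hi (insert i J) j = hi J j + if j < i then 1 else 0 := by
  unfold hi
  rw [Finset.filter_insert]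
  split_ifs with h1
  · rw [Finset.card_insert_of_notMem (by simp [h])]
  · simp

lemma lo_eq_zero {J : Finset ι} {j : ι} (h : ∀ i ∈ J, j ≤ i) : lo J j = 0 := by
  unfold lo
  rw [Finset.card_eq_zero, Finset.filter_eq_empty_iff]
  intro x hx; exact not_lt.2 (h x hx)

lemma hi_eq_zero {J : Finset ι} {j : ι} (h : ∀ i ∈ J, i ≤ j) : hi J j = 0 := by
  unfold hi
  rw [Finset.card_eq_zero, Finset.filter_eq_empty_iff]
  intro x hx; exact not_lt.2 (h x hx)

lemma lo_add_hi {J : Finset ι} {j : ι} (h : j ∉ J) : lo J j + hi J j = J.card := by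
  unfold lo hi
  rw [← Finset.card_union_of_disjoint]
  · congr 1
    ext x
    simp only [Finset.mem_union, Finset.mem_filter]
    constructor
    · rintro (h | h) <;> exact h.1
    · intro hx
      rcases lt_trichotomy x j with h1 | h1 | h1
      · exact Or.inl ⟨hx, h1⟩
      · subst h1; exact absurd hx h
      · exact Or.inr ⟨hx, h1⟩
  · rw [Finset.disjoint_filter]
    intro x _ h1 h2; exact lt_asymm h1 h2

lemma lo_erase {J : Finset ι} {j : ι} : lo (J.erase j) j = lo J j := by
  unfold lo
  congr 1
  ext x
  simp only [Finset.mem_filter, Finset.mem_erase]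
  constructor
  · rintro ⟨⟨_, h⟩, h2⟩; exact ⟨h, h2⟩
  · rintro ⟨h, h2⟩; exact ⟨⟨h2.ne, h⟩, h2⟩

lemma hi_erase {J : Finset ι} {j : ι} : hi (J.erase j) j = hi J j := by
  unfold hi
  congr 1
  ext x
  simp only [Finset.mem_filter, Finset.mem_erase]
  constructor
  · rintro ⟨⟨_, h⟩, h2⟩; exact ⟨h, h2⟩
  · rintro ⟨h, h2⟩; exact ⟨⟨h2.ne', h⟩, h2⟩

lemma op_left {c : K} {a : ι → C} (h : QExt c a) (J : Finset ι) (j : ι) :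
    a j * op a J = if j ∈ J then 0 else c ^ lo J j • op a (insert j J) := by
  induction J using Finset.induction_on_min generalizing j with
  | empty => simpa [lo] using (op_insert_min a (i := j) (J := ∅) (by simp)).symm
  | insert i J hi ih =>
    have hiJ : i ∉ J := fun h => lt_irrefl _ (hi i h)
    rw [op_insert_min a hi]
    rcases lt_trichotomy j i with hj | hj | hj
    · have hj' : ∀ k ∈ insert i J, j < k := by
        intro k hk
        rcases Finset.mem_insert.1 hk with rfl | hk
        · exact hj
        · exact hj.trans (hi k hk)
      rw [if_neg (fun h => lt_irrefl _ (hj' j h)), op_insert_min a hj', op_insert_min a hi,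
        lo_eq_zero (fun k hk => (hj' k hk).le), pow_zero, one_smul]
    · subst hj
      simp [← mul_assoc, h.sq]
    · rw [← mul_assoc, h.sw i j hj, smul_mul_assoc, mul_assoc, ih]
      by_cases hjJ : j ∈ J
      · simp [hjJ]
      · have hne : j ≠ i := hj.ne'
        rw [if_neg hjJ, if_neg (by simp [hjJ, hne]), lo_insert hiJ, if_pos hj, Finset.insert_comm,
          op_insert_min a (i := i) (J := insert j J), mul_smul_comm, smul_smul, pow_succ']
        intro k hk
        rcases Finset.mem_insert.1 hk with rfl | hk
        · exact hj
        · exact hi k hk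

lemma op_right {c : K} {a : ι → C} (h : QExt c a) (J : Finset ι) (j : ι) :
    op a J * a j = if j ∈ J then 0 else c ^ hi J j • op a (insert j J) := by
  induction J using Finset.induction_on_min generalizing j with
  | empty => simpa [hi] using (op_insert_min a (i := j) (J := ∅) (by simp)).symm
  | insert i J hi' ih =>
    have hiJ : i ∉ J := fun h => lt_irrefl _ (hi' i h)
    rw [op_insert_min a hi', mul_assoc, ih]
    by_cases hjJ : j ∈ J
    · simp [hjJ]
    rw [if_neg hjJ, mul_smul_comm, op_left h]
    by_cases hij : i = j
    · subst hij; simp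
    rw [if_neg (by simp [hiJ, hij]), if_neg (by simp [hjJ, Ne.symm hij]), hi_insert hiJ,
      lo_insert hjJ, lo_eq_zero (fun k hk => (hi' k hk).le), smul_smul, Finset.insert_comm, ← pow_add]
    simp

/-- geometric sum over ranks -/
lemma sum_pow_lo (c : K) (J : Finset ι) :
    ∑ j ∈ J, c ^ lo J j = ∑ r ∈ Finset.range J.card, c ^ r := by
  induction J using Finset.induction_on_max with
  | empty => simp
  | insert i J hi ih =>
    have hiJ : i ∉ J := fun h => lt_irrefl _ (hi i h)
    rw [Finset.sum_insert hiJ, Finset.card_insert_of_notMem hiJ, Finset.sum_range_succ, ← ih,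
      add_comm]
    congr 1
    · apply Finset.sum_congr rfl
      intro j hj
      rw [lo_insert hiJ, if_neg (not_lt.2 (hi j hj).le), add_zero]
    · rw [lo_insert hiJ, if_neg (lt_irrefl _), add_zero]
      congr 1
      have := lo_add_hi hiJ
      rw [hi_eq_zero (fun k hk => (hi k hk).le)] at this
      simpa using this

noncomputable def qfac (c : K) (t : ℕ) : K := ∏ s ∈ Finset.range t, ∑ r ∈ Finset.range (s+1), c ^ r

lemma sum_pow_eq [Fintype ι] {c : K} {a : ι → C} (h : QExt c a) (t : ℕ) :
    (∑ j, a j) ^ t = qfac c t • ∑ J ∈ Finset.powersetCard t Finset.univ, op a J := by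
  induction t with
  | zero => simp [qfac]
  | succ t ih =>
    have hf : qfac c (t+1) = qfac c t * ∑ r ∈ Finset.range (t+1), c ^ r :=
      Finset.prod_range_succ _ _
    rw [pow_succ', ih, mul_smul_comm, hf, mul_smul]
    congr 1
    rw [Finset.sum_mul_sum]
    simp_rw [op_left h]
    rw [Finset.smul_sum]
    have : ∀ J ∈ Finset.powersetCard (t+1) (Finset.univ : Finset ι),
        (∑ r ∈ Finset.range (t+1), c ^ r) • op a J = ∑ j ∈ J, c ^ lo J j • op a J := by
      intro J hJ
      rw [← Finset.sum_smul, sum_pow_lo, (Finset.mem_powersetCard.1 hJ).2]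
    rw [Finset.sum_congr rfl this, Finset.sum_comm]
    have : ∀ J : Finset ι, (∑ j, if j ∈ J then (0:C) else c ^ lo J j • op a (insert j J))
        = ∑ j ∈ Jᶜ, c ^ lo J j • op a (insert j J) := by
      intro J
      rw [← Finset.sum_add_sum_compl J, Finset.sum_eq_zero (s := J) (fun j hj => by simp [hj]), zero_add]
      exact Finset.sum_congr rfl (fun j hj => by simp [Finset.mem_compl.1 hj])
    simp_rw [this]
    rw [Finset.sum_sigma', Finset.sum_sigma']
    refine Finset.sum_bij' (fun p _ => ⟨insert p.2 p.1, p.2⟩) (fun p _ => ⟨p.1.erase p.2, p.2⟩)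
      ?_ ?_ ?_ ?_ ?_
    · rintro ⟨J, j⟩ hp
      simp only [Finset.mem_sigma, Finset.mem_powersetCard_univ, Finset.mem_compl] at hp ⊢
      exact ⟨by rw [Finset.card_insert_of_notMem hp.2, hp.1], Finset.mem_insert_self _ _⟩
    · rintro ⟨J, j⟩ hp
      simp only [Finset.mem_sigma, Finset.mem_powersetCard_univ, Finset.mem_compl] at hp ⊢
      exact ⟨by rw [Finset.card_erase_of_mem hp.2, hp.1]; rfl, Finset.notMem_erase _ _⟩
    · rintro ⟨J, j⟩ hp
      simp only [Finset.mem_sigma, Finset.mem_powersetCard_univ, Finset.mem_compl] at hp ⊢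
      simp [Finset.erase_insert hp.2]
    · rintro ⟨J, j⟩ hp
      simp only [Finset.mem_sigma, Finset.mem_powersetCard_univ, Finset.mem_compl] at hp ⊢
      simp [Finset.insert_erase hp.2]
    · rintro ⟨J, j⟩ hp
      simp only [Finset.mem_sigma, Finset.mem_powersetCard_univ, Finset.mem_compl] at hp ⊢
      rw [lo_insert hp.2]; simp

/-- product of a family along a function -/
lemma prod_ofFn_ext {c : K} {a : ι → C} (h : QExt c a) {t : ℕ} (g : Fin t → ι) :
    (List.ofFn fun k => a (g k)).prod = if Function.Injective g then
      c ^ ((Finset.univ.filter fun p : Fin t × Fin t => p.1 < p.2 ∧ g p.2 < g p.1).card) •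
        op a (Finset.univ.image g) else 0 := by
  induction t with
  | zero =>
    rw [if_pos (Function.injective_of_subsingleton _)]
    simp
  | succ t ih =>
    rw [List.ofFn_succ, List.prod_cons, ih (fun k => g k.succ)]
    have himg : Finset.univ.image g = insert (g 0) (Finset.univ.image fun k : Fin t => g k.succ) := by
      ext x; simp [Fin.exists_fin_succ, eq_comm]
    by_cases hi : Function.Injective fun k : Fin t => g k.succ
    · rw [if_pos hi, mul_smul_comm, op_left h]
      by_cases h0 : g 0 ∈ Finset.univ.image fun k : Fin t => g k.succ
      · rw [if_pos h0, if_neg, smul_zero]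
        intro hg
        obtain ⟨k, -, hk⟩ := Finset.mem_image.1 h0
        exact Fin.succ_ne_zero _ (hg hk)
      · rw [if_neg h0, if_pos, smul_smul, himg, ← pow_add]
        · congr 2
          unfold lo
          rw [Finset.filter_image, Finset.card_image_of_injective _ hi]
          rw [Finset.card_filter, Finset.card_filter, Finset.card_filter]
          rw [Fintype.sum_prod_type, Fintype.sum_prod_type, Fin.sum_univ_succ]
          simp_rw [Fin.sum_univ_succ]
          simp [add_comm]
        · intro k l hkl
          rw [Finset.mem_image] at h0
          push Not at h0
          induction k using Fin.cases with
          | zero =>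
            induction l using Fin.cases with
            | zero => rfl
            | succ l => exact absurd hkl.symm (h0 l (Finset.mem_univ _))
          | succ k =>
            induction l using Fin.cases with
            | zero => exact absurd hkl (h0 k (Finset.mem_univ _))
            | succ l => exact congrArg _ (hi hkl)
    · rw [if_neg hi, if_neg, mul_zero]
      intro hg
      exact hi (hg.comp (Fin.succ_injective _))

end ExtGeneric
end QG

namespace QG
section QMgeneric
variable {K : Type*} [Field K] {A : Type*} [Ring A] [Algebra K A]
variable {ι κ : Type*} [LinearOrder ι] [LinearOrder κ]

/-- quantum matrix relations for a family -/
structure IsQM (q : K) (x : ι → κ → A) : Prop where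
  row : ∀ i j l, j < l → x i j * x i l = q • (x i l * x i j)
  col : ∀ i k j, i < k → x i j * x k j = q • (x k j * x i j)
  comm : ∀ i k j l, k < i → j < l → x i j * x k l = x k l * x i j
  qrel : ∀ i k j l, i < k → j < l → x i j * x k l - x k l * x i j = (q - q⁻¹) • (x i l * x k j)

lemma IsQM.transpose {q : K} {x : ι → κ → A} (h : IsQM q x) : IsQM q (fun j i => x i j) where
  row i j l hh := h.col j l i hh
  col i k j hh := h.row j i k hh
  comm i k j l h1 h2 := (h.comm l j k i h2 h1).symm
  qrel i k j l h1 h2 := by rw [h.qrel j l i k h2 h1, h.comm l j i k h2 h1]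

lemma IsQM.map {B : Type*} [Ring B] [Algebra K B] {q : K} {x : ι → κ → A} (h : IsQM q x)
    (f : A →ₐ[K] B) : IsQM q (fun i j => f (x i j)) where
  row i j l hh := by rw [← map_mul, h.row i j l hh, map_smul, map_mul]
  col i k j hh := by rw [← map_mul, h.col i k j hh, map_smul, map_mul]
  comm i k j l h1 h2 := by rw [← map_mul, h.comm i k j l h1 h2, map_mul]
  qrel i k j l h1 h2 := by
    rw [← map_mul, ← map_mul, ← map_sub, h.qrel i k j l h1 h2, map_smul, map_mul]

lemma isQM_X (q : K) (m n : ℕ) : IsQM q (fun (i : Fin m) (j : Fin n) => X K q i j) where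
  row i j l h := by
    have := RingQuot.mkAlgHom_rel K (QMatRel.row (K := K) (q := q) i j l h)
    simpa [X] using this
  col i k j h := by
    have := RingQuot.mkAlgHom_rel K (QMatRel.col (K := K) (q := q) i k j h)
    simpa [X] using this
  comm i k j l h1 h2 := by
    have := RingQuot.mkAlgHom_rel K (QMatRel.comm (K := K) (q := q) i k j l h1 h2)
    simpa [X] using this
  qrel i k j l h1 h2 := by
    have := RingQuot.mkAlgHom_rel K (QMatRel.qrel (K := K) (q := q) i k j l h1 h2)
    simpa [X] using this

/-- universal property -/
noncomputable def liftQM {q : K} {m n : ℕ} {x : Fin m → Fin n → A} (h : IsQM q x) :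
    QMat K q m n →ₐ[K] A :=
  RingQuot.liftAlgHom K ⟨FreeAlgebra.lift K (fun p : Fin m × Fin n => x p.1 p.2), by
    intro a b hab
    induction hab with
    | row i j l hh => simpa using h.row i j l hh
    | col i k j hh => simpa using h.col i k j hh
    | comm i k j l h1 h2 => simpa using h.comm i k j l h1 h2
    | qrel i k j l h1 h2 => simpa using h.qrel i k j l h1 h2⟩

@[simp] lemma liftQM_X {q : K} {m n : ℕ} {x : Fin m → Fin n → A} (h : IsQM q x) (i : Fin m)
    (j : Fin n) : liftQM h (X K q i j) = x i j := by
  simp [liftQM, X]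

lemma adjoin_X (q : K) (m n : ℕ) :
    Algebra.adjoin K (Set.range fun p : Fin m × Fin n => X K q p.1 p.2) = ⊤ := by
  have h1 : (Set.range fun p : Fin m × Fin n => X K q p.1 p.2) =
      Set.image (RingQuot.mkAlgHom K (QMatRel K q m n)) (Set.range (FreeAlgebra.ι K)) := by
    rw [← Set.range_comp]; rfl
  rw [h1, ← AlgHom.map_adjoin, FreeAlgebra.adjoin_range_ι, Algebra.map_top, AlgHom.range_eq_top]
  exact RingQuot.mkAlgHom_surjective K _

lemma sum_pair_congr {M : Type*} [AddCommGroup M] [Fintype ι] (f g : ι → ι → M)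
    (h0 : ∀ i, f i i = g i i) (h : ∀ i k, i < k → f i k + f k i = g i k + g k i) :
    ∑ i, ∑ k, f i k = ∑ i, ∑ k, g i k := by
  have key : ∀ f : ι → ι → M, ∑ i, ∑ k, f i k =
      ∑ i, ∑ k, (if i < k then f i k + f k i else if i = k then f i i else 0) := by
    intro f
    have e1 : ∑ i, ∑ k, (if k < i then f i k else 0) = ∑ i, ∑ k, (if i < k then f k i else 0) :=
      Finset.sum_comm
    have e2 : ∑ i, ∑ k, f i k = ∑ i, ∑ k, ((if i < k then f i k else 0) +
        (if k < i then f i k else 0) + (if i = k then f i i else 0)) := by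
      refine Finset.sum_congr rfl fun i _ => Finset.sum_congr rfl fun k _ => ?_
      rcases lt_trichotomy i k with h | h | h
      · simp [h, h.ne, h.not_gt]
      · subst h; simp
      · simp [h, h.ne', h.not_gt]
    rw [e2]
    simp only [Finset.sum_add_distrib] at *
    rw [e1]
    simp only [← Finset.sum_add_distrib]
    refine Finset.sum_congr rfl fun i _ => Finset.sum_congr rfl fun k _ => ?_
    by_cases h1 : i < k
    · simp [h1, h1.ne]
    · simp [h1]
  rw [key f, key g]
  refine Finset.sum_congr rfl fun i _ => Finset.sum_congr rfl fun k _ => ?_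
  split_ifs with h1 h2
  · exact h i k h1
  · exact h0 i
  · rfl

/-- the elements `∑ i, L(x i j) F i` -/
lemma qext_col [Fintype ι] {C : Type*} [Ring C] [Algebra K C] {q : K} (hq : q ≠ 0)
    {x : ι → κ → A} (hx : IsQM q x)
    (L : A →ₐ[K] C) (F : ι → C) (hF : QExt (-q) F) (hLF : ∀ a i, Commute (F i) (L a)) :
    QExt (-q) (fun j => ∑ i, L (x i j) * F i) where
  sq j := by
    have e : ∀ i k, L (x i j) * F i * (L (x k j) * F k) = L (x i j * x k j) * (F i * F k) := by
      intro i k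
      rw [map_mul, mul_assoc, ← mul_assoc (F i), (hLF _ i).eq]
      simp only [mul_assoc]
    simp only [Finset.sum_mul_sum, e]
    rw [sum_pair_congr _ (fun _ _ => (0 : C))]
    · simp
    · intro i; simp [hF.sq]
    · intro i k hik
      simp only [hF.sw i k hik, hx.col i k j hik, map_smul, map_mul]
      simp only [smul_mul_assoc, mul_smul_comm]
      module
  sw j l hjl := by
    have e : ∀ i k j l, L (x i j) * F i * (L (x k l) * F k) = L (x i j * x k l) * (F i * F k) := by
      intro i k j l
      rw [map_mul, mul_assoc, ← mul_assoc (F i), (hLF _ i).eq]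
      simp only [mul_assoc]
    simp only [Finset.sum_mul_sum, e, Finset.smul_sum]
    apply sum_pair_congr
    · intro i; simp [hF.sq]
    · intro i k hik
      have h1 := hx.qrel i k j l hik hjl
      have h2 := hx.comm k i j l hik hjl
      rw [sub_eq_iff_eq_add] at h1
      simp only [hF.sw i k hik, h1, h2, map_smul, map_mul, map_add, add_mul, smul_add]
      simp only [smul_mul_assoc, mul_smul_comm]
      match_scalars <;> field_simp <;> ring

lemma QExt.mul {C : Type*} [Ring C] [Algebra K C] {c d : K} {a b : ι → C} (ha : QExt c a)
    (hb : QExt d b) (h : ∀ i j, Commute (b i) (a j)) : QExt (c * d) (fun i => a i * b i) where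
  sq i := by
    rw [mul_assoc, ← mul_assoc (b i), (h i i).eq, mul_assoc, ← mul_assoc, ha.sq, zero_mul]
  sw i j hij := by
    rw [mul_assoc, ← mul_assoc (b j), (h j i).eq, mul_assoc, ← mul_assoc, ha.sw i j hij,
      hb.sw i j hij, mul_assoc (a i), ← mul_assoc (b i), (h i j).eq, mul_assoc (a j), ← mul_assoc (a i)]
    simp [smul_smul, mul_comm]

lemma op_commute {C : Type*} [Ring C] {a : ι → C} {b : C} (h : ∀ i, Commute b (a i))
    (J : Finset ι) : Commute b (op a J) := by
  induction J using Finset.induction_on_min with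
  | empty => simp
  | insert i J hi ih => rw [op_insert_min _ hi]; exact (h i).mul_right ih

lemma op_mul {C : Type*} [Ring C] {a b : ι → C}
    (h : ∀ i j, Commute (b i) (a j)) (J : Finset ι) :
    op (fun i => a i * b i) J = op a J * op b J := by
  induction J using Finset.induction_on_min with
  | empty => simp
  | insert i J hi ih =>
    rw [op_insert_min _ hi, op_insert_min _ hi, op_insert_min _ hi, ih]
    have := (op_commute (h i) J).eq
    rw [mul_assoc, ← mul_assoc (b i), this]; simp only [mul_assoc]

/-- homogeneous elements of degree `t` -/
def Hom [Fintype ι] {C : Type*} [Ring C] [Algebra K C] (L : A →ₐ[K] C) (F : ι → C) (t : ℕ) (z : C) :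
    Prop := ∃ f : Finset ι → A, z = ∑ I ∈ Finset.powersetCard t Finset.univ, L (f I) * op F I

section
variable [Fintype ι] {C : Type*} [Ring C] [Algebra K C] {L : A →ₐ[K] C} {F : ι → C}
lemma Hom.zero {t : ℕ} : Hom L F t 0 := ⟨fun _ => 0, by simp⟩
lemma Hom.add {t : ℕ} {y z : C} (hy : Hom L F t y) (hz : Hom L F t z) : Hom L F t (y + z) := by
  obtain ⟨f, rfl⟩ := hy
  obtain ⟨g, rfl⟩ := hz
  exact ⟨fun I => f I + g I, by simp [add_mul, Finset.sum_add_distrib]⟩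
lemma Hom.sum {t : ℕ} {α : Type*} (s : Finset α) (y : α → C) (h : ∀ i ∈ s, Hom L F t (y i)) :
    Hom L F t (∑ i ∈ s, y i) := Finset.sum_induction _ _ (fun _ _ => Hom.add) Hom.zero h
lemma Hom.single {t : ℕ} (a : A) (I : Finset ι) (hI : I.card = t) : Hom L F t (L a * op F I) := by
  classical
  refine ⟨fun J => if J = I then a else 0, ?_⟩
  rw [Finset.sum_eq_single I]
  · simp
  · intro J _ hJ; simp [hJ]
  · intro h; simp [hI] at h

lemma Hom.step {c : K} (hF : QExt c F) (hLF : ∀ a i, Commute (F i) (L a)) {t : ℕ} {z : C}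
    (hz : Hom L F t z) (x : ι → A) : Hom L F (t+1) ((∑ i, L (x i) * F i) * z) := by
  obtain ⟨f, rfl⟩ := hz
  rw [Finset.sum_mul_sum]
  refine Hom.sum _ _ fun i _ => Hom.sum _ _ fun I hI => ?_
  rw [mul_assoc, ← mul_assoc (F i), (hLF _ i).eq, mul_assoc, ← mul_assoc, ← map_mul, op_left hF]
  split_ifs with h
  · simpa using Hom.zero
  · rw [mul_smul_comm, ← smul_mul_assoc, ← map_smul]
    apply Hom.single
    rw [Finset.card_insert_of_notMem h, (Finset.mem_powersetCard.1 hI).2]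

lemma Hom.op {c : K} (hF : QExt c F) (hLF : ∀ a i, Commute (F i) (L a)) (x : ι → κ → A)
    (J : Finset κ) : Hom L F J.card (op (fun j => ∑ i, L (x i j) * F i) J) := by
  induction J using Finset.induction_on_min with
  | empty => simpa using Hom.single (L := L) (F := F) 1 ∅ rfl
  | insert i J hi ih =>
    rw [op_insert_min _ hi, Finset.card_insert_of_notMem fun h => lt_irrefl _ (hi i h)]
    exact ih.step hF hLF _
end
end QMgeneric
end QG

namespace QG
section Model
variable {K : Type*} [Field K]

/-- exterior operator -/
noncomputable def extOp {ι : Type*} [LinearOrder ι] (W : Type*) [AddCommGroup W] [Module K W] (c : K) (i : ι) :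
    Module.End K (Finset ι → W) where
  toFun v S := if i ∈ S then c ^ lo S i • v (S.erase i) else 0
  map_add' v w := by ext S; simp only [Pi.add_apply]; split_ifs <;> simp
  map_smul' r v := by
    ext S; simp only [Pi.smul_apply, RingHom.id_apply]; split_ifs <;> simp [smul_comm r]

section
variable {ι : Type*} [LinearOrder ι] {W : Type*} [AddCommGroup W] [Module K W]
lemma extOp_apply (c : K) (i : ι) (v : Finset ι → W) (S : Finset ι) :
    extOp W c i v S = if i ∈ S then c ^ lo S i • v (S.erase i) else 0 := rfl

lemma lo_erase' {S : Finset ι} {i j : ι} (hi : i ∈ S) : lo S j = lo (S.erase i) j + if i < j then 1 else 0 := by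
  conv_lhs => rw [← Finset.insert_erase hi]
  rw [lo_insert (Finset.notMem_erase _ _)]

lemma qext_extOp (c : K) : QExt c (fun i : ι => extOp W c i) where
  sq i := by
    ext v S : 2
    simp [extOp_apply]
  sw i j hij := by
    ext v S : 2
    simp only [Module.End.mul_apply, LinearMap.smul_apply, Pi.smul_apply, extOp_apply]
    by_cases hi : i ∈ S <;> by_cases hj : j ∈ S
    · have h1 := lo_erase' (j := i) hj
      have h2 := lo_erase' (j := j) hi
      rw [if_neg hij.not_gt] at h1
      rw [if_pos hij] at h2
      simp only [hi, hj, Finset.mem_erase, ne_eq, hij.ne, hij.ne', not_false_eq_true, and_self, if_true, h1, h2,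
        smul_smul, Finset.erase_right_comm (a := i)]
      congr 1
      ring
    all_goals simp [hi, hj]

lemma op_extOp_single (c : K) (I : Finset ι) (w : W) :
    op (fun i : ι => extOp W c i) I (Pi.single ∅ w) = Pi.single I w := by
  induction I using Finset.induction_on_min with
  | empty => simp
  | insert i J hi ih =>
    have hiJ : i ∉ J := fun h => lt_irrefl _ (hi i h)
    rw [op_insert_min _ hi, Module.End.mul_apply, ih]
    ext S : 1
    rw [extOp_apply]
    by_cases h : S = insert i J
    · subst h
      simp [hiJ, lo_eq_zero (J := insert i J) (j := i) (by
        intro k hk; rcases Finset.mem_insert.1 hk with rfl | hk; exact le_rfl; exact (hi k hk).le)]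
    · rw [Pi.single_eq_of_ne h]
      split_ifs with h2
      · rw [Pi.single_eq_of_ne, smul_zero]
        intro h3
        exact h (by rw [← h3, Finset.insert_erase h2])
      · rfl
end

variable {A : Type*} [Ring A] [Algebra K A]
variable {ι κ : Type*} [LinearOrder ι] [LinearOrder κ]

variable (A ι κ) in
abbrev MV := Finset ι → Finset κ → A

variable (K A ι κ) in
noncomputable def Lop : A →ₐ[K] Module.End K (MV A ι κ) :=
  AlgHom.ofLinearMap
    { toFun := fun a => (((LinearMap.mulLeft K a).compLeft (Finset κ)).compLeft (Finset ι))
      map_add' := by intro a b; ext v S T; simp [add_mul]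
      map_smul' := by intro a b; ext v S T; simp } (by ext v S T; simp)
      (by intro a b; ext v S T; simp [mul_assoc])

@[simp] lemma Lop_apply (a : A) (v : MV A ι κ) (S : Finset ι) (T : Finset κ) :
    Lop K A ι κ a v S T = a * v S T := rfl

variable (A κ) in
noncomputable def Fop (c : K) (i : ι) : Module.End K (MV A ι κ) := extOp (Finset κ → A) c i
variable (A ι) in
noncomputable def Eop (c : K) (j : κ) : Module.End K (MV A ι κ) := (extOp A c j).compLeft (Finset ι)

lemma Fop_apply (c : K) (i : ι) (v : MV A ι κ) (S : Finset ι) (T : Finset κ) :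
    Fop A κ c i v S T = if i ∈ S then c ^ lo S i • v (S.erase i) T else 0 := by
  change (extOp (Finset κ → A) c i v S) T = _
  rw [extOp_apply]; split_ifs <;> rfl
lemma Eop_apply (c : K) (j : κ) (v : MV A ι κ) (S : Finset ι) (T : Finset κ) :
    Eop A ι c j v S T = if j ∈ T then c ^ lo T j • v S (T.erase j) else 0 := rfl

lemma qext_F (c : K) : QExt c (fun i : ι => Fop A κ c i) := qext_extOp c
lemma qext_E (c : K) : QExt c (fun j : κ => Eop A ι c j) where
  sq i := by
    ext v S T
    simp [Eop_apply]
  sw i j hij := by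
    ext v S T
    have := congrFun (congrArg (fun f => f (v S)) ((qext_extOp (K := K) (W := A) c).sw i j hij)) T
    exact this

lemma comm_LF (c : K) (a : A) (i : ι) : Commute (Fop A κ c i) (Lop K A ι κ a) := by
  ext v S T; simp [Fop_apply]
lemma comm_LE (c : K) (a : A) (j : κ) : Commute (Eop A ι c j) (Lop K A ι κ a) := by
  ext v S T; simp [Eop_apply]
lemma comm_EF (c d : K) (i : ι) (j : κ) : Commute (Fop A κ c i) (Eop A ι d j) := by
  ext v S T
  simp only [Module.End.mul_apply, Fop_apply, Eop_apply]
  split_ifs <;> simp [smul_comm (c ^ _)]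

lemma opF_single (c : K) (I : Finset ι) (w : Finset κ → A) :
    op (fun i : ι => Fop A κ c i) I (Pi.single ∅ w) = Pi.single I w := op_extOp_single c I w

lemma compLeft_single {W : Type*} [AddCommGroup W] [Module K W] (f : W →ₗ[K] W) (S : Finset ι) (w : W) :
    f.compLeft (Finset ι) (Pi.single S w) = Pi.single S (f w) := by
  ext T
  by_cases h : T = S
  · subst h; simp
  · simp [h]

lemma opE_single (c : K) (S : Finset ι) (J : Finset κ) (a : A) :
    op (fun j : κ => Eop A ι c j) J (Pi.single S (Pi.single ∅ a)) = Pi.single S (Pi.single J a) := by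
  induction J using Finset.induction_on_min with
  | empty => simp
  | insert i J hi ih =>
    rw [op_insert_min _ hi, Module.End.mul_apply, ih]
    have := op_extOp_single c (insert i J) a
    rw [op_insert_min _ hi, Module.End.mul_apply, op_extOp_single] at this
    rw [Eop, compLeft_single, this]

variable (A ι κ) in
noncomputable def v0 : MV A ι κ := Pi.single ∅ (Pi.single ∅ 1)

lemma LFE_v0 (c d : K) (a : A) (I S : Finset ι) (J T : Finset κ) :
    (Lop K A ι κ a * (op (fun i : ι => Fop A κ c i) I * op (fun j : κ => Eop A ι d j) J)) (v0 A ι κ) S T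
      = if S = I ∧ T = J then a else 0 := by
  rw [Module.End.mul_apply, Lop_apply, Module.End.mul_apply, v0, opE_single, opF_single]
  by_cases h : S = I
  · subst h
    by_cases h : T = J
    · subst h; simp
    · simp [h]
  · simp [h]

variable [Fintype ι] [Fintype κ]

noncomputable def eta (q : K) (x : ι → κ → A) (j : κ) : Module.End K (MV A ι κ) :=
  ∑ i, Lop K A ι κ (x i j) * Fop A κ (-q) i
noncomputable def omg (q : K) (x : ι → κ → A) (i : ι) : Module.End K (MV A ι κ) :=
  ∑ j, Lop K A ι κ (x i j) * Eop A ι (-q) j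

/-- column-type minors -/
noncomputable def cm (q : K) (x : ι → κ → A) (I : Finset ι) (J : Finset κ) : A :=
  op (eta q x) J (v0 A ι κ) I ∅
noncomputable def rm (q : K) (x : ι → κ → A) (I : Finset ι) (J : Finset κ) : A :=
  op (omg q x) I (v0 A ι κ) ∅ J

variable {q : K} {x : ι → κ → A}

lemma qext_eta (hq : q ≠ 0) (hx : IsQM q x) : QExt (-q) (eta q x) :=
  qext_col hq hx (Lop K A ι κ) _ (qext_F (-q)) (fun a i => comm_LF _ _ _)
lemma qext_omg (hq : q ≠ 0) (hx : IsQM q x) : QExt (-q) (omg q x) :=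
  qext_col hq hx.transpose (Lop K A ι κ) _ (qext_E (-q)) (fun a i => comm_LE _ _ _)

lemma op_eta (x : ι → κ → A) (J : Finset κ) : op (eta q x) J =
    ∑ I ∈ Finset.powersetCard J.card Finset.univ, Lop K A ι κ (cm q x I J) * op (fun i => Fop A κ (-q) i) I := by
  obtain ⟨f, hf⟩ := Hom.op (L := Lop K A ι κ) (qext_F (A := A) (ι := ι) (κ := κ) (-q)) (fun a i => comm_LF _ _ _) x J
  change op (eta q x) J = _ at hf
  rw [hf]
  refine Finset.sum_congr rfl fun I hI => ?_
  congr 2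
  rw [cm, hf, LinearMap.sum_apply, Finset.sum_apply, Finset.sum_apply, Finset.sum_eq_single I]
  · have := LFE_v0 (-q) (-q) (f I) I I (∅ : Finset κ) ∅
    simp at this
    exact this.symm
  · intro I' _ h
    have := LFE_v0 (-q) (-q) (f I') I' I (∅ : Finset κ) ∅
    simpa [h.symm] using this
  · intro h; exact absurd hI h

lemma op_omg (x : ι → κ → A) (I : Finset ι) : op (omg q x) I =
    ∑ J ∈ Finset.powersetCard I.card Finset.univ, Lop K A ι κ (rm q x I J) * op (fun j => Eop A ι (-q) j) J := by
  obtain ⟨f, hf⟩ := Hom.op (L := Lop K A ι κ) (qext_E (A := A) (ι := ι) (κ := κ) (-q)) (fun a i => comm_LE _ _ _)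
    (fun j i => x i j) I
  change op (omg q x) I = _ at hf
  rw [hf]
  refine Finset.sum_congr rfl fun J hJ => ?_
  congr 2
  rw [rm, hf, LinearMap.sum_apply, Finset.sum_apply, Finset.sum_apply, Finset.sum_eq_single J]
  · have := LFE_v0 (-q) (-q) (f J) (∅ : Finset ι) ∅ J J
    simp at this
    exact this.symm
  · intro J' _ h
    have := LFE_v0 (-q) (-q) (f J') (∅ : Finset ι) ∅ J' J
    simpa [h.symm] using this
  · intro h; exact absurd hJ h

lemma comm_E_eta (x : ι → κ → A) (j l : κ) : Commute (Eop A ι (-q) j) (eta q x l) := by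
  apply Commute.sum_right
  intro i _
  exact (comm_LE _ _ _).mul_right (comm_EF _ _ _ _).symm
lemma comm_F_omg (x : ι → κ → A) (i l : ι) : Commute (Fop A κ (-q) i) (omg q x l) := by
  apply Commute.sum_right
  intro j _
  exact (comm_LF _ _ _).mul_right (comm_EF _ _ _ _)

lemma qfac_ne_zero (hq : q ≠ 0) (hroot : ∀ k : ℕ, 0 < k → q ^ k ≠ 1) (t : ℕ) : qfac (-q * -q) t ≠ 0 := by
  rw [qfac, Finset.prod_ne_zero_iff]
  intro s _ h
  have h1 := geom_sum_mul (-q * -q) (s+1)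
  rw [h, zero_mul] at h1
  have : q ^ (2 * (s+1)) = 1 := by
    rw [pow_mul, pow_two, ← neg_mul_neg]; exact (sub_eq_zero.1 h1.symm)
  exact hroot _ (by omega) this

lemma cm_eq_rm (hq : q ≠ 0) (hroot : ∀ k : ℕ, 0 < k → q ^ k ≠ 1) (hx : IsQM q x)
    {I : Finset ι} {J : Finset κ} (h : I.card = J.card) : cm q x I J = rm q x I J := by
  have h1 : QExt (-q * -q) (fun j => eta q x j * Eop A ι (-q) j) :=
    (qext_eta hq hx).mul (qext_E _) (fun i j => comm_E_eta x i j)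
  have h2 : QExt (-q * -q) (fun i => omg q x i * Fop A κ (-q) i) :=
    (qext_omg hq hx).mul (qext_F _) (fun i j => comm_F_omg x i j)
  have h3 : ∑ j, eta q x j * Eop A ι (-q) j = ∑ i, omg q x i * Fop A κ (-q) i := by
    simp only [eta, omg, Finset.sum_mul]
    rw [Finset.sum_comm]
    refine Finset.sum_congr rfl fun i _ => Finset.sum_congr rfl fun j _ => ?_
    rw [mul_assoc, mul_assoc, (comm_EF _ _ _ _).eq]
  have h4 := sum_pow_eq h1 I.card
  rw [h3, sum_pow_eq h2 I.card] at h4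
  have h5 := (smul_right_injective _ (qfac_ne_zero hq hroot I.card)) h4
  have e1 : ∀ J' ∈ Finset.powersetCard I.card (Finset.univ : Finset κ),
      op (fun j => eta q x j * Eop A ι (-q) j) J' (v0 A ι κ) I J = if J' = J then cm q x I J else 0 := by
    intro J' hJ'
    rw [op_mul (fun i j => comm_E_eta x i j), op_eta, Finset.sum_mul, LinearMap.sum_apply,
      Finset.sum_apply, Finset.sum_apply]
    simp only [mul_assoc, LFE_v0]
    rw [(Finset.mem_powersetCard.1 hJ').2, Finset.sum_eq_single I]
    · by_cases hh : J' = J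
      · subst hh; simp
      · simp [hh, Ne.symm hh]
    · intro I' _ hI'; simp [hI'.symm]
    · simp
  have e2 : ∀ I' ∈ Finset.powersetCard I.card (Finset.univ : Finset ι),
      op (fun i => omg q x i * Fop A κ (-q) i) I' (v0 A ι κ) I J = if I' = I then rm q x I J else 0 := by
    intro I' hI'
    rw [op_mul (fun i j => comm_F_omg x i j), op_omg, Finset.sum_mul, LinearMap.sum_apply,
      Finset.sum_apply, Finset.sum_apply]
    have : ∀ J' : Finset κ, Commute (op (fun j : κ => Eop A ι (-q) j) J') (op (fun i : ι => Fop A κ (-q) i) I') :=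
      fun J' => op_commute (fun i => (op_commute (fun j => comm_EF _ _ _ _) J').symm) I'
    simp only [mul_assoc, (this _).eq, LFE_v0]
    rw [(Finset.mem_powersetCard.1 hI').2, Finset.sum_eq_single J]
    · by_cases hh : I' = I
      · subst hh; simp
      · simp [hh, Ne.symm hh]
    · intro I' _ hI'; simp [hI'.symm]
    · simp [h]
  have h6 := congrArg (fun f => f (v0 A ι κ) I J) h5
  simp only [LinearMap.sum_apply, Finset.sum_apply] at h6
  rw [Finset.sum_congr rfl e1, Finset.sum_congr rfl e2] at h6
  simp [h] at h6
  exact h6.symm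
end Model
end QG

namespace QG
section Laplace
variable {K : Type*} [Field K]
variable {A : Type*} [Ring A] [Algebra K A]
variable {ι κ : Type*} [LinearOrder ι] [LinearOrder κ] [Fintype ι] [Fintype κ]
variable {q : K} {x : ι → κ → A}

lemma row_left (hq : q ≠ 0) (hx : IsQM q x) (I : Finset ι) (J : Finset κ) (k : ι) :
    ∑ j ∈ J, (-q) ^ lo J j • (x k j * rm q x I (J.erase j)) =
      if k ∈ I then 0 else (-q) ^ lo I k • rm q x (insert k I) J := by
  have h := congrArg (fun f => f (v0 A ι κ) ∅ J) (op_left (qext_omg hq hx) I k)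
  simp only [omg, Module.End.mul_apply, LinearMap.sum_apply, Finset.sum_apply, Lop_apply, Eop_apply] at h
  change ∑ j, x k j * (if j ∈ J then (-q) ^ lo J j • rm q x I (J.erase j) else 0) = _ at h
  simp only [mul_ite, mul_zero, mul_smul_comm] at h
  rw [Finset.sum_ite_mem, Finset.univ_inter] at h
  rw [h]
  split_ifs <;> rfl

lemma col_left (hq : q ≠ 0) (hx : IsQM q x) (I : Finset ι) (J : Finset κ) (j : κ) :
    ∑ i ∈ I, (-q) ^ lo I i • (x i j * cm q x (I.erase i) J) =
      if j ∈ J then 0 else (-q) ^ lo J j • cm q x I (insert j J) := by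
  have h := congrArg (fun f => f (v0 A ι κ) I ∅) (op_left (qext_eta hq hx) J j)
  simp only [eta, Module.End.mul_apply, LinearMap.sum_apply, Finset.sum_apply, Lop_apply, Fop_apply] at h
  change ∑ i, x i j * (if i ∈ I then (-q) ^ lo I i • cm q x (I.erase i) J else 0) = _ at h
  simp only [mul_ite, mul_zero, mul_smul_comm] at h
  rw [Finset.sum_ite_mem, Finset.univ_inter] at h
  rw [h]
  split_ifs <;> rfl

lemma sum_erase_reindex {M : Type*} [AddCommGroup M] (J : Finset κ) (t : ℕ) (h : J.card = t + 1)
    (f : Finset κ → κ → M) :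
    ∑ J' ∈ Finset.powersetCard t Finset.univ, ∑ j, (if j ∉ J' ∧ J = insert j J' then f J' j else 0)
      = ∑ j ∈ J, f (J.erase j) j := by
  rw [Finset.sum_comm, ← Finset.sum_subset (Finset.subset_univ J)]
  · refine Finset.sum_congr rfl fun j hj => ?_
    rw [Finset.sum_eq_single (J.erase j)]
    · simp [Finset.insert_erase hj]
    · intro J' _ hJ'
      rw [if_neg]
      rintro ⟨h1, rfl⟩
      exact hJ' (by rw [Finset.erase_insert h1])
    · intro hh; exfalso; apply hh
      simp [Finset.card_erase_of_mem hj, h]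
  · intro j _ hj
    refine Finset.sum_eq_zero fun J' _ => ?_
    rw [if_neg]
    rintro ⟨_, rfl⟩
    exact hj (Finset.mem_insert_self _ _)

lemma row_right (hq : q ≠ 0) (hx : IsQM q x) (I : Finset ι) (J : Finset κ) (k : ι) (hc : J.card = I.card + 1) :
    ∑ j ∈ J, (-q) ^ hi J j • (rm q x I (J.erase j) * x k j) =
      if k ∈ I then 0 else (-q) ^ hi I k • rm q x (insert k I) J := by
  have h := congrArg (fun f => f (v0 A ι κ) ∅ J) (op_right (qext_omg hq hx) I k)
  rw [op_omg] at h
  rw [omg, Finset.sum_mul_sum] at h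
  have e : ∀ (J' : Finset κ) (j : κ), (Lop K A ι κ (rm q x I J') * op (fun j => Eop A ι (-q) j) J' *
      (Lop K A ι κ (x k j) * Eop A ι (-q) j)) (v0 A ι κ) ∅ J =
      if j ∉ J' ∧ J = insert j J' then (-q) ^ hi J' j • (rm q x I J' * x k j) else 0 := by
    intro J' j
    rw [mul_assoc, ← mul_assoc (op _ _), ← (op_commute (fun i => (comm_LE (-q) (x k j) i).symm) J').eq, mul_assoc,
      op_right (qext_E _), ← mul_assoc, ← map_mul]
    split_ifs with h1 h2 h3
    · exact absurd h1 h2.1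
    · simp
    · rw [mul_smul_comm, LinearMap.smul_apply, Pi.smul_apply, Pi.smul_apply]
      have := LFE_v0 (-q) (-q) (rm q x I J' * x k j) (∅ : Finset ι) ∅ (insert j J') J
      simp only [op_empty, one_mul] at this
      rw [this, if_pos ⟨by trivial, h3.2⟩]
    · rw [mul_smul_comm, LinearMap.smul_apply, Pi.smul_apply, Pi.smul_apply]
      have := LFE_v0 (-q) (-q) (rm q x I J' * x k j) (∅ : Finset ι) ∅ (insert j J') J
      simp only [op_empty, one_mul] at this
      rw [this, if_neg (fun hh => h3 ⟨h1, hh.2⟩), smul_zero]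
  simp only [LinearMap.sum_apply, Finset.sum_apply, e] at h
  rw [sum_erase_reindex J _ hc] at h
  simp only [hi_erase] at h
  rw [h]
  split_ifs <;> rfl

lemma col_right (hq : q ≠ 0) (hx : IsQM q x) (I : Finset ι) (J : Finset κ) (j : κ) (hc : I.card = J.card + 1) :
    ∑ i ∈ I, (-q) ^ hi I i • (cm q x (I.erase i) J * x i j) =
      if j ∈ J then 0 else (-q) ^ hi J j • cm q x I (insert j J) := by
  have h := congrArg (fun f => f (v0 A ι κ) I ∅) (op_right (qext_eta hq hx) J j)
  rw [op_eta] at h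
  rw [eta, Finset.sum_mul_sum] at h
  have e : ∀ (I' : Finset ι) (i : ι), (Lop K A ι κ (cm q x I' J) * op (fun j => Fop A κ (-q) j) I' *
      (Lop K A ι κ (x i j) * Fop A κ (-q) i)) (v0 A ι κ) I ∅ =
      if i ∉ I' ∧ I = insert i I' then (-q) ^ hi I' i • (cm q x I' J * x i j) else 0 := by
    intro I' i
    rw [mul_assoc, ← mul_assoc (op _ _), ← (op_commute (fun i' => (comm_LF (-q) (x i j) i').symm) I').eq, mul_assoc,
      op_right (qext_F _), ← mul_assoc, ← map_mul]
    split_ifs with h1 h2 h3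
    · exact absurd h1 h2.1
    · simp
    · rw [mul_smul_comm, LinearMap.smul_apply, Pi.smul_apply, Pi.smul_apply]
      have := LFE_v0 (-q) (-q) (cm q x I' J * x i j) (insert i I') I (∅ : Finset κ) ∅
      simp only [op_empty, mul_one] at this
      rw [this, if_pos ⟨h3.2, by trivial⟩]
    · rw [mul_smul_comm, LinearMap.smul_apply, Pi.smul_apply, Pi.smul_apply]
      have := LFE_v0 (-q) (-q) (cm q x I' J * x i j) (insert i I') I (∅ : Finset κ) ∅
      simp only [op_empty, mul_one] at this
      rw [this, if_neg (fun hh => h3 ⟨h1, hh.1⟩), smul_zero]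
  simp only [LinearMap.sum_apply, Finset.sum_apply, e] at h
  rw [sum_erase_reindex I _ hc] at h
  simp only [hi_erase] at h
  rw [h]
  split_ifs <;> rfl

/-- maximal minors -/
noncomputable def gm (q : K) (x : ι → κ → A) (J : Finset κ) : A := cm q x Finset.univ J

/-- standing hypotheses -/
structure QH (q : K) (x : ι → κ → A) : Prop where
  hq : q ≠ 0
  hroot : ∀ k : ℕ, 0 < k → q ^ k ≠ 1
  hx : IsQM q x

lemma QH.nq {q : K} {x : ι → κ → A} (h : QH q x) : (-q) ≠ 0 := neg_ne_zero.2 h.hq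

lemma gm_eq_rm (h : QH q x) {J : Finset κ} (hJ : J.card = Fintype.card ι) :
    gm q x J = rm q x Finset.univ J :=
  cm_eq_rm h.hq h.hroot h.hx (by rw [hJ, Finset.card_univ])

lemma card_erase_aux {J : Finset κ} {j : κ} {t : ℕ} (hj : j ∈ J) (hJ : J.card = t + 1) : (J.erase j).card = t := by
  rw [Finset.card_erase_of_mem hj, hJ]; rfl

lemma L1 (h : QH q x) {J : Finset κ} (hJ : J.card = Fintype.card ι + 1) (k : ι) :
    ∑ j ∈ J, (-q) ^ lo J j • (x k j * gm q x (J.erase j)) = 0 := by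
  have := row_left h.hq h.hx Finset.univ J k
  rw [if_pos (Finset.mem_univ _)] at this
  rw [← this]
  refine Finset.sum_congr rfl fun j hj => ?_
  rw [gm_eq_rm h (card_erase_aux hj hJ)]

lemma L2 (h : QH q x) {J : Finset κ} (hJ : J.card = Fintype.card ι + 1) (k : ι) :
    ∑ j ∈ J, (-q) ^ hi J j • (gm q x (J.erase j) * x k j) = 0 := by
  have := row_right h.hq h.hx Finset.univ J k (by rw [hJ, Finset.card_univ])
  rw [if_pos (Finset.mem_univ _)] at this
  rw [← this]
  refine Finset.sum_congr rfl fun j hj => ?_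
  rw [gm_eq_rm h (card_erase_aux hj hJ)]

lemma L3 (h : QH q x) {J : Finset κ} (hJ : J.card + 1 = Fintype.card ι) (j : κ) :
    ∑ i, (-q) ^ hi Finset.univ i • (cm q x (Finset.univ.erase i) J * x i j) =
      if j ∈ J then 0 else (-q) ^ hi J j • gm q x (insert j J) :=
  col_right h.hq h.hx Finset.univ J j (by rw [Finset.card_univ, hJ])

lemma plucker (h : QH q x) {I J : Finset κ} (hI : I.card + 1 = Fintype.card ι)
    (hJ : J.card = Fintype.card ι + 1) :
    ∑ j ∈ J \ I, (-q) ^ (lo J j + hi I j) • (gm q x (insert j I) * gm q x (J.erase j)) = 0 := by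
  have e : ∑ j ∈ J, (-q) ^ lo J j • ((∑ i, (-q) ^ hi Finset.univ i • (cm q x (Finset.univ.erase i) I * x i j))
      * gm q x (J.erase j)) = 0 := by
    simp only [Finset.sum_mul, Finset.smul_sum]
    rw [Finset.sum_comm]
    refine Finset.sum_eq_zero fun i _ => ?_
    have := congrArg (fun z => (-q) ^ hi Finset.univ i • (cm q x (Finset.univ.erase i) I * z)) (L1 h hJ i)
    simp only [mul_zero, smul_zero, Finset.mul_sum, Finset.smul_sum] at this
    rw [← this]
    refine Finset.sum_congr rfl fun j _ => ?_
    rw [smul_mul_assoc, mul_smul_comm, smul_comm, mul_assoc]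
  rw [← e, ← Finset.sum_subset (Finset.sdiff_subset (s := J) (t := I))]
  · refine Finset.sum_congr rfl fun j hj => ?_
    rw [L3 h hI, if_neg (Finset.mem_sdiff.1 hj).2, smul_mul_assoc, smul_smul, pow_add]
  · intro j hj hj2
    rw [L3 h hI, if_pos, zero_mul, smul_zero]
    by_contra h3; exact hj2 (Finset.mem_sdiff.2 ⟨hj, h3⟩)

lemma gm_central (h : QH q x) {M : Finset κ} (hM : M.card = Fintype.card ι) {j : κ} (hj : j ∈ M) (k : ι) :
    gm q x M * x k j = x k j * gm q x M := by
  have hc : ∀ (l : ι) (j' : κ), j' ∈ M → (Finset.univ.erase l).card = (M.erase j').card := by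
    intro l j' hj'
    rw [Finset.card_erase_of_mem (Finset.mem_univ _), Finset.card_erase_of_mem hj', hM, Finset.card_univ]
  have e1 : ∀ l : ι, ∑ j' ∈ M, (-q) ^ lo M j' • (x k j' * cm q x (Finset.univ.erase l) (M.erase j')) =
      if k = l then (-q) ^ lo Finset.univ k • gm q x M else 0 := by
    intro l
    have := row_left h.hq h.hx (Finset.univ.erase l) M k
    rw [Finset.sum_congr rfl (fun j' hj' => by rw [cm_eq_rm h.hq h.hroot h.hx (hc l j' hj')]), this]
    by_cases hkl : k = l
    · subst hkl
      rw [if_neg (by simp), if_pos rfl, lo_erase, Finset.insert_erase (Finset.mem_univ _), gm_eq_rm h hM]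
    · rw [if_pos (by simp [hkl]), if_neg hkl]
  have e2 : ∀ j' ∈ M, ∑ i, (-q) ^ hi Finset.univ i • (cm q x (Finset.univ.erase i) (M.erase j') * x i j) =
      if j' = j then (-q) ^ hi M j • gm q x M else 0 := by
    intro j' hj'
    rw [L3 h (by rw [Finset.card_erase_of_mem hj', hM]; have := Finset.card_pos.2 ⟨j, hj⟩; omega)]
    by_cases hh : j' = j
    · subst hh
      rw [if_neg (by simp), if_pos rfl, hi_erase, Finset.insert_erase hj]
    · rw [if_pos (by simp [hj, Ne.symm hh]), if_neg hh]
  have e3 : ∑ l, (-q) ^ hi Finset.univ l • ((∑ j' ∈ M, (-q) ^ lo M j' • (x k j' * cm q x (Finset.univ.erase l) (M.erase j')))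
      * x l j) = ∑ j' ∈ M, (-q) ^ lo M j' • (x k j' *
      ∑ i, (-q) ^ hi Finset.univ i • (cm q x (Finset.univ.erase i) (M.erase j') * x i j)) := by
    simp only [Finset.sum_mul, Finset.mul_sum, Finset.smul_sum]
    rw [Finset.sum_comm]
    refine Finset.sum_congr rfl fun j' _ => Finset.sum_congr rfl fun l _ => ?_
    rw [smul_mul_assoc, mul_smul_comm, smul_comm, mul_assoc]
  simp only [e1] at e3
  rw [Finset.sum_congr (s₁ := M) rfl (fun j' hj' => by rw [e2 j' hj'])] at e3
  simp only [ite_mul, zero_mul, smul_ite, smul_zero, mul_ite, mul_zero, Finset.sum_ite_eq, Finset.sum_ite_eq',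
    Finset.mem_univ, if_true, hj, smul_mul_assoc, mul_smul_comm, smul_smul, ← pow_add] at e3
  have f1 : hi Finset.univ k + lo Finset.univ k = lo M j + hi M j := by
    have a1 := lo_add_hi (Finset.notMem_erase k Finset.univ)
    have a2 := lo_add_hi (Finset.notMem_erase j M)
    rw [lo_erase, hi_erase] at a1 a2
    rw [a2, add_comm, a1, hc k j hj]
  rw [f1] at e3
  exact smul_right_injective _ (pow_ne_zero _ h.nq) e3

lemma R1 (h : QH q x) {N : Finset κ} (hN : N.card + 1 = Fintype.card ι) {a b : κ} (ha : a ∉ N) (hb : b ∉ N)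
    (hab : a < b) : gm q x (insert a N) * gm q x (insert b N) = q • (gm q x (insert b N) * gm q x (insert a N)) := by
  have haN : a ∉ insert b N := by simp [ha, hab.ne]
  have e := plucker h hN (J := insert a (insert b N))
    (by rw [Finset.card_insert_of_notMem haN, Finset.card_insert_of_notMem hb, hN])
  have e1 : (insert a (insert b N)) \ N = {a, b} := by
    ext z; simp only [Finset.mem_sdiff, Finset.mem_insert, Finset.mem_singleton]
    constructor
    · tauto
    · rintro (rfl | rfl) <;> simp [ha, hb]
  have e2 : (insert a (insert b N)).erase b = insert a N := by
    rw [Finset.insert_comm, Finset.erase_insert (by simp [hb, hab.ne'])]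
  rw [e1, Finset.sum_pair hab.ne, Finset.erase_insert haN, e2, lo_insert haN, lo_insert haN, lo_insert hb, lo_insert hb,
    if_neg (lt_irrefl _), if_neg hab.not_gt, if_pos hab, if_neg (lt_irrefl _)] at e
  have a1 := lo_add_hi ha
  have a2 := lo_add_hi hb
  have f1 : lo N a + 0 + 0 + hi N a = N.card := by omega
  have f2 : lo N b + 0 + 1 + hi N b = N.card + 1 := by omega
  rw [f1, f2, pow_succ, mul_smul, ← smul_add, smul_eq_zero_iff_right (pow_ne_zero _ h.nq), neg_smul,
    ← sub_eq_add_neg, sub_eq_zero] at e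
  exact e

lemma plucker3 (h : QH q x) {N : Finset κ} (hN : N.card + 2 = Fintype.card ι) {k a b c : κ} (hk : k ∉ N) (ha : a ∉ N) (hb : b ∉ N)
    (hc : c ∉ N) (hka : k ≠ a) (hkb : k ≠ b) (hkc : k ≠ c) (hab : a < b) (hbc : b < c) :
    (-q) ^ (if a < k then 1 else 0) • (gm q x (insert a (insert k N)) * gm q x (insert b (insert c N))) +
    (-q) ^ (1 + if b < k then 1 else 0) • (gm q x (insert b (insert k N)) * gm q x (insert a (insert c N))) +
    (-q) ^ (2 + if c < k then 1 else 0) • (gm q x (insert c (insert k N)) * gm q x (insert a (insert b N))) = 0 := by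
  have hac := hab.trans hbc
  have hb' : b ∉ insert c N := by simp [hb, hbc.ne]
  have ha' : a ∉ insert b (insert c N) := by simp [ha, hac.ne, hab.ne]
  have e := plucker h (I := insert k N) (J := insert a (insert b (insert c N)))
    (by rw [Finset.card_insert_of_notMem hk, ← hN])
    (by rw [Finset.card_insert_of_notMem ha', Finset.card_insert_of_notMem hb', Finset.card_insert_of_notMem hc, ← hN])
  have e1 : (insert a (insert b (insert c N))) \ (insert k N) = {a, b, c} := by
    ext z; simp only [Finset.mem_sdiff, Finset.mem_insert, Finset.mem_singleton]
    constructor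
    · tauto
    · rintro (rfl | rfl | rfl) <;> simp [ha, hb, hc, hka.symm, hkb.symm, hkc.symm]
  have e2 : (insert a (insert b (insert c N))).erase b = insert a (insert c N) := by
    rw [Finset.insert_comm, Finset.erase_insert (by simp [hb, hab.ne', hbc.ne])]
  have e3 : (insert a (insert b (insert c N))).erase c = insert a (insert b N) := by
    rw [Finset.insert_comm b c, Finset.insert_comm a c, Finset.erase_insert (by simp [hc, hac.ne', hbc.ne'])]
  rw [e1, Finset.sum_insert (by simp [hab.ne, hac.ne]), Finset.sum_pair hbc.ne, Finset.erase_insert ha', e2, e3] at e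
  simp only [lo_insert ha', lo_insert hb', lo_insert hc, hi_insert hk, hab, hbc, hac, hab.not_gt, hbc.not_gt, hac.not_gt,
    lt_irrefl, if_true, if_false] at e
  have a1 := lo_add_hi ha
  have a2 := lo_add_hi hb
  have a3 := lo_add_hi hc
  have f1 : ∀ t, lo N a + 0 + 0 + 0 + (hi N a + t) = N.card + t := by intro t; omega
  have f2 : ∀ t, lo N b + 0 + 0 + 1 + (hi N b + t) = N.card + (1 + t) := by intro t; omega
  have f3 : ∀ t, lo N c + 0 + 1 + 1 + (hi N c + t) = N.card + (2 + t) := by intro t; omega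
  rw [f1, f2, f3, pow_add _ N.card, pow_add _ N.card, pow_add _ N.card, mul_smul, mul_smul, mul_smul, ← smul_add, ← smul_add,
    smul_eq_zero_iff_right (pow_ne_zero _ h.nq), ← add_assoc] at e
  exact e

lemma R2_aux {M : Type*} [AddCommGroup M] [Module K M] {q : K} (hq : q ≠ 0) (hroot : ∀ k : ℕ, 0 < k → q ^ k ≠ 1)
    {P P' Q Q' S S' : M} (p1 : (-q) ^ 0 • P + (-q) ^ (1 + 0) • Q + (-q) ^ (2 + 0) • S = 0)
    (p2 : (-q) ^ 1 • P + (-q) ^ (1 + 0) • S' + (-q) ^ (2 + 0) • Q' = 0)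
    (p3 : (-q) ^ 1 • Q + (-q) ^ (1 + 1) • S' + (-q) ^ (2 + 0) • P' = 0)
    (p4 : (-q) ^ 1 • S + (-q) ^ (1 + 1) • Q' + (-q) ^ (2 + 1) • P' = 0) :
    S = S' ∧ Q - Q' = (q - q⁻¹) • S ∧ P = q ^ 2 • P' ∧ P = q • Q - q ^ 2 • S := by
  have h2 : q ^ 2 + 1 ≠ 0 := by
    intro h0
    apply hroot 4 (by norm_num)
    linear_combination (q^2 - 1) * h0
  have s1 : S = S' := by
    linear_combination (norm := skip) (q^2+1)⁻¹ • p1 + (q * (q^2+1))⁻¹ • p2 - (q^2+1)⁻¹ • p3 - (q * (q^2+1))⁻¹ • p4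
    match_scalars <;> field_simp <;> ring
  subst s1
  refine ⟨rfl, ?_, ?_, ?_⟩
  · linear_combination (norm := skip) (-q⁻¹) • p3 - (q^2)⁻¹ • p4
    match_scalars <;> field_simp <;> ring
  · linear_combination (norm := skip) (-q⁻¹) • p2 + q⁻¹ • p4
    match_scalars <;> field_simp <;> ring
  · linear_combination (norm := skip) p1
    match_scalars <;> field_simp <;> ring

lemma R2 (h : QH q x) {N : Finset κ} (hN : N.card + 2 = Fintype.card ι) {a b c d : κ} (ha : a ∉ N) (hb : b ∉ N)
    (hc : c ∉ N) (hd : d ∉ N) (hab : a < b) (hbc : b < c) (hcd : c < d) :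
    let g := fun s t => gm q x (insert s (insert t N))
    g a d * g b c = g b c * g a d ∧ g a c * g b d - g b d * g a c = (q - q⁻¹) • (g a d * g b c) ∧
    g a b * g c d = q ^ 2 • (g c d * g a b) ∧ g a b * g c d = q • (g a c * g b d) - q ^ 2 • (g a d * g b c) := by
  intro g
  have hac := hab.trans hbc
  have had := hac.trans hcd
  have hbd := hbc.trans hcd
  have gs : ∀ s t, gm q x (insert s (insert t N)) = gm q x (insert t (insert s N)) := fun s t => by
    rw [Finset.insert_comm]
  have p1 := plucker3 h hN ha hb hc hd hab.ne hac.ne had.ne hbc hcd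
  have p2 := plucker3 h hN hb ha hc hd hab.ne' hbc.ne hbd.ne hac hcd
  have p3 := plucker3 h hN hc ha hb hd hac.ne' hbc.ne' hcd.ne hab hbd
  have p4 := plucker3 h hN hd ha hb hc had.ne' hbd.ne' hcd.ne' hab hbc
  simp only [hab, hbc, hcd, hac, hbd, had, hab.not_gt, hbc.not_gt, hcd.not_gt, hac.not_gt, hbd.not_gt, had.not_gt, if_true, if_false,
    gs b a, gs c a, gs d a, gs c b, gs d b, gs d c] at p1 p2 p3 p4
  simp only [g]
  set ab := gm q x (insert a (insert b N))
  set ac := gm q x (insert a (insert c N))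
  set ad := gm q x (insert a (insert d N))
  set bc := gm q x (insert b (insert c N))
  set bd := gm q x (insert b (insert d N))
  set cd := gm q x (insert c (insert d N))
  exact R2_aux h.hq h.hroot p1 p2 p3 p4
end Laplace
end QG

namespace QG
section Laplace2
variable {K : Type*} [Field K]
variable {A : Type*} [Ring A] [Algebra K A]
variable {ι κ : Type*} [LinearOrder ι] [LinearOrder κ] [Fintype ι] [Fintype κ]
variable {q : K} {x : ι → κ → A}

lemma card_exch {M : Finset κ} {a j : κ} (hj : j ∈ M) (ha : a ∉ M) : (insert a (M.erase j)).card = M.card := by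
  rw [Finset.card_insert_of_notMem (by simp [ha]), Finset.card_erase_of_mem hj]
  have := Finset.card_pos.2 ⟨j, hj⟩; omega

/-- `[M]` and an exchanged minor -/
lemma R1M (h : QH q x) {M : Finset κ} (hM : M.card = Fintype.card ι) {a j : κ} (hj : j ∈ M) (ha : a ∉ M) :
    (j < a → gm q x M * gm q x (insert a (M.erase j)) = q • (gm q x (insert a (M.erase j)) * gm q x M)) ∧
    (a < j → gm q x M * gm q x (insert a (M.erase j)) = q⁻¹ • (gm q x (insert a (M.erase j)) * gm q x M)) := by
  have hN : (M.erase j).card + 1 = Fintype.card ι := by rw [Finset.card_erase_add_one hj, hM]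
  constructor
  · intro hja
    have := R1 h hN (a := j) (b := a) (by simp) (by simp [ha]) hja
    rwa [Finset.insert_erase hj] at this
  · intro hja
    have := R1 h hN (a := a) (b := j) (by simp [ha]) (by simp) hja
    rw [Finset.insert_erase hj] at this
    rw [this, smul_smul, inv_mul_cancel₀ h.hq, one_smul]

lemma gm_scale (h : QH q x) {M : Finset κ} (hM : M.card = Fintype.card ι) {a : κ} (ha : a ∉ M) (k : ι) :
    ((∀ j ∈ M, j < a) → gm q x M * x k a * gm q x M = q • (x k a * gm q x M * gm q x M)) ∧
    ((∀ j ∈ M, a < j) → gm q x M * x k a * gm q x M = q⁻¹ • (x k a * gm q x M * gm q x M)) := by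
  have e := L1 h (J := insert a M) (by rw [Finset.card_insert_of_notMem ha, hM]) k
  rw [Finset.sum_insert ha, Finset.erase_insert ha] at e
  have he : ∀ j ∈ M, (insert a M).erase j = insert a (M.erase j) := by
    intro j hj
    rw [Finset.erase_insert_of_ne]
    rintro rfl; exact ha hj
  have key : ∀ r : K, (∀ j ∈ M, gm q x M * gm q x (insert a (M.erase j)) = r • (gm q x (insert a (M.erase j)) * gm q x M)) →
      gm q x M * x k a * gm q x M = r • (x k a * gm q x M * gm q x M) := by
    intro r hr
    have e1 := congrArg (fun z => gm q x M * z) e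
    have e2 := congrArg (fun z => r • (z * gm q x M)) e
    simp only [mul_add, add_mul, smul_add, mul_zero, zero_mul, smul_zero, Finset.mul_sum, Finset.sum_mul, Finset.smul_sum] at e1 e2
    have e3 : ∑ j ∈ M, gm q x M * (-q) ^ lo (insert a M) j • (x k j * gm q x ((insert a M).erase j)) =
        ∑ j ∈ M, r • ((-q) ^ lo (insert a M) j • (x k j * gm q x ((insert a M).erase j)) * gm q x M) := by
      refine Finset.sum_congr rfl fun j hj => ?_
      rw [he j hj, mul_smul_comm, ← mul_assoc, gm_central h hM hj, mul_assoc, hr j hj, smul_mul_assoc, mul_smul_comm,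
        smul_comm, mul_assoc]
    rw [e3] at e1
    have e4 := add_right_cancel (e1.trans e2.symm)
    rw [mul_smul_comm, smul_mul_assoc, smul_comm r] at e4
    have := smul_right_injective _ (pow_ne_zero _ h.nq) e4
    simpa [mul_assoc] using this
  constructor
  · intro hh; exact key q fun j hj => (R1M h hM hj ha).1 (hh j hj)
  · intro hh; exact key q⁻¹ fun j hj => (R1M h hM hj ha).2 (hh j hj)

lemma prod_ofFn_sum {C : Type*} [Ring C] [Algebra K C] (L : A →ₐ[K] C) (F : ι → C) (hLF : ∀ a i, Commute (F i) (L a))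
    {t : ℕ} (y : ι → Fin t → A) :
    (List.ofFn fun k => ∑ i, L (y i k) * F i).prod =
      ∑ f : Fin t → ι, L (List.ofFn fun k => y (f k) k).prod * (List.ofFn fun k => F (f k)).prod := by
  induction t with
  | zero => simp
  | succ t ih =>
    rw [List.ofFn_succ, List.prod_cons, ih (fun i k => y i k.succ)]
    rw [← (Fin.consEquiv (fun _ : Fin (t+1) => ι)).sum_comp, Fintype.sum_prod_type, Finset.sum_mul_sum]
    refine Finset.sum_congr rfl fun i _ => Finset.sum_congr rfl fun f _ => ?_
    simp only [Fin.consEquiv, Equiv.coe_fn_mk, List.ofFn_succ, Fin.cons_zero, Fin.cons_succ, List.prod_cons, map_mul]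
    rw [mul_assoc, ← mul_assoc (F i), (hLF _ i).eq]
    simp only [mul_assoc]

lemma sort_eq_ofFn (J : Finset κ) {t : ℕ} (hJ : J.card = t) : J.sort (· ≤ ·) = List.ofFn (J.orderEmbOfFin hJ) := by
  subst hJ
  apply List.ext_getElem
  · simp
  · intro i h1 h2
    simp [Finset.orderEmbOfFin_apply]
end Laplace2

variable {K : Type*} [Field K] {q : K}

lemma QH_X (hq : q ≠ 0) (hroot : ∀ k : ℕ, 0 < k → q ^ k ≠ 1) (m n : ℕ) :
    QH q (fun (i : Fin m) (j : Fin n) => X K q i j) := ⟨hq, hroot, isQM_X q m n⟩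

lemma grMinor_eq {m n : ℕ} {J : Finset (Fin n)} (hJ : J.card = m) :
    grMinor K q m J = gm q (fun (i : Fin m) (j : Fin n) => X K q i j) J := by
  rw [grMinor, dif_pos hJ, gm, cm, op, sort_eq_ofFn J hJ, List.map_ofFn]
  have e := prod_ofFn_sum (Lop K (QMat K q m n) (Fin m) (Fin n)) (fun i => Fop (QMat K q m n) (Fin n) (-q) i)
    (fun a i => comm_LF _ _ _) (fun i k => X K q i (J.orderEmbOfFin hJ k))
  have e' : (List.ofFn (eta q (fun (i : Fin m) (j : Fin n) => X K q i j) ∘ (J.orderEmbOfFin hJ))) =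
    (List.ofFn fun k => ∑ i, (Lop K (QMat K q m n) (Fin m) (Fin n)) (X K q i (J.orderEmbOfFin hJ k)) *
      Fop (QMat K q m n) (Fin n) (-q) i) := rfl
  rw [e', e, qMinor, LinearMap.sum_apply, Finset.sum_apply, Finset.sum_apply]
  simp only [prod_ofFn_ext (qext_F (A := QMat K q m n) (ι := Fin m) (κ := Fin n) (-q))]
  rw [← Finset.sum_subset (Finset.subset_univ (Finset.univ.image (fun σ : Equiv.Perm (Fin m) => (σ : Fin m → Fin m))))]
  · rw [Finset.sum_image (fun a _ b _ h => DFunLike.coe_injective h)]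
    refine Finset.sum_congr rfl fun σ _ => ?_
    rw [if_pos σ.injective, mul_smul_comm, LinearMap.smul_apply, Pi.smul_apply, Pi.smul_apply]
    have himg : Finset.univ.image (σ : Fin m → Fin m) = Finset.univ := Finset.image_univ_of_surjective σ.surjective
    have := LFE_v0 (-q) (-q) ((List.ofFn fun k => X K q (σ k) (J.orderEmbOfFin hJ k)).prod)
      (Finset.univ : Finset (Fin m)) Finset.univ (∅ : Finset (Fin n)) ∅
    simp only [op_empty, mul_one, and_self, if_true] at this
    rw [himg, this]
    rfl
  · intro f _ hf
    rw [if_neg, mul_zero]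
    · rfl
    · intro hinj
      apply hf
      rw [Finset.mem_image]
      exact ⟨Equiv.ofBijective f (Finite.injective_iff_bijective.1 hinj), Finset.mem_univ _, rfl⟩
end QG

namespace QG
variable {K : Type*} [Field K]

/-- the relations between maximal minors we use -/
structure GrRel {B : Type*} [Ring B] [Algebra K B] (q : K) (m : ℕ) {n : ℕ} (G : Finset (Fin n) → B) : Prop where
  hq : q ≠ 0
  r1 : ∀ (N : Finset (Fin n)) (a b : Fin n), N.card + 1 = m → a ∉ N → b ∉ N → a < b →
    G (insert a N) * G (insert b N) = q • (G (insert b N) * G (insert a N))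
  r2 : ∀ (N : Finset (Fin n)) (a b c d : Fin n), N.card + 2 = m → a ∉ N → b ∉ N → c ∉ N → d ∉ N → a < b → b < c → c < d →
    let g := fun s t => G (insert s (insert t N))
    g a d * g b c = g b c * g a d ∧ g a c * g b d - g b d * g a c = (q - q⁻¹) • (g a d * g b c) ∧
    g a b * g c d = q ^ 2 • (g c d * g a b) ∧ g a b * g c d = q • (g a c * g b d) - q ^ 2 • (g a d * g b c)
  pl : ∀ (I J : Finset (Fin n)), I.card + 1 = m → J.card = m + 1 →
    ∑ j ∈ J \ I, (-q) ^ (lo J j + hi I j) • (G (insert j I) * G (J.erase j)) = 0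

lemma grRel_grMinor {q : K} (hq : q ≠ 0) (hroot : ∀ k : ℕ, 0 < k → q ^ k ≠ 1) (m n : ℕ) :
    GrRel q m (fun J : Finset (Fin n) => grMinor K q m J) where
  hq := hq
  r1 N a b hN ha hb hab := by
    have h := QH_X hq hroot m n
    beta_reduce
    rw [grMinor_eq, grMinor_eq]
    · exact R1 h (by simpa using hN) ha hb hab
    · rw [Finset.card_insert_of_notMem hb, hN]
    · rw [Finset.card_insert_of_notMem ha, hN]
  r2 N a b c d hN ha hb hc hd hab hbc hcd := by
    have h := QH_X hq hroot m n
    have hac := hab.trans hbc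
    have had := hac.trans hcd
    have hbd := hbc.trans hcd
    have e : ∀ s t, s ∉ N → t ∉ N → s < t → grMinor K q m (insert s (insert t N)) =
      gm q (fun (i : Fin m) (j : Fin n) => X K q i j) (insert s (insert t N)) := by
      intro s t hs ht hst
      apply grMinor_eq
      rw [Finset.card_insert_of_notMem (by simp [hs, hst.ne]), Finset.card_insert_of_notMem ht, ← hN]
    intro g
    simp only [g, e a b ha hb hab, e a c ha hc hac, e a d ha hd had, e b c hb hc hbc, e b d hb hd hbd, e c d hc hd hcd]
    exact R2 h (by simpa using hN) ha hb hc hd hab hbc hcd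
  pl I J hI hJ := by
    have h := QH_X hq hroot m n
    rw [← plucker h (I := I) (J := J) (by simpa using hI) (by simpa using hJ)]
    refine Finset.sum_congr rfl fun j hj => ?_
    rw [Finset.mem_sdiff] at hj
    rw [grMinor_eq, grMinor_eq]
    · exact card_erase_aux hj.1 hJ
    · rw [Finset.card_insert_of_notMem hj.2, hI]

lemma GrRel.map {B C : Type*} [Ring B] [Algebra K B] [Ring C] [Algebra K C] {q : K} {m n : ℕ} {G : Finset (Fin n) → B}
    (h : GrRel q m G) (f : B →ₐ[K] C) : GrRel q m (fun J => f (G J)) where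
  hq := h.hq
  r1 N a b hN ha hb hab := by
    rw [← map_mul, h.r1 N a b hN ha hb hab, map_smul, map_mul]
  r2 N a b c d hN ha hb hc hd hab hbc hcd := by
    obtain ⟨h1, h2, h3, h4⟩ := h.r2 N a b c d hN ha hb hc hd hab hbc hcd
    refine ⟨?_, ?_, ?_, ?_⟩
    · simpa using congrArg f h1
    · simpa using congrArg f h2
    · simpa using congrArg f h3
    · simpa using congrArg f h4
  pl I J hI hJ := by simpa using congrArg f (h.pl I J hI hJ)

lemma GrRel.of_map {B C : Type*} [Ring B] [Algebra K B] [Ring C] [Algebra K C] {q : K} {m n : ℕ} {G : Finset (Fin n) → B}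
    (f : B →ₐ[K] C) (hf : Function.Injective f) (h : GrRel q m (fun J => f (G J))) : GrRel q m G where
  hq := h.hq
  r1 N a b hN ha hb hab := by
    apply hf
    simpa using h.r1 N a b hN ha hb hab
  r2 N a b c d hN ha hb hc hd hab hbc hcd := by
    obtain ⟨h1, h2, h3, h4⟩ := h.r2 N a b c d hN ha hb hc hd hab hbc hcd
    refine ⟨?_, ?_, ?_, ?_⟩ <;> apply hf
    · simpa using h1
    · simpa using h2
    · simpa using h3
    · simpa using h4
  pl I J hI hJ := by apply hf; simpa using h.pl I J hI hJ

lemma grRel_grE {q : K} (hq : q ≠ 0) (hroot : ∀ k : ℕ, 0 < k → q ^ k ≠ 1) (m n : ℕ) :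
    GrRel q m (fun J : Finset (Fin n) => grE K q m J) :=
  GrRel.of_map (qGrass K q m n).val Subtype.val_injective (grRel_grMinor hq hroot m n)

/-- combinatorial configuration for dehomogenisation -/
structure Cfg (m N n : ℕ) where
  M : Finset (Fin n)
  b : Fin m → Fin n
  a : Fin N → Fin n
  aft : Fin N → Bool
  hb : StrictAnti b
  bM : ∀ i, b i ∈ M
  Mb : ∀ z ∈ M, ∃ i, b i = z
  aM : ∀ j, a j ∉ M
  Ma : ∀ z, z ∉ M → ∃ j, a j = z
  h_aft : ∀ j, aft j = true → ∀ z ∈ M, z < a j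
  h_bef : ∀ j, aft j = false → ∀ z ∈ M, a j < z
  mono : ∀ j l, j < l → aft j = aft l → a j < a l
  mix : ∀ j l, j < l → aft l = true → aft j = true

namespace Cfg
variable {m N n : ℕ} (c : Cfg m N n)

lemma cardM : c.M.card = m := by
  have : c.M = Finset.univ.image c.b := by
    ext z; simp only [Finset.mem_image, Finset.mem_univ, true_and]
    constructor
    · exact c.Mb z
    · rintro ⟨i, rfl⟩; exact c.bM i
  rw [this, Finset.card_image_of_injective _ c.hb.injective, Finset.card_univ, Fintype.card_fin]

/-- exchanged index set -/
def J (i : Fin m) (j : Fin N) : Finset (Fin n) := insert (c.a j) (c.M.erase (c.b i))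

/-- commutation scalar -/
def s (q : K) (j : Fin N) : K := if c.aft j = true then q else q⁻¹

lemma s_ne {q : K} (hq : q ≠ 0) (j : Fin N) : c.s q j ≠ 0 := by
  unfold s; split_ifs; exact hq; exact inv_ne_zero hq

section
variable {B : Type*} [Ring B] [Algebra K B] {q : K} {G : Finset (Fin n) → B} (h : GrRel q m G)

lemma uJ (h : GrRel q m G) (i : Fin m) (j : Fin N) : G c.M * G (c.J i j) = c.s q j • (G (c.J i j) * G c.M) := by
  have hN : (c.M.erase (c.b i)).card + 1 = m := by rw [Finset.card_erase_add_one (c.bM i), c.cardM]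
  unfold s J
  cases hj : c.aft j
  · have := h.r1 _ (c.a j) (c.b i) hN (by simp [c.aM j]) (by simp) (c.h_bef j hj _ (c.bM i))
    rw [Finset.insert_erase (c.bM i)] at this
    rw [this, smul_smul, if_neg (by simp), inv_mul_cancel₀ h.hq, one_smul]
  · have := h.r1 _ (c.b i) (c.a j) hN (by simp) (by simp [c.aM j]) (c.h_aft j hj _ (c.bM i))
    rw [Finset.insert_erase (c.bM i)] at this
    rw [this, if_pos rfl]

lemma uinvJ (h : GrRel q m G) (u : Bˣ) (hu : (u : B) = G c.M) (i : Fin m) (j : Fin N) :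
    ((u⁻¹ : Bˣ) : B) * G (c.J i j) = (c.s q j)⁻¹ • (G (c.J i j) * ((u⁻¹ : Bˣ) : B)) := by
  have e := c.uJ h i j
  rw [← hu] at e
  have e1 : G (c.J i j) = c.s q j • (((u⁻¹ : Bˣ) : B) * G (c.J i j) * u) := by
    rw [mul_assoc, ← mul_smul_comm, ← e, Units.inv_mul_cancel_left]
  conv_rhs => rw [e1]
  rw [smul_mul_assoc, smul_smul, inv_mul_cancel₀ (c.s_ne h.hq j), one_smul, Units.mul_inv_cancel_right]

/-- the dehomogenised generators -/
def xi (G : Finset (Fin n) → B) (u : Bˣ) (i : Fin m) (j : Fin N) : B := G (c.J i j) * ((u⁻¹ : Bˣ) : B)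

lemma xi_mul (h : GrRel q m G) (u : Bˣ) (hu : (u : B) = G c.M) (i k : Fin m) (j l : Fin N) :
    c.xi G u i j * c.xi G u k l = (c.s q l)⁻¹ • (G (c.J i j) * G (c.J k l) * (((u⁻¹ : Bˣ) : B) * ((u⁻¹ : Bˣ) : B))) := by
  unfold xi
  rw [mul_assoc, ← mul_assoc ((u⁻¹ : Bˣ) : B), c.uinvJ h u hu, smul_mul_assoc, mul_smul_comm]
  simp only [mul_assoc]

lemma u_xi (h : GrRel q m G) (u : Bˣ) (hu : (u : B) = G c.M) (i : Fin m) (j : Fin N) :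
    (u : B) * c.xi G u i j = c.s q j • (c.xi G u i j * u) := by
  unfold xi
  rw [← mul_assoc, hu, c.uJ h, smul_mul_assoc, ← hu]
  simp [mul_assoc]

/-- base set for two rows -/
lemma J_eq {i k : Fin m} (hik : i ≠ k) (j : Fin N) :
    c.J i j = insert (c.a j) (insert (c.b k) ((c.M.erase (c.b i)).erase (c.b k))) := by
  rw [J, Finset.insert_erase]
  simp [c.bM, c.hb.injective.ne hik.symm]

lemma isQM_xi (h : GrRel q m G) (u : Bˣ) (hu : (u : B) = G c.M) : IsQM q (c.xi G u) where
  row i j l hjl := by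
    rw [c.xi_mul h u hu, c.xi_mul h u hu]
    have hN : (c.M.erase (c.b i)).card + 1 = m := by rw [Finset.card_erase_add_one (c.bM i), c.cardM]
    have key : (c.s q l)⁻¹ • (G (c.J i j) * G (c.J i l)) = q • (c.s q j)⁻¹ • (G (c.J i l) * G (c.J i j)) := by
      have hj0 : c.a j ∉ c.M.erase (c.b i) := by simp [c.aM]
      have hl0 : c.a l ∉ c.M.erase (c.b i) := by simp [c.aM]
      unfold J s
      cases hj : c.aft j <;> cases hl : c.aft l
      · rw [h.r1 _ _ _ hN hj0 hl0 (c.mono j l hjl (by rw [hj, hl]))]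
        simp only [Bool.false_eq_true, if_false, if_true]
        rw [smul_comm]
      · have := c.mix j l hjl hl; simp [hj] at this
      · rw [h.r1 _ _ _ hN hl0 hj0 ((c.h_bef l hl _ (c.bM i)).trans (c.h_aft j hj _ (c.bM i)))]
        have := h.hq
        simp only [Bool.false_eq_true, if_false, if_true]
        match_scalars
        field_simp
      · rw [h.r1 _ _ _ hN hj0 hl0 (c.mono j l hjl (by rw [hj, hl]))]
        simp only [Bool.false_eq_true, if_false, if_true]
        rw [smul_comm]
    rw [← smul_mul_assoc, key, smul_mul_assoc, smul_mul_assoc]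
  col i k j hik := by
    rw [c.xi_mul h u hu, c.xi_mul h u hu]
    have hN : (((c.M.erase (c.b i)).erase (c.b k))).card + 2 = m := by
      have hne := c.hb.injective.ne hik.ne'
      have h1 := Finset.card_erase_add_one (s := c.M.erase (c.b i)) (a := c.b k) (by simp [c.bM, hne])
      have h2 := Finset.card_erase_add_one (c.bM i)
      have := c.cardM
      omega
    have hbne : c.b k ≠ c.b i := c.hb.injective.ne hik.ne'
    have hja : ∀ z ∈ c.M, c.a j ≠ z := by rintro z hz rfl; exact c.aM j hz
    have e := h.r1 (insert (c.a j) ((c.M.erase (c.b i)).erase (c.b k))) (c.b k) (c.b i)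
      (by rw [Finset.card_insert_of_notMem (by simp [c.aM])]; omega)
      (by simp [(hja _ (c.bM k)).symm]) (by simp [(hja _ (c.bM i)).symm]) (c.hb hik)
    have j1 := c.J_eq hik.ne j
    have j2 := c.J_eq hik.ne' j
    rw [Finset.insert_comm] at j1 j2
    rw [Finset.erase_right_comm] at j2
    rw [j1, j2, e, smul_mul_assoc, smul_comm]
  comm i k j l hki hjl := by
    rw [c.xi_mul h u hu, c.xi_mul h u hu]
    suffices key : (c.s q l)⁻¹ • (G (c.J i j) * G (c.J k l)) = (c.s q j)⁻¹ • (G (c.J k l) * G (c.J i j)) by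
      simpa only [smul_mul_assoc] using congrArg (· * (((u⁻¹ : Bˣ) : B) * ((u⁻¹ : Bˣ) : B))) key
    have hbne : c.b k ≠ c.b i := c.hb.injective.ne hki.ne
    have hN : (((c.M.erase (c.b i)).erase (c.b k))).card + 2 = m := by
      have h1 := Finset.card_erase_add_one (s := c.M.erase (c.b i)) (a := c.b k) (by simp [c.bM, hbne])
      have h2 := Finset.card_erase_add_one (c.bM i)
      have := c.cardM
      omega
    have hq := h.hq
    have j1 := c.J_eq hki.ne' j
    have j2 := c.J_eq hki.ne l
    rw [Finset.erase_right_comm] at j2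
    rw [j1, j2]
    unfold s
    have hj0 : c.a j ∉ (c.M.erase (c.b i)).erase (c.b k) := by simp [c.aM]
    have hl0 : c.a l ∉ (c.M.erase (c.b i)).erase (c.b k) := by simp [c.aM]
    have hi0 : c.b i ∉ (c.M.erase (c.b i)).erase (c.b k) := by simp
    have hk0 : c.b k ∉ (c.M.erase (c.b i)).erase (c.b k) := by simp
    cases hj : c.aft j <;> cases hl : c.aft l
    · obtain ⟨e, -⟩ := h.r2 _ (c.a j) (c.a l) (c.b i) (c.b k) hN hj0 hl0 hi0 hk0 (c.mono j l hjl (by rw [hj, hl]))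
        (c.h_bef l hl _ (c.bM i)) (c.hb hki)
      dsimp only at e
      rw [e]
    · have := c.mix j l hjl hl; simp [hj] at this
    · obtain ⟨-, -, e, -⟩ := h.r2 _ (c.a l) (c.b i) (c.b k) (c.a j) hN hl0 hi0 hk0 hj0 (c.h_bef l hl _ (c.bM i))
        (c.hb hki) (c.h_aft j hj _ (c.bM k))
      simp only [Finset.insert_comm (c.b k) (c.a j)] at e
      rw [e]
      simp only [Bool.false_eq_true, if_false, if_true]
      match_scalars
      field_simp
    · obtain ⟨e, -⟩ := h.r2 _ (c.b i) (c.b k) (c.a j) (c.a l) hN hi0 hk0 hj0 hl0 (c.hb hki) (c.h_aft j hj _ (c.bM k))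
        (c.mono j l hjl (by rw [hj, hl]))
      simp only [Finset.insert_comm (c.b k) (c.a j), Finset.insert_comm (c.b i) (c.a l)] at e
      rw [e]
  qrel i k j l hik hjl := by
    rw [c.xi_mul h u hu, c.xi_mul h u hu, c.xi_mul h u hu]
    suffices key : (c.s q l)⁻¹ • (G (c.J i j) * G (c.J k l)) - (c.s q j)⁻¹ • (G (c.J k l) * G (c.J i j))
        = (q - q⁻¹) • (c.s q j)⁻¹ • (G (c.J i l) * G (c.J k j)) by
      simpa only [smul_mul_assoc, sub_mul] using congrArg (· * (((u⁻¹ : Bˣ) : B) * ((u⁻¹ : Bˣ) : B))) key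
    have hbne : c.b k ≠ c.b i := c.hb.injective.ne hik.ne'
    have hN : (((c.M.erase (c.b i)).erase (c.b k))).card + 2 = m := by
      have h1 := Finset.card_erase_add_one (s := c.M.erase (c.b i)) (a := c.b k) (by simp [c.bM, hbne])
      have h2 := Finset.card_erase_add_one (c.bM i)
      have := c.cardM
      omega
    have hq := h.hq
    have j1 := c.J_eq hik.ne j
    have j2 := c.J_eq hik.ne' l
    have j3 := c.J_eq hik.ne l
    have j4 := c.J_eq hik.ne' j
    rw [Finset.erase_right_comm] at j2 j4
    rw [j1, j2, j3, j4]
    unfold s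
    have hj0 : c.a j ∉ (c.M.erase (c.b i)).erase (c.b k) := by simp [c.aM]
    have hl0 : c.a l ∉ (c.M.erase (c.b i)).erase (c.b k) := by simp [c.aM]
    have hi0 : c.b i ∉ (c.M.erase (c.b i)).erase (c.b k) := by simp
    have hk0 : c.b k ∉ (c.M.erase (c.b i)).erase (c.b k) := by simp
    cases hj : c.aft j <;> cases hl : c.aft l
    · obtain ⟨e1, e2, -⟩ := h.r2 _ (c.a j) (c.a l) (c.b k) (c.b i) hN hj0 hl0 hk0 hi0 (c.mono j l hjl (by rw [hj, hl]))
        (c.h_bef l hl _ (c.bM k)) (c.hb hik)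
      dsimp only at e1 e2
      rw [e1] at e2
      simp only [Bool.false_eq_true, if_false]
      rw [← smul_sub, e2, smul_comm]
    · have := c.mix j l hjl hl; simp [hj] at this
    · obtain ⟨e1, e2, e3, e4⟩ := h.r2 _ (c.a l) (c.b k) (c.b i) (c.a j) hN hl0 hk0 hi0 hj0 (c.h_bef l hl _ (c.bM k))
        (c.hb hik) (c.h_aft j hj _ (c.bM i))
      simp only [Finset.insert_comm (c.b k) (c.a j), Finset.insert_comm (c.b i) (c.a j)] at e1 e2 e3 e4
      rw [sub_eq_iff_eq_add] at e2
      rw [e4, e2]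
      simp only [Bool.false_eq_true, if_false, if_true]
      match_scalars <;> field_simp <;> ring
    · obtain ⟨e1, e2, -⟩ := h.r2 _ (c.b k) (c.b i) (c.a j) (c.a l) hN hk0 hi0 hj0 hl0 (c.hb hik) (c.h_aft j hj _ (c.bM i))
        (c.mono j l hjl (by rw [hj, hl]))
      simp only [Finset.insert_comm (c.b k) (c.a j), Finset.insert_comm (c.b i) (c.a l), Finset.insert_comm (c.b k) (c.a l),
        Finset.insert_comm (c.b i) (c.a j)] at e1 e2
      simp only [if_true]
      rw [← smul_sub, e2, smul_comm]

lemma G_mem (h : GrRel q m G) (u : Bˣ) (hu : (u : B) = G c.M) (S : Subalgebra K B) (hS : ∀ i j, c.xi G u i j ∈ S)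
    (hu1 : (u : B) ∈ S) (hu2 : ((u⁻¹ : Bˣ) : B) ∈ S) (I : Finset (Fin n)) (hI : I.card = m) : G I ∈ S := by
  induction hd : (I \ c.M).card using Nat.strong_induction_on generalizing I with
  | _ d ih =>
    subst hd
    rcases (I \ c.M).eq_empty_or_nonempty with h0 | ⟨z, hz⟩
    · rw [Finset.sdiff_eq_empty_iff_subset] at h0
      rw [Finset.eq_of_subset_of_card_le h0 (by rw [hI, c.cardM]), ← hu]
      exact hu1
    · rw [Finset.mem_sdiff] at hz
      obtain ⟨jz, hjz⟩ := c.Ma z hz.2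
      have hJmem : ∀ y ∈ c.M, G (insert z (c.M.erase y)) ∈ S := by
        intro y hy
        obtain ⟨i, rfl⟩ := c.Mb y hy
        have : G (insert z (c.M.erase (c.b i))) = c.xi G u i jz * u := by
          rw [xi, J, hjz, mul_assoc, Units.inv_mul, mul_one]
        rw [this]
        exact S.mul_mem (hS _ _) hu1
      have e := h.pl (I.erase z) (insert z c.M) (by rw [Finset.card_erase_add_one hz.1, hI])
        (by rw [Finset.card_insert_of_notMem hz.2, c.cardM])
      have e1 : (insert z c.M) \ I.erase z = insert z (c.M \ I) := by
        ext y; simp only [Finset.mem_sdiff, Finset.mem_insert, Finset.mem_erase]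
        constructor
        · rintro ⟨h1 | h1, h2⟩
          · exact Or.inl h1
          · by_cases h3 : y = z
            · exact Or.inl h3
            · exact Or.inr ⟨h1, fun h4 => h2 ⟨h3, h4⟩⟩
        · rintro (h1 | h1)
          · exact ⟨Or.inl h1, fun h2 => h2.1 h1⟩
          · exact ⟨Or.inr h1.1, fun h2 => h1.2 h2.2⟩
      rw [e1, Finset.sum_insert (by simp [hz.1]), Finset.insert_erase hz.1, Finset.erase_insert hz.2] at e
      have e2 : ∑ j ∈ c.M \ I, (-q) ^ (lo (insert z c.M) j + hi (I.erase z) j) •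
          (G (insert j (I.erase z)) * G ((insert z c.M).erase j)) ∈ S := by
        refine S.sum_mem fun y hy => S.smul_mem (S.mul_mem ?_ ?_) _
        · rw [Finset.mem_sdiff] at hy
          refine ih _ ?_ _ ?_ rfl
          · apply Finset.card_lt_card
            rw [Finset.ssubset_iff_of_subset]
            · exact ⟨z, Finset.mem_sdiff.2 hz, by
                simp only [Finset.mem_sdiff, Finset.mem_insert, Finset.mem_erase]
                rintro ⟨h1 | h1, h2⟩
                · subst h1; exact hy.2 hz.1
                · exact h1.1 rfl⟩
            · intro w
              simp only [Finset.mem_sdiff, Finset.mem_insert, Finset.mem_erase]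
              rintro ⟨h1 | h1, h2⟩
              · subst h1; exact absurd hy.1 h2
              · exact ⟨h1.2, h2⟩
          · rw [card_exch hz.1 hy.2, hI]
        · rw [Finset.mem_sdiff] at hy
          rw [Finset.erase_insert_of_ne (by rintro rfl; exact hz.2 hy.1)]
          exact hJmem y hy.1
      have e3 := eq_neg_of_add_eq_zero_left e
      have e4 : G I * G c.M ∈ S := by
        have h5 := S.neg_mem e2
        rw [← e3] at h5
        have h6 := S.smul_mem h5 (((-q) ^ (lo (insert z c.M) z + hi (I.erase z) z))⁻¹)
        rwa [smul_smul, inv_mul_cancel₀ (pow_ne_zero _ (neg_ne_zero.2 h.hq)), one_smul] at h6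
      have := S.mul_mem e4 hu2
      rwa [← hu, mul_assoc, Units.mul_inv, mul_one] at this
end
end Cfg
end QG

namespace QG
variable {K : Type*} [Field K]
section
variable {ι κ : Type*} [LinearOrder ι] [LinearOrder κ] {A : Type*} [Ring A] [Algebra K A] {q : K} {x : ι → κ → A}

lemma IsQM.sw_eq (h : IsQM q x) (hq : q ≠ 0) {a b : κ} (hab : a < b) (i : ι) : x i b * x i a = q⁻¹ • (x i a * x i b) := by
  rw [h.row i a b hab, smul_smul, inv_mul_cancel₀ hq, one_smul]
lemma IsQM.sw_lt (h : IsQM q x) {a b : κ} (hab : a < b) {i k : ι} (hik : i < k) : x i b * x k a = x k a * x i b :=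
  (h.comm k i a b hik hab).symm
lemma IsQM.sw_gt (h : IsQM q x) {a b : κ} (hab : a < b) {i k : ι} (hik : i < k) :
    x k b * x i a = x i a * x k b - (q - q⁻¹) • (x k a * x i b) := by
  rw [← h.sw_lt hab hik, ← h.qrel i k a b hik hab]; abel

/-- diagonal scalar -/
def dd (q : K) (t : Bool) (k l : ι) : K := if k = l then (if t = true then q else q⁻¹) else 1
/-- off-diagonal scalar -/
def gg (q : K) (t : Bool) (k l : ι) : K :=
  if t = true then (if k < l then q - q⁻¹ else 0) else (if l < k then -(q - q⁻¹) else 0)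

lemma dd_self (q : K) (k : ι) : dd q true k k = q := by simp [dd]
lemma dd_self' (q : K) (k : ι) : dd q false k k = q⁻¹ := by simp [dd]
lemma dd_lt (q : K) (t : Bool) {k l : ι} (h : k < l) : dd q t k l = 1 := by simp [dd, h.ne]
lemma dd_gt (q : K) (t : Bool) {k l : ι} (h : k < l) : dd q t l k = 1 := by simp [dd, h.ne']
lemma gg_self (q : K) (t : Bool) (k : ι) : gg q t k k = 0 := by simp [gg]
lemma gg_lt (q : K) {k l : ι} (h : k < l) : gg q true k l = q - q⁻¹ := by simp [gg, h]
lemma gg_gt (q : K) {k l : ι} (h : k < l) : gg q true l k = 0 := by simp [gg, h.not_gt]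
lemma gg_lt' (q : K) {k l : ι} (h : k < l) : gg q false k l = 0 := by simp [gg, h.not_gt]
lemma gg_gt' (q : K) {k l : ι} (h : k < l) : gg q false l k = -(q - q⁻¹) := by simp [gg, h]

/-- entry of the matrix representing `x l a`, contracted with a weight -/
def ent (q : K) (x : ι → κ → A) (tp : κ → Bool) (w : ι → K) (l : ι) (a : κ) (r : ι) : A :=
  (w r * dd q (tp a) r l) • x l a + (w l * gg q (tp a) r l) • x r a

/-- contracted product -/
def ent2 (q : K) (x : ι → κ → A) (tp : κ → Bool) (w : ι → K) (l : ι) (a : κ) (l' : ι) (a' : κ) (r : ι) : A :=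
  dd q (tp a) r l • (x l a * ent q x tp w l' a' r) + gg q (tp a) r l • (x r a * ent q x tp w l' a' l)

lemma ent2_row (h : IsQM q x) (hq : q ≠ 0) (tp : κ → Bool) (hm : ∀ a b, a < b → tp a = true → tp b = true) (w : ι → K)
    (l : ι) (a b : κ) (hab : a < b) (r : ι) : ent2 q x tp w l a l b r = q • ent2 q x tp w l b l a r := by
  unfold ent2 ent
  cases hta : tp a <;> cases htb : tp b
  case true.false => have := hm a b hab hta; simp [htb] at this
  all_goals
    rcases lt_trichotomy r l with hr | rfl | hr
    all_goals
      simp only [dd_self, dd_self', gg_self, mul_add, add_mul, mul_smul_comm, smul_mul_assoc, h.sw_eq hq hab, smul_add,smul_sub,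
        mul_one, mul_zero, zero_smul, add_zero, zero_add, one_smul] <;>
      (try simp only [dd_lt _ _ hr, dd_gt _ _ hr, gg_lt _ hr, gg_gt _ hr, gg_lt' _ hr, gg_gt' _ hr, h.sw_lt hab hr, h.sw_gt hab hr, smul_sub, 
        mul_one, mul_zero, zero_smul, add_zero, zero_add, one_smul]) <;>
      match_scalars <;> field_simp <;> ring


lemma ent2_col (h : IsQM q x) (hq : q ≠ 0) (tp : κ → Bool) (w : ι → K)
    (l k : ι) (a : κ) (hlk : l < k) (r : ι) : ent2 q x tp w l a k a r = q • ent2 q x tp w k a l a r := by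
  unfold ent2 ent
  have hc := fun i k hik => h.col i k a hik
  cases hta : tp a
  all_goals
    rcases lt_trichotomy r l with hr | rfl | hr
    on_goal 3 => rcases lt_trichotomy r k with hr' | rfl | hr'
    all_goals
      simp only [dd_self, dd_self', gg_self, mul_add, add_mul, mul_smul_comm, smul_mul_assoc, smul_add, smul_sub,
        mul_one, mul_zero, zero_smul, add_zero, zero_add, one_smul,
        dd_lt _ _ hlk, dd_gt _ _ hlk, gg_lt _ hlk, gg_gt _ hlk, gg_lt' _ hlk, gg_gt' _ hlk, hc _ _ hlk] <;>
      (try have hr' := hr.trans hlk) <;>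
      (try simp only [dd_lt _ _ hr, dd_gt _ _ hr, gg_lt _ hr, gg_gt _ hr, gg_lt' _ hr, gg_gt' _ hr, hc _ _ hr, smul_sub,
        mul_one, mul_zero, zero_smul, add_zero, zero_add, one_smul]) <;>
      (try simp only [dd_lt _ _ hr', dd_gt _ _ hr', gg_lt _ hr', gg_gt _ hr', gg_lt' _ hr', gg_gt' _ hr', hc _ _ hr', smul_sub,
        mul_one, mul_zero, zero_smul, add_zero, zero_add, one_smul]) <;>
      match_scalars <;> field_simp <;> ring

lemma ent2_comm (h : IsQM q x) (hq : q ≠ 0) (tp : κ → Bool) (hm : ∀ a b, a < b → tp a = true → tp b = true) (w : ι → K)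
    (l k : ι) (a b : κ) (hlk : l < k) (hab : a < b) (r : ι) : ent2 q x tp w k a l b r = ent2 q x tp w l b k a r := by
  unfold ent2 ent
  cases hta : tp a <;> cases htb : tp b
  case true.false => have := hm a b hab hta; simp [htb] at this
  all_goals
    rcases lt_trichotomy r l with hr | rfl | hr
    on_goal 3 => rcases lt_trichotomy r k with hr' | rfl | hr'
    all_goals
      simp only [dd_self, dd_self', gg_self, mul_add, add_mul, mul_smul_comm, smul_mul_assoc, smul_add, smul_sub,
        mul_one, mul_zero, zero_smul, add_zero, zero_add, one_smul, h.sw_eq hq hab, h.sw_lt hab hlk, h.sw_gt hab hlk,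
        dd_lt _ _ hlk, dd_gt _ _ hlk, gg_lt _ hlk, gg_gt _ hlk, gg_lt' _ hlk, gg_gt' _ hlk] <;>
      (try have hr' := hr.trans hlk) <;>
      (try simp only [dd_lt _ _ hr, dd_gt _ _ hr, gg_lt _ hr, gg_gt _ hr, gg_lt' _ hr, gg_gt' _ hr, h.sw_lt hab hr, h.sw_gt hab hr, smul_sub,
        mul_one, mul_zero, zero_smul, add_zero, zero_add, one_smul]) <;>
      (try simp only [dd_lt _ _ hr', dd_gt _ _ hr', gg_lt _ hr', gg_gt _ hr', gg_lt' _ hr', gg_gt' _ hr', h.sw_lt hab hr', h.sw_gt hab hr', smul_sub,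
        mul_one, mul_zero, zero_smul, add_zero, zero_add, one_smul]) <;>
      match_scalars <;> field_simp <;> ring

lemma ent2_qrel (h : IsQM q x) (hq : q ≠ 0) (tp : κ → Bool) (hm : ∀ a b, a < b → tp a = true → tp b = true) (w : ι → K)
    (l k : ι) (a b : κ) (hlk : l < k) (hab : a < b) (r : ι) :
    ent2 q x tp w l a k b r - ent2 q x tp w k b l a r = (q - q⁻¹) • ent2 q x tp w l b k a r := by
  unfold ent2 ent
  cases hta : tp a <;> cases htb : tp b
  case true.false => have := hm a b hab hta; simp [htb] at this
  all_goals
    rcases lt_trichotomy r l with hr | rfl | hr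
    on_goal 3 => rcases lt_trichotomy r k with hr' | rfl | hr'
    all_goals
      simp only [dd_self, dd_self', gg_self, mul_add, add_mul, mul_smul_comm, smul_mul_assoc, smul_add, smul_sub,
        mul_one, mul_zero, zero_smul, add_zero, zero_add, one_smul, h.sw_eq hq hab, h.sw_lt hab hlk, h.sw_gt hab hlk,
        dd_lt _ _ hlk, dd_gt _ _ hlk, gg_lt _ hlk, gg_gt _ hlk, gg_lt' _ hlk, gg_gt' _ hlk] <;>
      (try have hr' := hr.trans hlk) <;>
      (try simp only [dd_lt _ _ hr, dd_gt _ _ hr, gg_lt _ hr, gg_gt _ hr, gg_lt' _ hr, gg_gt' _ hr, h.sw_lt hab hr, h.sw_gt hab hr, smul_sub,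
        mul_one, mul_zero, zero_smul, add_zero, zero_add, one_smul]) <;>
      (try simp only [dd_lt _ _ hr', dd_gt _ _ hr', gg_lt _ hr', gg_gt _ hr', gg_lt' _ hr', gg_gt' _ hr', h.sw_lt hab hr', h.sw_gt hab hr', smul_sub,
        mul_one, mul_zero, zero_smul, add_zero, zero_add, one_smul]) <;>
      match_scalars <;> field_simp <;> ring

end
end QG

namespace QG
variable {K : Type*} [Field K]
section
variable {ι κ : Type*} [LinearOrder ι] [Fintype ι] [LinearOrder κ] {A : Type*} [Ring A] [Algebra K A] {q : K} {x : ι → κ → A}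

/-- matrix representing `x l a` -/
def thm (q : K) (x : ι → κ → A) (tp : κ → Bool) (l : ι) (a : κ) : Matrix ι ι A :=
  fun r s => ent q x tp (fun t => if t = s then 1 else 0) l a r

lemma thm_mul (q : K) (x : ι → κ → A) (tp : κ → Bool) (l : ι) (a : κ) (Y : Matrix ι ι A) (r s : ι) :
    (thm q x tp l a * Y) r s = dd q (tp a) r l • (x l a * Y r s) + gg q (tp a) r l • (x r a * Y l s) := by
  rw [Matrix.mul_apply]
  simp only [thm, ent, ite_mul, one_mul, zero_mul, ite_smul, zero_smul, add_mul, Finset.sum_add_distrib, smul_mul_assoc,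
    Finset.sum_ite_eq, Finset.mem_univ, if_true]

lemma thm_mul_thm (q : K) (x : ι → κ → A) (tp : κ → Bool) (l : ι) (a : κ) (l' : ι) (a' : κ) (r s : ι) :
    (thm q x tp l a * thm q x tp l' a') r s = ent2 q x tp (fun t => if t = s then 1 else 0) l a l' a' r := by
  rw [thm_mul]; rfl

lemma isQM_thm (h : IsQM q x) (hq : q ≠ 0) (tp : κ → Bool) (hm : ∀ a b, a < b → tp a = true → tp b = true) :
    IsQM q (thm q x tp) where
  row i j l hjl := by
    ext r s
    rw [Matrix.smul_apply, thm_mul_thm, thm_mul_thm, ent2_row h hq tp hm _ _ _ _ hjl]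
  col i k j hik := by
    ext r s
    rw [Matrix.smul_apply, thm_mul_thm, thm_mul_thm, ent2_col h hq tp _ _ _ _ hik]
  comm i k j l hki hjl := by
    ext r s
    rw [thm_mul_thm, thm_mul_thm, ent2_comm h hq tp hm _ _ _ _ _ hki hjl]
  qrel i k j l hik hjl := by
    ext r s
    rw [Matrix.smul_apply, Matrix.sub_apply, thm_mul_thm, thm_mul_thm, thm_mul_thm, ent2_qrel h hq tp hm _ _ _ _ _ hik hjl]
end

lemma qmat_induction {q : K} {m n : ℕ} {p : QMat K q m n → Prop} (one : p 1) (add : ∀ v w, p v → p w → p (v + w))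
    (smul : ∀ (c : K) v, p v → p (c • v)) (mulX : ∀ i j v, p v → p (X K q i j * v)) (v : QMat K q m n) : p v := by
  have key : ∀ a : QMat K q m n, ∀ v, p v → p (a * v) := by
    intro a
    have ha : a ∈ Algebra.adjoin K (Set.range fun p : Fin m × Fin n => X K q p.1 p.2) := by rw [adjoin_X]; trivial
    induction ha using Algebra.adjoin_induction with
    | mem x hx => obtain ⟨⟨i, j⟩, rfl⟩ := hx; exact fun v => mulX i j v
    | algebraMap r => intro v hv; rw [← Algebra.smul_def]; exact smul r v hv
    | add x y _ _ hx hy => intro v hv; rw [add_mul]; exact add _ _ (hx v hv) (hy v hv)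
    | mul x y _ _ hx hy => intro v hv; rw [mul_assoc]; exact hx _ (hy v hv)
  simpa using key v 1 one

/-- data for the representation -/
structure TH (q : K) {N : ℕ} (tp : Fin N → Bool) : Prop where
  hq : q ≠ 0
  hm : ∀ a b, a < b → tp a = true → tp b = true

section
variable {q : K} {m N : ℕ} {tp : Fin N → Bool}

/-- the operators for the columns in `M` -/
noncomputable def PP (h : TH q tp) (k b : Fin m) : Module.End K (QMat K q m N) :=
  { toFun := fun v => liftQM (isQM_thm (isQM_X q m N) h.hq tp h.hm) v k b
    map_add' := fun v w => by rw [map_add, Matrix.add_apply]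
    map_smul' := fun c v => by rw [map_smul, Matrix.smul_apply]; rfl }

lemma PP_one (h : TH q tp) (k b : Fin m) : PP h k b (1 : QMat K q m N) = if k = b then 1 else 0 := by
  simp [PP, Matrix.one_apply]

lemma PP_X (h : TH q tp) (k b l : Fin m) (a : Fin N) (v : QMat K q m N) :
    PP h k b (X K q l a * v) = dd q (tp a) k l • (X K q l a * PP h k b v) + gg q (tp a) k l • (X K q k a * PP h l b v) := by
  simp only [PP, LinearMap.coe_mk, AddHom.coe_mk, map_mul, liftQM_X]
  exact thm_mul _ _ _ _ _ _ _ _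

/-- relations at a vector -/
structure PRel (h : TH q tp) (v : QMat K q m N) : Prop where
  row : ∀ (k b b' : Fin m), b < b' → PP h k b' (PP h k b v) = q⁻¹ • PP h k b (PP h k b' v)
  lt : ∀ (i k b b' : Fin m), b < b' → i < k → PP h i b' (PP h k b v) = PP h k b (PP h i b' v)
  gt : ∀ (i k b b' : Fin m), b < b' → i < k → PP h k b' (PP h i b v) =
    PP h i b (PP h k b' v) - (q - q⁻¹) • PP h k b (PP h i b' v)
  col : ∀ (i k b : Fin m), i < k → PP h i b (PP h k b v) = q • PP h k b (PP h i b v)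

lemma PP2_one (h : TH q tp) (i k b c : Fin m) : PP h i b (PP h k c (1 : QMat K q m N)) =
    if (i = b ∧ k = c) then 1 else 0 := by
  rw [PP_one]
  by_cases h1 : k = c
  · simp [h1, PP_one]
  · simp [h1]

lemma pRel_one (h : TH q tp) : PRel h (1 : QMat K q m N) where
  row k b b' hb := by
    rw [PP2_one, PP2_one, if_neg, if_neg, smul_zero]
    · rintro ⟨rfl, rfl⟩; exact lt_irrefl _ hb
    · rintro ⟨rfl, rfl⟩; exact lt_irrefl _ hb
  lt i k b b' hb hik := by
    rw [PP2_one, PP2_one]; simp only [and_comm]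
  gt i k b b' hb hik := by
    rw [PP2_one, PP2_one, PP2_one, if_neg (c := k = b ∧ i = b'), smul_zero, sub_zero]
    · simp only [and_comm]
    · rintro ⟨rfl, rfl⟩; exact lt_asymm hb hik
  col i k b hik := by
    rw [PP2_one, PP2_one, if_neg, if_neg, smul_zero]
    · rintro ⟨rfl, rfl⟩; exact lt_irrefl _ hik
    · rintro ⟨rfl, rfl⟩; exact lt_irrefl _ hik

lemma pRel_add (h : TH q tp) {v w : QMat K q m N} (hv : PRel h v) (hw : PRel h w) : PRel h (v + w) where
  row k b b' hb := by simp only [map_add, smul_add, hv.row k b b' hb, hw.row k b b' hb]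
  lt i k b b' hb hik := by simp only [map_add, hv.lt i k b b' hb hik, hw.lt i k b b' hb hik]
  gt i k b b' hb hik := by
    simp only [map_add, hv.gt i k b b' hb hik, hw.gt i k b b' hb hik, smul_add]; abel
  col i k b hik := by simp only [map_add, smul_add, hv.col i k b hik, hw.col i k b hik]

lemma pRel_smul (h : TH q tp) (c : K) {v : QMat K q m N} (hv : PRel h v) : PRel h (c • v) where
  row k b b' hb := by simp only [map_smul, hv.row k b b' hb, smul_comm c]
  lt i k b b' hb hik := by simp only [map_smul, hv.lt i k b b' hb hik]
  gt i k b b' hb hik := by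
    simp only [map_smul, hv.gt i k b b' hb hik, smul_sub, smul_comm c]
  col i k b hik := by simp only [map_smul, hv.col i k b hik, smul_comm c]

lemma pRel_X (h : TH q tp) (l : Fin m) (a : Fin N) {v : QMat K q m N} (hv : PRel h v) : PRel h (X K q l a * v) where
  row k b b' hb := by
    have hq := h.hq
    have e1 := fun k => hv.row k b b' hb
    have e2 := fun i k hik => hv.lt i k b b' hb hik
    have e3 := fun i k hik => hv.gt i k b b' hb hik
    cases ht : tp a
    all_goals
      rcases lt_trichotomy l k with hr | rfl | hr
      all_goals
        simp only [PP_X, map_add, map_smul, ht, dd_self, dd_self', gg_self, mul_add, mul_sub, mul_smul_comm, smul_add, smul_sub,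
          mul_one, mul_zero, zero_smul, smul_zero, add_zero, zero_add, one_smul, e1] <;>
        (try simp only [dd_lt _ _ hr, dd_gt _ _ hr, gg_lt _ hr, gg_gt _ hr, gg_lt' _ hr, gg_gt' _ hr, e2 _ _ hr, e3 _ _ hr,
          mul_add, mul_sub, mul_smul_comm, smul_add, smul_sub, zero_smul, add_zero, zero_add, one_smul]) <;>
        match_scalars <;> field_simp <;> ring
  lt i k b b' hb hik := by
    have hq := h.hq
    have e1 := fun k => hv.row k b b' hb
    have e2 := fun i k hik => hv.lt i k b b' hb hik
    have e3 := fun i k hik => hv.gt i k b b' hb hik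
    cases ht : tp a
    all_goals
      rcases lt_trichotomy l i with hr | rfl | hr
      on_goal 3 => rcases lt_trichotomy l k with hr' | rfl | hr'
      all_goals
        simp only [PP_X, map_add, map_smul, ht, dd_self, dd_self', gg_self, mul_add, mul_sub, mul_smul_comm, smul_add, smul_sub,
          mul_one, mul_zero, zero_smul, smul_zero, add_zero, zero_add, one_smul, e1, e2 _ _ hik, e3 _ _ hik,
          dd_lt _ _ hik, dd_gt _ _ hik, gg_lt _ hik, gg_gt _ hik, gg_lt' _ hik, gg_gt' _ hik] <;>
        (try have hr' := hr.trans hik) <;>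
        (try simp only [dd_lt _ _ hr, dd_gt _ _ hr, gg_lt _ hr, gg_gt _ hr, gg_lt' _ hr, gg_gt' _ hr, e2 _ _ hr, e3 _ _ hr,
          mul_add, mul_sub, mul_smul_comm, smul_add, smul_sub, zero_smul, add_zero, zero_add, one_smul]) <;>
        (try simp only [dd_lt _ _ hr', dd_gt _ _ hr', gg_lt _ hr', gg_gt _ hr', gg_lt' _ hr', gg_gt' _ hr', e2 _ _ hr', e3 _ _ hr',
          mul_add, mul_sub, mul_smul_comm, smul_add, smul_sub, zero_smul, add_zero, zero_add, one_smul]) <;>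
        match_scalars <;> field_simp <;> ring
  gt i k b b' hb hik := by
    have hq := h.hq
    have e1 := fun k => hv.row k b b' hb
    have e2 := fun i k hik => hv.lt i k b b' hb hik
    have e3 := fun i k hik => hv.gt i k b b' hb hik
    cases ht : tp a
    all_goals
      rcases lt_trichotomy l i with hr | rfl | hr
      on_goal 3 => rcases lt_trichotomy l k with hr' | rfl | hr'
      all_goals
        simp only [PP_X, map_add, map_smul, ht, dd_self, dd_self', gg_self, mul_add, mul_sub, mul_smul_comm, smul_add, smul_sub,
          mul_one, mul_zero, zero_smul, smul_zero, add_zero, zero_add, one_smul, e1, e2 _ _ hik, e3 _ _ hik,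
          dd_lt _ _ hik, dd_gt _ _ hik, gg_lt _ hik, gg_gt _ hik, gg_lt' _ hik, gg_gt' _ hik] <;>
        (try have hr' := hr.trans hik) <;>
        (try simp only [dd_lt _ _ hr, dd_gt _ _ hr, gg_lt _ hr, gg_gt _ hr, gg_lt' _ hr, gg_gt' _ hr, e2 _ _ hr, e3 _ _ hr,
          mul_add, mul_sub, mul_smul_comm, smul_add, smul_sub, zero_smul, add_zero, zero_add, one_smul]) <;>
        (try simp only [dd_lt _ _ hr', dd_gt _ _ hr', gg_lt _ hr', gg_gt _ hr', gg_lt' _ hr', gg_gt' _ hr', e2 _ _ hr', e3 _ _ hr',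
          mul_add, mul_sub, mul_smul_comm, smul_add, smul_sub, zero_smul, add_zero, zero_add, one_smul]) <;>
        match_scalars <;> field_simp <;> ring
  col i k b hik := by
    have hq := h.hq
    have e1 := fun i k hik => hv.col i k b hik
    cases ht : tp a
    all_goals
      rcases lt_trichotomy l i with hr | rfl | hr
      on_goal 3 => rcases lt_trichotomy l k with hr' | rfl | hr'
      all_goals
        simp only [PP_X, map_add, map_smul, ht, dd_self, dd_self', gg_self, mul_add, mul_sub, mul_smul_comm, smul_add, smul_sub,
          mul_one, mul_zero, zero_smul, smul_zero, add_zero, zero_add, one_smul, e1 _ _ hik,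
          dd_lt _ _ hik, dd_gt _ _ hik, gg_lt _ hik, gg_gt _ hik, gg_lt' _ hik, gg_gt' _ hik] <;>
        (try have hr' := hr.trans hik) <;>
        (try simp only [dd_lt _ _ hr, dd_gt _ _ hr, gg_lt _ hr, gg_gt _ hr, gg_lt' _ hr, gg_gt' _ hr, e1 _ _ hr,
          mul_add, mul_sub, mul_smul_comm, smul_add, smul_sub, zero_smul, add_zero, zero_add, one_smul]) <;>
        (try simp only [dd_lt _ _ hr', dd_gt _ _ hr', gg_lt _ hr', gg_gt _ hr', gg_lt' _ hr', gg_gt' _ hr', e1 _ _ hr',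
          mul_add, mul_sub, mul_smul_comm, smul_add, smul_sub, zero_smul, add_zero, zero_add, one_smul]) <;>
        match_scalars <;> field_simp <;> ring

lemma pRel (h : TH q tp) (v : QMat K q m N) : PRel h v := by
  induction v using qmat_induction with
  | one => exact pRel_one h
  | add v w hv hw => exact pRel_add h hv hw
  | smul c v hv => exact pRel_smul h c hv
  | mulX l a v hv => exact pRel_X h l a hv

end
end QG

namespace QG
variable {K : Type*} [Field K]

lemma IsQM.scale {ι κ : Type*} [LinearOrder ι] [LinearOrder κ] {A : Type*} [Ring A] [Algebra K A] {q : K} {x : ι → κ → A}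
    (h : IsQM q x) (t : κ → K) : IsQM q (fun i j => t j • x i j) where
  row i j l hjl := by
    simp only [smul_mul_assoc, mul_smul_comm, h.row i j l hjl]; match_scalars; ring
  col i k j hik := by
    simp only [smul_mul_assoc, mul_smul_comm, h.col i k j hik]; match_scalars; ring
  comm i k j l hki hjl := by
    simp only [smul_mul_assoc, mul_smul_comm, h.comm i k j l hki hjl]; match_scalars; ring
  qrel i k j l hik hjl := by
    have := congrArg (fun z => (t j * t l) • z) (h.qrel i k j l hik hjl)
    simp only [smul_mul_assoc, mul_smul_comm, smul_sub, smul_smul] at this ⊢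
    rw [mul_comm (t l) (t j), this]; match_scalars; ring

/-- scaling of columns -/
noncomputable def sc (q : K) (m : ℕ) {N : ℕ} (t : Fin N → K) : QMat K q m N →ₐ[K] QMat K q m N :=
  liftQM ((isQM_X q m N).scale t)

@[simp] lemma sc_X (q : K) {m N : ℕ} (t : Fin N → K) (i : Fin m) (j : Fin N) :
    sc q m t (X K q i j) = t j • X K q i j := by simp [sc]

lemma qmat_hom_ext {q : K} {m N : ℕ} {A : Type*} [Semiring A] [Algebra K A] {f g : QMat K q m N →ₐ[K] A}
    (h : ∀ i j, f (X K q i j) = g (X K q i j)) : f = g := by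
  apply AlgHom.ext_of_adjoin_eq_top (adjoin_X q m N)
  rintro _ ⟨⟨i, j⟩, rfl⟩
  exact h i j

lemma sc_comp (q : K) (m : ℕ) {N : ℕ} (t t' : Fin N → K) : (sc q m t).comp (sc q m t') = sc q m (fun j => t j * t' j) := by
  apply qmat_hom_ext
  intro i j
  simp [smul_smul, mul_comm]

lemma sc_one (q : K) (m : ℕ) {N : ℕ} (t : Fin N → K) (ht : ∀ j, t j = 1) : sc q m t = AlgHom.id K _ := by
  apply qmat_hom_ext
  intro i j
  simp [ht]

/-- scaling of columns as an automorphism -/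
noncomputable def scE (q : K) (m : ℕ) {N : ℕ} (t : Fin N → K) (ht : ∀ j, t j ≠ 0) : QMat K q m N ≃ₐ[K] QMat K q m N :=
  AlgEquiv.ofAlgHom (sc q m t) (sc q m fun j => (t j)⁻¹)
    (by rw [sc_comp]; exact sc_one _ _ _ fun j => mul_inv_cancel₀ (ht j))
    (by rw [sc_comp]; exact sc_one _ _ _ fun j => inv_mul_cancel₀ (ht j))

namespace Cfg
variable {m N n : ℕ} (c : Cfg m N n)

lemma cardC (hN : N + m = n) : (c.M)ᶜ.card = N := by
  rw [Finset.card_compl, c.cardM, Fintype.card_fin]; omega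

/-- type of column of the model -/
noncomputable def tp (hN : N + m = n) (a : Fin N) : Bool :=
  decide (∀ z ∈ c.M, z < (c.M)ᶜ.orderEmbOfFin (c.cardC hN) a)

lemma th {q : K} (hq : q ≠ 0) (hN : N + m = n) : TH q (c.tp hN) where
  hq := hq
  hm a b hab ha := by
    simp only [tp, decide_eq_true_eq] at ha ⊢
    exact fun z hz => (ha z hz).trans (by simpa using hab)

variable {q : K} (hq : q ≠ 0) (hN : N + m = n)

/-- images of the generators -/
noncomputable def phiX (k : Fin m) (z : Fin n) : Module.End K (QMat K q m N) :=
  if h : z ∈ c.M then PP (c.th hq hN) k ((c.M.orderIsoOfFin c.cardM).symm ⟨z, h⟩)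
  else Algebra.lmul K _ (X K q k (((c.M)ᶜ.orderIsoOfFin (c.cardC hN)).symm ⟨z, Finset.mem_compl.2 h⟩))

lemma tp_aft {z : Fin n} (hz : z ∉ c.M) {y : Fin n} (hy : y ∈ c.M) (hyz : y < z) :
    c.tp hN (((c.M)ᶜ.orderIsoOfFin (c.cardC hN)).symm ⟨z, Finset.mem_compl.2 hz⟩) = true := by
  simp only [tp, decide_eq_true_eq, ← Finset.coe_orderIsoOfFin_apply, OrderIso.apply_symm_apply]
  obtain ⟨j, rfl⟩ := c.Ma z hz
  cases hj : c.aft j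
  · exact absurd hyz (c.h_bef j hj y hy).not_gt
  · exact c.h_aft j hj

lemma tp_bef {z : Fin n} (hz : z ∉ c.M) {y : Fin n} (hy : y ∈ c.M) (hyz : z < y) :
    c.tp hN (((c.M)ᶜ.orderIsoOfFin (c.cardC hN)).symm ⟨z, Finset.mem_compl.2 hz⟩) = false := by
  simp only [tp, decide_eq_false_iff_not, ← Finset.coe_orderIsoOfFin_apply, OrderIso.apply_symm_apply]
  exact fun h => (h y hy).not_gt hyz

lemma ltM {j l : Fin n} (hj : j ∈ c.M) (hl : l ∈ c.M) (hjl : j < l) :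
    (c.M.orderIsoOfFin c.cardM).symm ⟨j, hj⟩ < (c.M.orderIsoOfFin c.cardM).symm ⟨l, hl⟩ :=
  (OrderIso.lt_iff_lt (c.M.orderIsoOfFin c.cardM).symm).2 (Subtype.mk_lt_mk.2 hjl)

lemma ltC {j l : Fin n} (hj : j ∉ c.M) (hl : l ∉ c.M) (hjl : j < l) :
    ((c.M)ᶜ.orderIsoOfFin (c.cardC hN)).symm ⟨j, Finset.mem_compl.2 hj⟩ <
      ((c.M)ᶜ.orderIsoOfFin (c.cardC hN)).symm ⟨l, Finset.mem_compl.2 hl⟩ :=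
  (OrderIso.lt_iff_lt ((c.M)ᶜ.orderIsoOfFin (c.cardC hN)).symm).2 (Subtype.mk_lt_mk.2 hjl)

lemma isQM_phiX : IsQM q (c.phiX hq hN) where
  row k j l hjl := by
    ext v
    simp only [Module.End.mul_apply, LinearMap.smul_apply, phiX]
    by_cases hj : j ∈ c.M <;> by_cases hl : l ∈ c.M
    · simp only [hj, hl, dif_pos]
      rw [(pRel (c.th hq hN) v).row k _ _ (c.ltM hj hl hjl), smul_smul,
        mul_inv_cancel₀ hq, one_smul]
    · simp only [hj, hl, dif_pos, dif_neg, not_false_iff, Algebra.coe_lmul_eq_mul, LinearMap.mul_apply', PP_X,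
        c.tp_aft hN hl hj hjl, dd_self, gg_self, zero_smul, add_zero]
    · simp only [hj, hl, dif_pos, dif_neg, not_false_iff, Algebra.coe_lmul_eq_mul, LinearMap.mul_apply', PP_X,
        c.tp_bef hN hj hl hjl, dd_self', gg_self, zero_smul, add_zero, smul_smul, mul_inv_cancel₀ hq, one_smul]
    · simp only [hj, hl, dif_neg, not_false_iff, Algebra.coe_lmul_eq_mul, LinearMap.mul_apply', ← mul_assoc]
      rw [(isQM_X q m N).row k _ _ (c.ltC hN hj hl hjl), smul_mul_assoc]
  col i k j hik := by
    ext v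
    simp only [Module.End.mul_apply, LinearMap.smul_apply, phiX]
    by_cases hj : j ∈ c.M
    · simp only [hj, dif_pos]
      rw [(pRel (c.th hq hN) v).col i k _ hik]
    · simp only [hj, dif_neg, not_false_iff, Algebra.coe_lmul_eq_mul, LinearMap.mul_apply', ← mul_assoc]
      rw [(isQM_X q m N).col i k _ hik, smul_mul_assoc]
  comm i k j l hki hjl := by
    ext v
    simp only [Module.End.mul_apply, LinearMap.smul_apply, phiX]
    by_cases hj : j ∈ c.M <;> by_cases hl : l ∈ c.M
    · simp only [hj, hl, dif_pos]
      rw [(pRel (c.th hq hN) v).lt k i _ _ (c.ltM hj hl hjl) hki]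
    · simp only [hj, hl, dif_pos, dif_neg, not_false_iff, Algebra.coe_lmul_eq_mul, LinearMap.mul_apply', PP_X,
        c.tp_aft hN hl hj hjl, dd_gt _ _ hki, gg_gt _ hki, zero_smul, add_zero, one_smul]
    · simp only [hj, hl, dif_pos, dif_neg, not_false_iff, Algebra.coe_lmul_eq_mul, LinearMap.mul_apply', PP_X,
        c.tp_bef hN hj hl hjl, dd_lt _ _ hki, gg_lt' _ hki, zero_smul, add_zero, one_smul]
    · simp only [hj, hl, dif_neg, not_false_iff, Algebra.coe_lmul_eq_mul, LinearMap.mul_apply', ← mul_assoc]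
      rw [(isQM_X q m N).comm i k _ _ hki (c.ltC hN hj hl hjl)]
  qrel i k j l hik hjl := by
    ext v
    simp only [Module.End.mul_apply, LinearMap.smul_apply, LinearMap.sub_apply, phiX]
    by_cases hj : j ∈ c.M <;> by_cases hl : l ∈ c.M
    · simp only [hj, hl, dif_pos]
      have hlt := c.ltM hj hl hjl
      rw [(pRel (c.th hq hN) v).gt i k _ _ hlt hik, (pRel (c.th hq hN) v).lt i k _ _ hlt hik]
      abel
    · simp only [hj, hl, dif_pos, dif_neg, not_false_iff, Algebra.coe_lmul_eq_mul, LinearMap.mul_apply', PP_X,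
        c.tp_aft hN hl hj hjl, dd_lt _ _ hik, gg_lt _ hik, zero_smul, add_zero, one_smul]
      abel
    · simp only [hj, hl, dif_pos, dif_neg, not_false_iff, Algebra.coe_lmul_eq_mul, LinearMap.mul_apply', PP_X,
        c.tp_bef hN hj hl hjl, dd_lt _ _ hik, dd_gt _ _ hik, gg_lt' _ hik, gg_gt' _ hik, zero_smul, add_zero, one_smul]
      module
    · simp only [hj, hl, dif_neg, not_false_iff, Algebra.coe_lmul_eq_mul, LinearMap.mul_apply', ← mul_assoc]
      rw [← sub_mul, (isQM_X q m N).qrel i k _ _ hik (c.ltC hN hj hl hjl), smul_mul_assoc]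

/-- the representation -/
noncomputable def Phi : QMat K q m n →ₐ[K] Module.End K (QMat K q m N) := liftQM (c.isQM_phiX hq hN)

end Cfg
end QG

namespace QG
variable {K : Type*} [Field K]
namespace Cfg
variable {m N n : ℕ} (c : Cfg m N n)
variable {q : K} (hq : q ≠ 0) (hN : N + m = n)

lemma Phi_X (k : Fin m) (z : Fin n) : c.Phi hq hN (X K q k z) = c.phiX hq hN k z := by simp [Phi]

lemma Phi_M (k p : Fin m) : c.Phi hq hN (X K q k (c.M.orderEmbOfFin c.cardM p)) = PP (c.th hq hN) k p := by
  rw [Phi_X, phiX, dif_pos (Finset.orderEmbOfFin_mem _ _ _)]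
  congr 1
  rw [OrderIso.symm_apply_eq]
  ext; rw [Finset.coe_orderIsoOfFin_apply]

lemma Phi_C (k : Fin m) (a : Fin N) : c.Phi hq hN (X K q k ((c.M)ᶜ.orderEmbOfFin (c.cardC hN) a)) =
    Algebra.lmul K _ (X K q k a) := by
  rw [Phi_X, phiX, dif_neg (Finset.mem_compl.1 (Finset.orderEmbOfFin_mem _ _ _))]
  congr 2
  rw [OrderIso.symm_apply_eq]
  ext; rw [Finset.coe_orderIsoOfFin_apply]

lemma prod_PP_one (σ : Fin m → Fin m) (l : List (Fin m)) :
    (l.map fun k => PP (c.th hq hN) (σ k) k).prod (1 : QMat K q m N) = if (∀ k ∈ l, σ k = k) then 1 else 0 := by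
  induction l with
  | nil => simp
  | cons k l ih =>
    rw [List.map_cons, List.prod_cons, Module.End.mul_apply, ih]
    by_cases h : ∀ k ∈ l, σ k = k
    · rw [if_pos h, PP_one]
      exact if_congr (by simp only [List.mem_cons, forall_eq_or_imp]; exact ⟨fun a => ⟨a, h⟩, fun a => a.1⟩) rfl rfl
    · rw [if_neg h, if_neg (by simp [h]), map_zero]

lemma Mo_one : c.Phi hq hN (grMinor K q m c.M) (1 : QMat K q m N) = 1 := by
  rw [grMinor, dif_pos c.cardM, qMinor, map_sum, LinearMap.sum_apply, Finset.sum_eq_single (1 : Equiv.Perm (Fin m))]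
  · simp only [map_smul, map_list_prod, List.map_ofFn, LinearMap.smul_apply, Function.comp_def, Phi_M]
    rw [List.ofFn_eq_map, c.prod_PP_one hq hN (fun k => (1 : Equiv.Perm (Fin m)) k)]
    have : invCount (1 : Equiv.Perm (Fin m)) = 0 := by
      simp only [invCount, Finset.card_eq_zero, Finset.filter_eq_empty_iff]
      rintro ⟨a, b⟩ -
      simp only [Equiv.Perm.coe_one, id_eq, not_and]
      exact fun h => h.not_gt
    simp [this]
  · intro σ _ hσ
    simp only [map_smul, map_list_prod, List.map_ofFn, LinearMap.smul_apply, Function.comp_def, Phi_M]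
    rw [List.ofFn_eq_map, c.prod_PP_one hq hN (fun k => σ k), if_neg, smul_zero]
    intro h
    exact hσ (Equiv.ext fun k => h k (List.mem_finRange k))
  · intro h; exact absurd (Finset.mem_univ _) h

/-- scaling -/
noncomputable def stp (q : K) (a : Fin N) : K := if c.tp hN a = true then q else q⁻¹

lemma Mo_X (hroot : ∀ k : ℕ, 0 < k → q ^ k ≠ 1) (k : Fin m) (a : Fin N) (v : QMat K q m N) :
    c.Phi hq hN (grMinor K q m c.M) (X K q k a * c.Phi hq hN (grMinor K q m c.M) v) =
      c.stp hN q a • (X K q k a * c.Phi hq hN (grMinor K q m c.M) (c.Phi hq hN (grMinor K q m c.M) v)) := by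
  have h := QH_X hq hroot m n
  have hz : (c.M)ᶜ.orderEmbOfFin (c.cardC hN) a ∉ c.M := Finset.mem_compl.1 (Finset.orderEmbOfFin_mem _ _ _)
  obtain ⟨h1, h2⟩ := gm_scale h (by rw [c.cardM, Fintype.card_fin]) hz k
  rw [← grMinor_eq c.cardM] at h1 h2
  have key : ∀ t : K, (grMinor K q m c.M * X K q k ((c.M)ᶜ.orderEmbOfFin (c.cardC hN) a) * grMinor K q m c.M =
    t • (X K q k ((c.M)ᶜ.orderEmbOfFin (c.cardC hN) a) * grMinor K q m c.M * grMinor K q m c.M)) →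
    c.Phi hq hN (grMinor K q m c.M) (X K q k a * c.Phi hq hN (grMinor K q m c.M) v) =
      t • (X K q k a * c.Phi hq hN (grMinor K q m c.M) (c.Phi hq hN (grMinor K q m c.M) v)) := by
    intro t ht
    have e := congrArg (fun f => c.Phi hq hN f v) ht
    simpa only [map_mul, map_smul, Phi_C, Module.End.mul_apply, LinearMap.smul_apply, Algebra.coe_lmul_eq_mul,
      LinearMap.mul_apply'] using e
  unfold stp
  cases ht : c.tp hN a
  · rw [if_neg (by simp)]
    refine key _ (h2 fun y hy => ?_)
    rcases lt_trichotomy y ((c.M)ᶜ.orderEmbOfFin (c.cardC hN) a) with h3 | h3 | h3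
    · have := c.tp_aft hN hz hy h3
      have e : ((c.M)ᶜ.orderIsoOfFin (c.cardC hN)).symm ⟨_, Finset.mem_compl.2 hz⟩ = a := by
        rw [OrderIso.symm_apply_eq]; ext; rw [Finset.coe_orderIsoOfFin_apply]
      rw [e, ht] at this; simp at this
    · exact absurd (h3 ▸ hy) hz
    · exact h3
  · rw [if_pos rfl]
    refine key _ (h1 ?_)
    simpa [tp] using ht

lemma stp_ne (hq : q ≠ 0) (a : Fin N) : c.stp hN q a ≠ 0 := by
  unfold stp; split_ifs; exact hq; exact inv_ne_zero hq

lemma Mo_eq (hroot : ∀ k : ℕ, 0 < k → q ^ k ≠ 1) (v : QMat K q m N) :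
    c.Phi hq hN (grMinor K q m c.M) v = sc q m (c.stp hN q) v := by
  have key : v ∈ Submodule.span K {w : QMat K q m N | ∃ t : K, t ≠ 0 ∧ c.Phi hq hN (grMinor K q m c.M) w = t • w ∧
      sc q m (c.stp hN q) w = t • w} := by
    induction v using qmat_induction with
    | one => exact Submodule.subset_span ⟨1, one_ne_zero, by rw [Mo_one, one_smul], by rw [map_one, one_smul]⟩
    | add v w hv hw => exact Submodule.add_mem _ hv hw
    | smul t v hv => exact Submodule.smul_mem _ t hv
    | mulX k a v hv =>
      induction hv using Submodule.span_induction with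
      | mem w hw =>
        obtain ⟨t, ht, h1, h2⟩ := hw
        refine Submodule.subset_span ⟨c.stp hN q a * t, mul_ne_zero (c.stp_ne hN hq a) ht, ?_, ?_⟩
        · have e := c.Mo_X hq hN hroot k a w
          simp only [h1, mul_smul_comm, map_smul, smul_smul] at e
          have e2 := congrArg (fun z => t⁻¹ • z) e
          simp only [smul_smul] at e2
          rw [inv_mul_cancel₀ ht, one_smul] at e2
          rw [e2]
          congr 1
          field_simp
        · rw [map_mul, sc_X, h2, smul_mul_assoc, mul_smul_comm, smul_smul]
      | zero => simp
      | add v w _ _ hv hw => rw [mul_add]; exact Submodule.add_mem _ hv hw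
      | smul t v _ hv => rw [mul_smul_comm]; exact Submodule.smul_mem _ t hv
  induction key using Submodule.span_induction with
  | mem w hw => obtain ⟨t, ht, h1, h2⟩ := hw; rw [h1, h2]
  | zero => simp
  | add v w _ _ hv hw => rw [map_add, map_add, hv, hw]
  | smul t v _ hv => rw [map_smul, map_smul, hv]

/-- the unit `U` -/
noncomputable def UU : (Module.End K (QMat K q m N))ˣ :=
  LinearMap.GeneralLinearGroup.ofLinearEquiv (scE q m (c.stp hN q) (c.stp_ne hN hq)).toLinearEquiv

lemma UU_eq (hroot : ∀ k : ℕ, 0 < k → q ^ k ≠ 1) :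
    ((c.UU hq hN : (Module.End K (QMat K q m N))ˣ) : Module.End K (QMat K q m N)) = c.Phi hq hN (grMinor K q m c.M) := by
  ext v
  rw [c.Mo_eq hq hN hroot]; rfl

lemma gr' (hroot : ∀ k : ℕ, 0 < k → q ^ k ≠ 1) : GrRel q m (fun J : Finset (Fin n) => c.Phi hq hN (grMinor K q m J)) :=
  GrRel.map (C := Module.End K (QMat K q m N)) (grRel_grMinor hq hroot m n) (c.Phi hq hN)

/-- representation of the dehomogenised algebra -/
noncomputable def rho (hroot : ∀ k : ℕ, 0 < k → q ^ k ≠ 1) : QMat K q m N →ₐ[K] Module.End K (QMat K q m N) :=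
  liftQM (c.isQM_xi (c.gr' hq hN hroot) (c.UU hq hN) (c.UU_eq hq hN hroot))

end Cfg
end QG

namespace QG

lemma fin_inj_aux {K V : Type*} [Field K] [AddCommGroup V] [Module K V] (E : V →ₗ[K] V) (W : Submodule K V)
    (hfg : W.FG) (h : W ≤ W.map E) {r : V} (hr : r ∈ W) (h0 : E r = 0) : r = 0 := by
  have : FiniteDimensional K W := Module.Finite.iff_fg.2 hfg
  let f := E.domRestrict W
  have h1 : LinearMap.range f = W.map E := by
    rw [LinearMap.range_domRestrict]
  have h2 := LinearMap.finrank_range_add_finrank_ker f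
  have h3 : Module.finrank K W ≤ Module.finrank K (LinearMap.range f) := by
    apply Submodule.finrank_mono
    rw [h1]; exact h
  have h4 : LinearMap.ker f = ⊥ := by
    have h6 : Module.finrank K (LinearMap.ker f) = 0 := by omega
    exact Submodule.finrank_eq_zero.1 h6
  have h5 : (⟨r, hr⟩ : W) ∈ LinearMap.ker f := by
    rw [LinearMap.mem_ker]; exact h0
  rw [h4, Submodule.mem_bot] at h5
  exact congrArg Subtype.val h5
variable {K : Type*} [Field K]

/-- generating space -/
def WW (q : K) (m N : ℕ) : Submodule K (QMat K q m N) :=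
  Submodule.span K (insert 1 (Set.range fun p : Fin m × Fin N => X K q p.1 p.2))

lemma one_mem_WW (q : K) (m N : ℕ) : (1 : QMat K q m N) ∈ WW q m N := Submodule.subset_span (Set.mem_insert _ _)
lemma X_mem_WW (q : K) {m N : ℕ} (i : Fin m) (j : Fin N) : X K q i j ∈ WW q m N :=
  Submodule.subset_span (Set.mem_insert_of_mem _ ⟨(i, j), rfl⟩)

lemma WW_pow_succ (q : K) (m N d : ℕ) : WW q m N ^ d ≤ WW q m N ^ (d + 1) := by
  intro v hv
  rw [pow_succ', ← one_mul v]
  exact Submodule.mul_mem_mul (one_mem_WW q m N) hv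

lemma WW_mono (q : K) (m N : ℕ) : Monotone (fun d => WW q m N ^ d) := monotone_nat_of_le_succ (WW_pow_succ q m N)

lemma WW_fg (q : K) (m N d : ℕ) : (WW q m N ^ d).FG := by
  apply Submodule.FG.pow
  exact Submodule.fg_span ((Set.finite_range _).insert _)

lemma WW_exists (q : K) {m N : ℕ} (v : QMat K q m N) : ∃ d, v ∈ WW q m N ^ d := by
  induction v using qmat_induction with
  | one => exact ⟨0, by rw [pow_zero]; exact Submodule.one_le.1 le_rfl⟩
  | add v w hv hw =>
    obtain ⟨d, hd⟩ := hv; obtain ⟨e, he⟩ := hw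
    exact ⟨max d e, Submodule.add_mem _ (WW_mono q m N (le_max_left _ _) hd) (WW_mono q m N (le_max_right _ _) he)⟩
  | smul t v hv => obtain ⟨d, hd⟩ := hv; exact ⟨d, Submodule.smul_mem _ t hd⟩
  | mulX i j v hv =>
    obtain ⟨d, hd⟩ := hv
    exact ⟨d + 1, by rw [pow_succ']; exact Submodule.mul_mem_mul (X_mem_WW q i j) hd⟩

lemma PP_WW {q : K} {m N : ℕ} {tp : Fin N → Bool} (h : TH q tp) (d : ℕ) : ∀ (k b : Fin m) (v : QMat K q m N), v ∈ WW q m N ^ d →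
    PP h k b v ∈ WW q m N ^ d := by
  induction d with
  | zero =>
    intro k b v hv
    rw [pow_zero, Submodule.mem_one] at hv
    obtain ⟨t, rfl⟩ := hv
    rw [Algebra.algebraMap_eq_smul_one, map_smul, PP_one, pow_zero]
    apply Submodule.smul_mem
    split_ifs
    · exact Submodule.one_le.1 le_rfl
    · exact Submodule.zero_mem _
  | succ d ih =>
    intro k b v hv
    rw [pow_succ'] at hv
    have : WW q m N * WW q m N ^ d ≤ Submodule.comap (PP h k b) (WW q m N ^ (d + 1)) := by
      rw [Submodule.mul_le]
      intro w hw v hv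
      rw [Submodule.mem_comap]
      induction hw using Submodule.span_induction with
      | mem w hw =>
        rcases hw with rfl | ⟨⟨l, a⟩, rfl⟩
        · rw [one_mul]; exact WW_pow_succ q m N d (ih k b v hv)
        · rw [PP_X, pow_succ']
          exact Submodule.add_mem _ (Submodule.smul_mem _ _ (Submodule.mul_mem_mul (X_mem_WW q _ _) (ih _ _ _ hv)))
            (Submodule.smul_mem _ _ (Submodule.mul_mem_mul (X_mem_WW q _ _) (ih _ _ _ hv)))
      | zero => simp
      | add v w _ _ hv hw => rw [add_mul, map_add]; exact Submodule.add_mem _ hv hw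
      | smul t v _ hv => rw [smul_mul_assoc, map_smul]; exact Submodule.smul_mem _ t hv
    exact this hv

namespace Cfg
variable {m N n : ℕ} (c : Cfg m N n)
variable {q : K} (hq : q ≠ 0) (hN : N + m = n) (hroot : ∀ k : ℕ, 0 < k → q ^ k ≠ 1)

lemma rho_X (i : Fin m) (j : Fin N) : c.rho hq hN hroot (X K q i j) =
    c.xi (fun J => c.Phi hq hN (grMinor K q m J)) (c.UU hq hN) i j := by simp [rho]

lemma X_mem (k : Fin m) (a : Fin N) (v : QMat K q m N) (S : Submodule K (QMat K q m N))
    (hS : ∀ i j p, c.rho hq hN hroot (X K q i j) (PP (c.th hq hN) k p v) ∈ S) : X K q k a * v ∈ S := by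
  have hUi : ∀ w, (((c.UU hq hN)⁻¹ : (Module.End K (QMat K q m N))ˣ) : Module.End K (QMat K q m N))
      ((c.UU hq hN : Module.End K (QMat K q m N)) w) = w := fun w => by
    rw [← Module.End.mul_apply, Units.inv_mul, Module.End.one_apply]
  set z := (c.M)ᶜ.orderEmbOfFin (c.cardC hN) a with hzdef
  have hz : z ∉ c.M := Finset.mem_compl.1 (Finset.orderEmbOfFin_mem _ _ _)
  obtain ⟨jz, hjz⟩ := c.Ma z hz
  have hcard : (insert z c.M).card = m + 1 := by rw [Finset.card_insert_of_notMem hz, c.cardM]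
  have e := L2 (QH_X hq hroot m n) (J := insert z c.M) (by rw [hcard, Fintype.card_fin]) k
  rw [Finset.sum_insert hz, Finset.erase_insert hz, ← grMinor_eq c.cardM] at e
  have e1 := congrArg (fun f => c.Phi hq hN f v) e
  simp only [map_add, map_sum, map_smul, map_mul, map_zero, LinearMap.add_apply, LinearMap.sum_apply, LinearMap.smul_apply,
    Module.End.mul_apply, LinearMap.zero_apply] at e1
  rw [hzdef, Phi_C, ← c.UU_eq hq hN hroot, ← hzdef] at e1
  have e2 : ∀ y ∈ c.M, ∃ w ∈ S, c.Phi hq hN (gm q (fun (i : Fin m) (j : Fin n) => X K q i j) ((insert z c.M).erase y))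
      (c.Phi hq hN (X K q k y) v) = (c.UU hq hN : Module.End K (QMat K q m N)) w := by
    intro y hy
    obtain ⟨i, rfl⟩ := c.Mb y hy
    have hne : z ≠ c.b i := by rintro h; exact hz (h ▸ hy)
    obtain ⟨p, hp⟩ : ∃ p, c.M.orderEmbOfFin c.cardM p = c.b i := by
      have : c.b i ∈ Set.range (c.M.orderEmbOfFin c.cardM) := by rw [Finset.range_orderEmbOfFin]; exact hy
      exact this
    have hJ : (insert z c.M).erase (c.b i) = c.J i jz := by
      rw [J, hjz, Finset.erase_insert_of_ne hne]
    refine ⟨(c.s q jz)⁻¹ • c.rho hq hN hroot (X K q i jz) (PP (c.th hq hN) k p v), S.smul_mem _ (hS _ _ _), ?_⟩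
    rw [← grMinor_eq (card_erase_aux (Finset.mem_insert_of_mem hy) hcard), hJ, ← hp, Phi_M, map_smul, rho_X]
    have e3 := c.u_xi (c.gr' hq hN hroot) (c.UU hq hN) (c.UU_eq hq hN hroot) i jz
    have e4 := congrArg (fun f => f (PP (c.th hq hN) k p v)) e3
    simp only [Module.End.mul_apply, LinearMap.smul_apply] at e4
    rw [e4, smul_smul, inv_mul_cancel₀ (c.s_ne hq jz), one_smul, xi, Module.End.mul_apply, hUi]
  choose! w hw hw2 using e2
  rw [Finset.sum_congr rfl (fun y hy => by rw [hw2 y hy])] at e1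
  simp only [← map_smul, ← map_sum, ← map_add] at e1
  have e5 := congrArg (((c.UU hq hN)⁻¹ : (Module.End K (QMat K q m N))ˣ) : Module.End K (QMat K q m N)) e1
  rw [hUi, map_zero] at e5
  have e6 : (-q) ^ hi (insert z c.M) z • (X K q k a * v) ∈ S := by
    rw [← mul_smul_comm]
    change (Algebra.lmul K (QMat K q m N)) (X K q k a) ((-q) ^ hi (insert z c.M) z • v) ∈ S
    rw [eq_neg_of_add_eq_zero_left e5]
    exact S.neg_mem (S.sum_mem fun y hy => S.smul_mem _ (hw y hy))
  have := S.smul_mem (((-q) ^ hi (insert z c.M) z)⁻¹) e6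
  rwa [smul_smul, inv_mul_cancel₀ (pow_ne_zero _ (neg_ne_zero.2 hq)), one_smul] at this

/-- evaluation at `1` -/
noncomputable def EE : QMat K q m N →ₗ[K] QMat K q m N where
  toFun r := c.rho hq hN hroot r 1
  map_add' r s := by rw [map_add]; rfl
  map_smul' t r := by rw [map_smul]; rfl

lemma EE_surj (d : ℕ) : WW q m N ^ d ≤ Submodule.map (c.EE hq hN hroot) (WW q m N ^ d) := by
  induction d with
  | zero =>
    rw [pow_zero]
    intro v hv
    rw [Submodule.mem_one] at hv
    obtain ⟨t, rfl⟩ := hv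
    refine ⟨algebraMap K _ t, Submodule.mem_one.2 ⟨t, rfl⟩, ?_⟩
    simp [EE, Algebra.algebraMap_eq_smul_one]
  | succ d ih =>
    conv_lhs => rw [pow_succ']
    rw [Submodule.mul_le]
    intro w hw v hv
    induction hw using Submodule.span_induction with
    | mem w hw =>
      rcases hw with rfl | ⟨⟨k, a⟩, rfl⟩
      · rw [one_mul]; exact Submodule.map_mono (WW_pow_succ q m N d) (ih hv)
      · refine c.X_mem hq hN hroot k a v _ fun i j p => ?_
        obtain ⟨r, hr, hr2⟩ := ih (PP_WW (c.th hq hN) d k p v hv)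
        rw [← hr2]
        refine ⟨X K q i j * r, ?_, ?_⟩
        · rw [pow_succ']; exact Submodule.mul_mem_mul (X_mem_WW q _ _) hr
        · simp [EE]
    | zero => simp
    | add v w _ _ hv hw => rw [add_mul]; exact Submodule.add_mem _ hv hw
    | smul t v _ hv => rw [smul_mul_assoc]; exact Submodule.smul_mem _ t hv

lemma EE_inj : Function.Injective (c.EE hq hN hroot) := by
  rw [injective_iff_map_eq_zero]
  intro r hr
  obtain ⟨d, hd⟩ := WW_exists q r
  exact fin_inj_aux (V := QMat K q m N) (c.EE hq hN hroot) (WW q m N ^ d) (WW_fg q m N d)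
    (c.EE_surj hq hN hroot d) hd hr

lemma rho_inj : Function.Injective (c.rho hq hN hroot) := by
  intro r s hrs
  apply c.EE_inj hq hN hroot
  simp only [EE, LinearMap.coe_mk, AddHom.coe_mk, hrs]

end Cfg
end QG

namespace QG
variable {K : Type*} [Field K]

section NL
variable {A B D : Type*} [Ring A] [Algebra K A] [Ring B] [Algebra K B] [Ring D] [Algebra K D] {u : A}

lemma NormalLoc.fracs (L : NormalLoc K A B u) (b : B) : ∃ (a : A) (k : ℕ), b * L.emb u ^ k = L.emb a := by
  obtain ⟨a, k, h⟩ := L.surj b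
  refine ⟨a, k, ?_⟩
  rw [h, mul_assoc]
  have : L.emb u ^ k = ((L.isUnit.unit ^ k : Bˣ) : B) := by simp
  rw [this, ← Units.val_mul]; simp

lemma NormalLoc.lift (L : NormalLoc K A B u) (f : A →ₐ[K] D) (hf : IsUnit (f u)) :
    ∃ g : B →ₐ[K] D, ∀ a, g (L.emb a) = f a := by
  choose num den hnd using L.fracs
  obtain ⟨U, hU⟩ := hf
  -- characterisation
  have char : ∀ b a k, b * L.emb u ^ k = L.emb a → f (num b) * ((U⁻¹ ^ den b : Dˣ) : D) * (U : D) ^ k = f a := by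
    intro b a k h
    have h1 : a * u ^ den b = num b * u ^ k := by
      apply L.inj
      simp only [map_mul, map_pow]
      rw [← h, ← hnd, mul_assoc, mul_assoc, ← pow_add, ← pow_add, add_comm]
    have h2 := congrArg f h1
    simp only [map_mul, map_pow, ← hU] at h2
    have e1 : ((U⁻¹ ^ den b : Dˣ) : D) * (U : D) ^ k = (U : D) ^ k * ((U⁻¹ ^ den b : Dˣ) : D) := by
      have : Commute (U⁻¹ ^ den b) (U ^ k) := ((Commute.refl U).inv_left.pow_left _).pow_right _
      have := congrArg Units.val this.eq
      simpa using this
    rw [mul_assoc, e1, ← mul_assoc, ← h2, mul_assoc]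
    have : (U : D) ^ den b * ((U⁻¹ ^ den b : Dˣ) : D) = 1 := by
      rw [← Units.val_pow_eq_pow_val, ← Units.val_mul]; simp
    rw [this, mul_one]
  let g : B → D := fun b => f (num b) * ((U⁻¹ ^ den b : Dˣ) : D)
  have cg : ∀ b a k, b * L.emb u ^ k = L.emb a → g b * (U : D) ^ k = f a := char
  have canc : ∀ (d e : D) (k : ℕ), d * (U : D) ^ k = e * (U : D) ^ k → d = e := by
    intro d e k h
    rw [← Units.val_pow_eq_pow_val] at h
    exact (Units.mul_left_inj _).1 h
  have ge : ∀ a, g (L.emb a) = f a := by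
    intro a
    have := cg (L.emb a) a 0 (by simp)
    simpa using this
  have gadd : ∀ b b', g (b + b') = g b + g b' := by
    intro b b'
    apply canc _ _ (den b + den b')
    have h1 : b * L.emb u ^ (den b + den b') = L.emb (num b * u ^ den b') := by
      rw [pow_add, ← mul_assoc, hnd]; simp
    have h2 : b' * L.emb u ^ (den b + den b') = L.emb (num b' * u ^ den b) := by
      rw [add_comm, pow_add, ← mul_assoc, hnd]; simp
    rw [add_mul, cg _ _ _ h1, cg _ _ _ h2, cg _ (num b * u ^ den b' + num b' * u ^ den b) _ (by rw [add_mul, h1, h2, map_add]), map_add]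
  have gmul : ∀ b b', g (b * b') = g b * g b' := by
    intro b b'
    obtain ⟨k, hk⟩ : ∃ k, k = den b := ⟨_, rfl⟩
    obtain ⟨aa, j, h⟩ := L.fracs (((L.isUnit.unit⁻¹ ^ k : Bˣ) : B) * L.emb (num b'))
    have hy : (L.emb u ^ k) * ((L.isUnit.unit⁻¹ ^ k : Bˣ) : B) = 1 := by
      have : L.emb u ^ k = ((L.isUnit.unit ^ k : Bˣ) : B) := by simp
      rw [this, ← Units.val_mul]; simp
    have h1 : num b' * u ^ j = u ^ k * aa := by
      apply L.inj
      simp only [map_mul, map_pow]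
      rw [← h, ← mul_assoc, ← mul_assoc, hy, one_mul]
    have h1' := congrArg f h1
    simp only [map_mul, map_pow, ← hU] at h1'
    have h2 : b * b' * L.emb u ^ (den b' + j) = L.emb (num b * aa) := by
      rw [pow_add, ← mul_assoc, mul_assoc b, hnd, mul_assoc, ← map_pow, ← map_mul, h1]
      rw [map_mul, map_pow, ← mul_assoc, hk, hnd, map_mul]
    apply canc _ _ (den b' + j)
    rw [cg _ _ _ h2, pow_add, mul_assoc, ← mul_assoc (g b'), cg b' _ _ (hnd b'), h1', ← mul_assoc, hk, cg _ _ _ (hnd b), map_mul]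
  refine ⟨AlgHom.ofLinearMap ⟨⟨g, gadd⟩, ?_⟩ ?_ gmul, ge⟩
  · intro t b
    have : g (algebraMap K B t) = algebraMap K D t := by
      rw [← L.emb.commutes t, ge, f.commutes]
    rw [Algebra.smul_def]
    simp only [gmul, this, RingHom.id_apply, Algebra.smul_def]
  · have := ge 1
    simpa using this
end NL

lemma IsQM.mulC {ι κ : Type*} [LinearOrder ι] [LinearOrder κ] {A : Type*} [Ring A] [Algebra K A] {q : K} {x : ι → κ → A}
    (h : IsQM q x) (t : A) (ht : ∀ i j, Commute t (x i j)) : IsQM q (fun i j => x i j * t) := by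
  have key : ∀ i j k l, x i j * t * (x k l * t) = x i j * x k l * (t * t) := by
    intro i j k l
    rw [mul_assoc, ← mul_assoc t, (ht k l).eq]; simp only [mul_assoc]
  constructor
  · intro i j l hh; rw [key, key, h.row i j l hh, smul_mul_assoc]
  · intro i j l hh; rw [key, key, h.col i j l hh, smul_mul_assoc]
  · intro i k j l h1 h2; rw [key, key, h.comm i k j l h1 h2]
  · intro i k j l h1 h2; rw [key, key, key, ← sub_mul, h.qrel i k j l h1 h2, smul_mul_assoc]

lemma prod_map_mulC {A ι : Type*} [Ring A] (t : A) (f : ι → A) (ht : ∀ i, Commute t (f i)) (l : List ι) :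
    (l.map fun i => f i * t).prod = (l.map f).prod * t ^ l.length := by
  induction l with
  | nil => simp
  | cons a l ih =>
    have : Commute t (l.map f).prod := by
      apply Commute.list_prod_right
      intro x hx
      obtain ⟨i, _, rfl⟩ := List.mem_map.1 hx
      exact ht i
    simp only [List.map_cons, List.prod_cons, ih, List.length_cons, pow_succ']
    rw [mul_assoc, ← mul_assoc t, this.eq]; simp only [mul_assoc]

lemma map_grMinor_mulC {D : Type*} [Ring D] [Algebra K D] {q : K} {m n : ℕ} (f g : QMat K q m n →ₐ[K] D) (t : D)
    (ht : ∀ i j, Commute t (g (X K q i j)))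
    (hf : ∀ i j, f (X K q i j) = g (X K q i j) * t) (J : Finset (Fin n)) : f (grMinor K q m J) = g (grMinor K q m J) * t ^ m := by
  unfold grMinor
  split_ifs with h
  · unfold qMinor
    rw [map_sum, map_sum, Finset.sum_mul]
    refine Finset.sum_congr rfl fun σ _ => ?_
    rw [map_smul, map_smul, smul_mul_assoc, map_list_prod, map_list_prod]
    congr 1
    have := prod_map_mulC t (fun k : Fin m => g (X K q (σ k) (J.orderEmbOfFin h k))) (fun k => ht _ _) (List.finRange m)
    simp only [← hf] at this
    rw [List.ofFn_eq_map, List.map_map, List.map_map]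
    rw [List.length_finRange] at this
    exact this
  · simp

end QG

namespace QG
variable {K : Type*} [Field K]

section Psi
variable {R B D : Type*} [Ring R] [Algebra K R] [Ring B] [Algebra K B] [Ring D] [Algebra K D]

/-- the map `Σ r_k Y^k ↦ Σ φ(r_k) y^k` -/
noncomputable def Psi (φ : R →ₐ[K] B) (y : Bˣ) : (ℤ →₀ R) →ₗ[K] B :=
  Finsupp.lsum K fun k => (LinearMap.mulRight K ((y ^ k : Bˣ) : B)).comp φ.toLinearMap

lemma Psi_single (φ : R →ₐ[K] B) (y : Bˣ) (k : ℤ) (r : R) :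
    Psi φ y (Finsupp.single k r) = φ r * ((y ^ k : Bˣ) : B) := by
  simp [Psi]

lemma zpow_comm_aux (φ : R →ₐ[K] B) (y : Bˣ) (σ : R ≃ₐ[K] R) (h : ∀ r, (y : B) * φ r = φ (σ r) * y) (k : ℤ) (r : R) :
    ((y ^ k : Bˣ) : B) * φ r = φ ((σ ^ k) r) * ((y ^ k : Bˣ) : B) := by
  have h' : ∀ r, ((y⁻¹ : Bˣ) : B) * φ r = φ ((σ⁻¹) r) * ((y⁻¹ : Bˣ) : B) := by
    intro r
    have := h (σ⁻¹ r)
    have e : σ (σ⁻¹ r) = r := by rw [← AlgEquiv.mul_apply, mul_inv_cancel]; rfl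
    rw [e] at this
    rw [Units.inv_mul_eq_iff_eq_mul, ← mul_assoc, this, mul_assoc]
    simp
  induction k using Int.induction_on generalizing r with
  | zero => simp
  | succ k ih =>
    rw [zpow_add_one, zpow_add_one, Units.val_mul, mul_assoc, h, ← mul_assoc, ih, mul_assoc]
    rfl
  | pred k ih =>
    rw [zpow_sub_one, zpow_sub_one, Units.val_mul, mul_assoc, h', ← mul_assoc, ih, mul_assoc]
    rfl

lemma Psi_mul (φ : R →ₐ[K] B) (y : Bˣ) (σ : R ≃ₐ[K] R) (h : ∀ r, (y : B) * φ r = φ (σ r) * y) (k l : ℤ) (r s : R) :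
    Psi φ y (Finsupp.single k r) * Psi φ y (Finsupp.single l s) = Psi φ y (Finsupp.single (k + l) (r * (σ ^ k) s)) := by
  rw [Psi_single, Psi_single, Psi_single, zpow_add, Units.val_mul, map_mul, mul_assoc, ← mul_assoc _ (φ s), zpow_comm_aux φ y σ h]
  simp only [mul_assoc]

lemma Psi_mul_mem (φ : R →ₐ[K] B) (y : Bˣ) (σ : R ≃ₐ[K] R) (h : ∀ r, (y : B) * φ r = φ (σ r) * y) (f g : ℤ →₀ R) :
    ∃ e, Psi φ y f * Psi φ y g = Psi φ y e := by
  induction f using Finsupp.induction_linear with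
  | zero => exact ⟨0, by simp⟩
  | add f f' hf hf' =>
    obtain ⟨a, ha⟩ := hf
    obtain ⟨b, hb⟩ := hf'
    exact ⟨a + b, by rw [map_add, add_mul, ha, hb, map_add]⟩
  | single k r =>
    induction g using Finsupp.induction_linear with
    | zero => exact ⟨0, by simp⟩
    | add f f' hf hf' =>
      obtain ⟨a, ha⟩ := hf
      obtain ⟨b, hb⟩ := hf'
      exact ⟨a + b, by rw [map_add, mul_add, ha, hb, map_add]⟩
    | single l s => exact ⟨_, Psi_mul φ y σ h k l r s⟩

/-- the range of `Psi` as a subalgebra -/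
noncomputable def PsiS (φ : R →ₐ[K] B) (y : Bˣ) (σ : R ≃ₐ[K] R) (h : ∀ r, (y : B) * φ r = φ (σ r) * y) : Subalgebra K B :=
  (LinearMap.range (Psi φ y)).toSubalgebra ⟨Finsupp.single 0 1, by simp [Psi_single]⟩ (by
    rintro _ _ ⟨f, rfl⟩ ⟨g, rfl⟩
    obtain ⟨e, he⟩ := Psi_mul_mem φ y σ h f g
    exact ⟨e, he.symm⟩)

lemma Psi_equiv {T : Type*} [Ring T] [Algebra K T] (σ : R ≃ₐ[K] R)
    (φ : R →ₐ[K] B) (y : Bˣ) (h : ∀ r, (y : B) * φ r = φ (σ r) * y) (hb : Function.Bijective (Psi φ y))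
    (φ' : R →ₐ[K] T) (y' : Tˣ) (h' : ∀ r, (y' : T) * φ' r = φ' (σ r) * y') (hb' : Function.Bijective (Psi φ' y')) :
    ∃ θ : T ≃ₐ[K] B, (∀ r, θ (φ' r) = φ r) ∧ θ y' = y := by
  let e := LinearEquiv.ofBijective _ hb
  let e' := LinearEquiv.ofBijective _ hb'
  let θ := e'.symm.trans e
  have hθ : ∀ f, θ (Psi φ' y' f) = Psi φ y f := by
    intro f
    have : e'.symm (Psi φ' y' f) = f := e'.symm_apply_apply f
    show e (e'.symm _) = _
    rw [this]; rfl
  have h1 : θ 1 = 1 := by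
    have := hθ (Finsupp.single 0 1)
    simpa [Psi_single] using this
  have hm : ∀ a b, θ (a * b) = θ a * θ b := by
    intro a b
    obtain ⟨f, rfl⟩ := hb'.2 a
    obtain ⟨g, rfl⟩ := hb'.2 b
    induction f using Finsupp.induction_linear with
    | zero => simp
    | add f f' hf hf' => rw [map_add, add_mul, map_add, hf, hf', map_add, add_mul]
    | single k r =>
      induction g using Finsupp.induction_linear with
      | zero => simp
      | add f f' hf hf' => rw [map_add, mul_add, map_add, hf, hf', map_add, mul_add]
      | single l s => rw [Psi_mul φ' y' σ h', hθ, hθ, hθ, Psi_mul φ y σ h]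
  refine ⟨AlgEquiv.ofLinearEquiv θ h1 hm, ?_, ?_⟩
  · intro r
    have := hθ (Finsupp.single 0 r)
    simpa [Psi_single] using this
  · have := hθ (Finsupp.single 1 1)
    simpa [Psi_single] using this

/-- inclusion of coefficients in the Laurent polynomial ring -/
noncomputable def CA (E : Type*) [Ring E] [Algebra K E] : E →ₐ[K] LaurentPolynomial E where
  toRingHom := LaurentPolynomial.C
  commutes' t := by
    rfl

lemma CA_apply (E : Type*) [Ring E] [Algebra K E] (e : E) : CA (K := K) E e = LaurentPolynomial.C e := rfl

/-- T as unit -/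
noncomputable def TU (E : Type*) [Ring E] (k : ℤ) : (LaurentPolynomial E)ˣ where
  val := LaurentPolynomial.T k
  inv := LaurentPolynomial.T (-k)
  val_inv := by rw [← LaurentPolynomial.T_add]; simp
  inv_val := by rw [← LaurentPolynomial.T_add]; simp

lemma TU_zpow (E : Type*) [Ring E] (k : ℤ) (l : ℤ) : TU E k ^ l = TU E (k * l) := by
  have h : ∀ a b : ℤ, TU E (a + b) = TU E a * TU E b := by
    intro a b; ext1; exact LaurentPolynomial.T_add a b
  induction l using Int.induction_on with
  | zero => ext1; simp [TU]
  | succ l ih => rw [zpow_add_one, ih, ← h]; congr 1; ring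
  | pred l ih =>
    rw [zpow_sub_one, ih, mul_inv_eq_iff_eq_mul, ← h]; congr 1; ring

lemma Psi_inj {E : Type*} [Ring E] [Algebra K E] (φ : R →ₐ[K] B) (y : Bˣ) (ρ : R →ₐ[K] E) (hρ : Function.Injective ρ) (U : Eˣ)
    (m : ℕ) (hm : 0 < m) (g : B →ₐ[K] LaurentPolynomial E) (h1 : ∀ r, g (φ r) = CA (K := K) E (ρ r))
    (h2 : g y = CA (K := K) E U * LaurentPolynomial.T m) : Function.Injective (Psi φ y) := by
  have hy : Units.map (g : B →* LaurentPolynomial E) y = Units.map (CA (K := K) E : E →* LaurentPolynomial E) U * TU E m := by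
    ext1; exact h2
  have hyk : ∀ k : ℤ, g ((y ^ k : Bˣ) : B) = LaurentPolynomial.C ((U ^ k : Eˣ) : E) * LaurentPolynomial.T (m * k) := by
    intro k
    have : Commute (Units.map (CA (K := K) E : E →* LaurentPolynomial E) U) (TU E m) := by
      rw [Commute, SemiconjBy]; ext1
      exact ((LaurentPolynomial.commute_T m _).eq).symm
    have e := congrArg (fun z => ((z ^ k : (LaurentPolynomial E)ˣ) : LaurentPolynomial E)) hy
    rw [this.mul_zpow, TU_zpow, ← map_zpow, ← map_zpow] at e
    exact e
  rw [injective_iff_map_eq_zero]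
  intro f hf
  have key : ∀ f : ℤ →₀ R, ∀ k : ℤ, (g (Psi φ y f)).coeff (m * k) = ρ (f k) * ((U ^ k : Eˣ) : E) := by
    intro f k
    induction f using Finsupp.induction_linear with
    | zero => simp
    | add f f' hf hf' =>
      rw [map_add, map_add, Finsupp.add_apply, map_add, add_mul, ← hf, ← hf']; rfl
    | single l r =>
      rw [Psi_single, map_mul g, h1, hyk, CA_apply, ← mul_assoc, ← map_mul, ← LaurentPolynomial.single_eq_C_mul_T]
      have : (m : ℤ) * l = m * k ↔ l = k := by
        constructor
        · intro h; exact mul_left_cancel₀ (by exact_mod_cast hm.ne') h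
        · rintro rfl; rfl
      classical
      by_cases hlk : l = k
      · subst hlk; rw [Finsupp.single_eq_same]; exact Finsupp.single_eq_same
      · rw [Finsupp.single_eq_of_ne' hlk, map_zero, zero_mul]
        exact Finsupp.single_eq_of_ne' (mt this.1 hlk)
  ext k
  have := key f k
  rw [hf, map_zero] at this
  have h0 : ρ (f k) = 0 := by
    have h3 : ρ (f k) * ((U ^ k : Eˣ) : E) = 0 := this.symm
    exact (Units.mul_left_eq_zero _).1 h3
  rw [Finsupp.zero_apply]
  exact hρ (by rw [h0, map_zero])

end Psi
end QG

namespace QG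
variable {K : Type*} [Field K]

namespace Cfg
variable {m N n : ℕ} (c : Cfg m N n)
variable {q : K}

lemma exD {E : Type*} [Ring E] [Algebra K E] (Φ : QMat K q m n →ₐ[K] E) : ∃ f : QMat K q m n →ₐ[K] LaurentPolynomial E,
    ∀ J, f (grMinor K q m J) = CA (K := K) E (Φ (grMinor K q m J)) * LaurentPolynomial.T m := by
  have h1 := (isQM_X q m n).map (B := LaurentPolynomial E) ((CA (K := K) E).comp Φ)
  have h2 := h1.mulC (LaurentPolynomial.T 1) (fun i j => LaurentPolynomial.commute_T 1 _)
  refine ⟨liftQM h2, fun J => ?_⟩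
  rw [map_grMinor_mulC (liftQM h2) ((CA (K := K) E).comp Φ) (LaurentPolynomial.T 1)
    (fun i j => LaurentPolynomial.commute_T 1 _) (fun i j => by rw [liftQM_X])]
  rw [LaurentPolynomial.T_pow]
  simp

variable {B : Type*} [Ring B] [Algebra K B]

lemma gr_emb (hq : q ≠ 0) (hroot : ∀ k : ℕ, 0 < k → q ^ k ≠ 1) (L : NormalLoc K (↥(qGrass K q m n)) B (grE K q m c.M)) :
    GrRel q m (fun J : Finset (Fin n) => L.emb (grE K q m J)) :=
  GrRel.map (B := ↥(qGrass K q m n)) (C := B) (grRel_grE hq hroot m n) L.emb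

/-- the embedding of coefficients -/
noncomputable def ph (hq : q ≠ 0) (hroot : ∀ k : ℕ, 0 < k → q ^ k ≠ 1) (L : NormalLoc K (↥(qGrass K q m n)) B (grE K q m c.M)) : QMat K q m N →ₐ[K] B :=
  liftQM (c.isQM_xi (c.gr_emb hq hroot L) L.isUnit.unit rfl)

lemma ph_X (hq : q ≠ 0) (hroot : ∀ k : ℕ, 0 < k → q ^ k ≠ 1) (L : NormalLoc K (↥(qGrass K q m n)) B (grE K q m c.M)) (i j) :
    c.ph hq hroot L (X K q i j) = c.xi (fun J => L.emb (grE K q m J)) L.isUnit.unit i j := by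
  simp [ph]

lemma comm_of_X (φ : QMat K q m N →ₐ[K] B) (y : Bˣ) (t : Fin N → K) (ht : ∀ j, t j ≠ 0)
    (h : ∀ i j, (y : B) * φ (X K q i j) = t j • (φ (X K q i j) * y)) (r : QMat K q m N) :
    (y : B) * φ r = φ (scE q m t ht r) * y := by
  have e : ∀ r, scE q m t ht r = sc q m t r := fun r => rfl
  simp only [e]
  induction r using qmat_induction with
  | one => simp
  | add v w hv hw => simp only [map_add, mul_add, add_mul, hv, hw]
  | smul a v hv => simp only [map_smul, mul_smul_comm, smul_mul_assoc, hv]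
  | mulX i j v hv =>
    rw [map_mul, ← mul_assoc, h, smul_mul_assoc, mul_assoc, hv, map_mul, map_mul, sc_X, map_smul, smul_mul_assoc, smul_mul_assoc, mul_assoc]

lemma ph_inj_aux (hq : q ≠ 0) (hroot : ∀ k : ℕ, 0 < k → q ^ k ≠ 1) (hm : 0 < m) (L : NormalLoc K (↥(qGrass K q m n)) B (grE K q m c.M))
    {E : Type*} [Ring E] [Algebra K E] (Φ : QMat K q m n →ₐ[K] E) (U : Eˣ) (hU : (U : E) = Φ (grMinor K q m c.M))
    (ρ : QMat K q m N →ₐ[K] E) (hρX : ∀ i j, ρ (X K q i j) = c.xi (fun J => Φ (grMinor K q m J)) U i j) (hρ : Function.Injective ρ) :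
    Function.Injective (Psi (c.ph hq hroot L) L.isUnit.unit) := by
  obtain ⟨f, hf⟩ := exD Φ
  have hW : f (grMinor K q m c.M) = ((Units.map (CA (K := K) E : E →* LaurentPolynomial E) U * TU E m : (LaurentPolynomial E)ˣ) : LaurentPolynomial E) := by
    rw [hf, ← hU]; rfl
  let f' : ↥(qGrass K q m n) →ₐ[K] LaurentPolynomial E := f.comp (qGrass K q m n).val
  obtain ⟨g, hg⟩ := NormalLoc.lift (D := LaurentPolynomial E) L f' ⟨_, hW.symm⟩
  have hg' : ∀ J, g (L.emb (grE K q m J)) = CA (K := K) E (Φ (grMinor K q m J)) * LaurentPolynomial.T m :=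
    fun J => (hg _).trans (hf J)
  refine Psi_inj _ _ ρ hρ U m hm g ?_ ?_
  · have : g.comp (c.ph hq hroot L) = (CA (K := K) E).comp ρ := by
      apply qmat_hom_ext
      intro i j
      have h1 : Units.map (g : B →* LaurentPolynomial E) L.isUnit.unit = Units.map (CA (K := K) E : E →* LaurentPolynomial E) U * TU E m := by
        ext1
        exact (hg _).trans hW
      have h2 : g ((L.isUnit.unit⁻¹ : Bˣ) : B) = LaurentPolynomial.T (-m) * CA (K := K) E ((U⁻¹ : Eˣ) : E) := by
        have := congrArg (fun z => ((z⁻¹ : (LaurentPolynomial E)ˣ) : LaurentPolynomial E)) h1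
        rw [mul_inv_rev, ← map_inv, ← map_inv] at this
        exact this
      rw [AlgHom.comp_apply, AlgHom.comp_apply, ph_X, hρX]
      unfold xi
      rw [map_mul, map_mul, hg', h2, mul_assoc, ← mul_assoc (LaurentPolynomial.T _), ← LaurentPolynomial.T_add]
      simp
    exact fun r => DFunLike.congr_fun this r
  · rw [IsUnit.unit_spec, hg', ← hU]

lemma ph_inj (hq : q ≠ 0) (hroot : ∀ k : ℕ, 0 < k → q ^ k ≠ 1) (hN : N + m = n) (hm : 0 < m) (L : NormalLoc K (↥(qGrass K q m n)) B (grE K q m c.M)) :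
    Function.Injective (Psi (c.ph hq hroot L) L.isUnit.unit) :=
  ph_inj_aux c hq hroot hm L (E := Module.End K (QMat K q m N)) (c.Phi hq hN) (c.UU hq hN) (c.UU_eq hq hN hroot)
    (c.rho hq hN hroot) (c.rho_X hq hN hroot) (c.rho_inj hq hN hroot)

lemma ph_comm (hq : q ≠ 0) (hroot : ∀ k : ℕ, 0 < k → q ^ k ≠ 1) (L : NormalLoc K (↥(qGrass K q m n)) B (grE K q m c.M)) (r : QMat K q m N) :
    (L.isUnit.unit : B) * c.ph hq hroot L r = c.ph hq hroot L (scE q m (c.s q) (c.s_ne hq) r) * L.isUnit.unit := by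
  apply comm_of_X
  intro i j
  rw [ph_X]
  exact c.u_xi (c.gr_emb hq hroot L) L.isUnit.unit rfl i j

lemma ph_surj (hq : q ≠ 0) (hroot : ∀ k : ℕ, 0 < k → q ^ k ≠ 1) (L : NormalLoc K (↥(qGrass K q m n)) B (grE K q m c.M)) :
    Function.Surjective (Psi (c.ph hq hroot L) L.isUnit.unit) := by
  let S := PsiS (c.ph hq hroot L) L.isUnit.unit _ (c.ph_comm hq hroot L)
  have hy : ∀ k : ℤ, ((L.isUnit.unit ^ k : Bˣ) : B) ∈ S := fun k => ⟨Finsupp.single k 1, by simp [Psi_single]⟩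
  have hG : ∀ J : Finset (Fin n), L.emb (grE K q m J) ∈ S := by
    intro J
    by_cases hJ : J.card = m
    · refine c.G_mem (c.gr_emb hq hroot L) L.isUnit.unit rfl S ?_ ?_ ?_ J hJ
      · intro i j
        refine ⟨Finsupp.single 0 (X K q i j), ?_⟩
        rw [Psi_single, ph_X]; simp
      · simpa using hy 1
      · simpa using hy (-1)
    · have : grE K q m J = 0 := by
        apply Subtype.ext
        simp [grE, grMinor, hJ]
      rw [this, map_zero]; exact S.zero_mem
  have hA : ∀ (a : QMat K q m n) (ha : a ∈ qGrass K q m n), L.emb ⟨a, ha⟩ ∈ S := by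
    intro a ha
    have hle : qGrass K q m n ≤ (S.comap L.emb).map (qGrass K q m n).val := by
      refine Algebra.adjoin_le ?_
      rintro _ ⟨J, rfl⟩
      exact ⟨grE K q m J, hG J, rfl⟩
    obtain ⟨b, hb, hb2⟩ := hle ha
    have : b = ⟨a, ha⟩ := Subtype.ext hb2
    rw [← this]; exact hb
  intro b
  obtain ⟨a, k, h⟩ := L.surj b
  have : b ∈ S := by
    rw [h]
    refine S.mul_mem (hA _ a.2) ?_
    have := hy (-k)
    rwa [zpow_neg, zpow_natCast, ← inv_pow] at this
  exact this

lemma ph_bij (hq : q ≠ 0) (hroot : ∀ k : ℕ, 0 < k → q ^ k ≠ 1) (hN : N + m = n) (hm : 0 < m) (L : NormalLoc K (↥(qGrass K q m n)) B (grE K q m c.M)) :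
    Function.Bijective (Psi (c.ph hq hroot L) L.isUnit.unit) := ⟨c.ph_inj hq hroot hN hm L, c.ph_surj hq hroot L⟩

end Cfg
end QG

namespace QG

lemma mem_consec0 {m n : ℕ} (hn : 0 < n) (hmn : m < n) (z : Fin n) : z ∈ consecSet hn m 0 ↔ (z : ℕ) < m := by
  simp only [consecSet, Finset.mem_image, Finset.mem_range, fmod, Fin.ext_iff]
  constructor
  · rintro ⟨k, hk, h⟩
    rw [Nat.mod_eq_of_lt (by omega)] at h; omega
  · intro h
    refine ⟨z, h, ?_⟩
    rw [Nat.mod_eq_of_lt (by omega)]; omega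

lemma mem_consec1 {m n : ℕ} (hn : 0 < n) (hmn : m < n) (z : Fin n) : z ∈ consecSet hn m 1 ↔ 1 ≤ (z : ℕ) ∧ (z : ℕ) ≤ m := by
  simp only [consecSet, Finset.mem_image, Finset.mem_range, fmod, Fin.ext_iff]
  constructor
  · rintro ⟨k, hk, h⟩
    rw [Nat.mod_eq_of_lt (by omega)] at h; omega
  · intro h
    refine ⟨z - 1, by omega, ?_⟩
    rw [Nat.mod_eq_of_lt (by omega)]; omega

lemma fmod_val {n : ℕ} (hn : 0 < n) {k : ℕ} (hk : k < n) : (fmod n hn k : ℕ) = k := Nat.mod_eq_of_lt hk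

/-- configuration at the first consecutive minor -/
def cfg0 {m n : ℕ} (hn : 0 < n) (hmn : m < n) : Cfg m (n - m) n where
  M := consecSet hn m 0
  b i := fmod n hn (0 + (m - 1 - i))
  a j := fmod n hn (0 + m + j)
  aft _ := true
  hb i k h := by
    have : (i : ℕ) < k := h
    rw [Fin.lt_def, fmod_val hn (by omega), fmod_val hn (by omega)]; omega
  bM i := by rw [mem_consec0 hn hmn, fmod_val hn (by omega)]; omega
  Mb z hz := by
    rw [mem_consec0 hn hmn] at hz
    refine ⟨⟨m - 1 - z, by omega⟩, ?_⟩
    rw [Fin.ext_iff, fmod_val hn (by dsimp only; omega)]; dsimp only; omega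
  aM j := by rw [mem_consec0 hn hmn, fmod_val hn (by omega)]; omega
  Ma z hz := by
    rw [mem_consec0 hn hmn] at hz
    refine ⟨⟨z - m, by omega⟩, ?_⟩
    rw [Fin.ext_iff, fmod_val hn (by dsimp only; omega)]; dsimp only; omega
  h_aft j _ z hz := by
    rw [mem_consec0 hn hmn] at hz
    rw [Fin.lt_def, fmod_val hn (by omega)]; omega
  h_bef j h := by simp at h
  mono j l h _ := by
    have : (j : ℕ) < l := h
    rw [Fin.lt_def, fmod_val hn (by omega), fmod_val hn (by omega)]; omega
  mix j l _ _ := rfl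

lemma fmod1_lt {m n : ℕ} (hn : 0 < n) (hmn : m < n) (j : Fin (n - m)) (h : (j : ℕ) + 1 < n - m) :
    (fmod n hn (1 + m + j) : ℕ) = 1 + m + j := fmod_val hn (by omega)

lemma fmod1_last {m n : ℕ} (hn : 0 < n) (hmn : m < n) (j : Fin (n - m)) (h : ¬ (j : ℕ) + 1 < n - m) :
    (fmod n hn (1 + m + j) : ℕ) = 0 := by
  have : 1 + m + (j : ℕ) = n := by omega
  simp [fmod, this]

/-- configuration at the second consecutive minor -/
def cfg1 {m n : ℕ} (hn : 0 < n) (hmn : m < n) : Cfg m (n - m) n where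
  M := consecSet hn m 1
  b i := fmod n hn (1 + (m - 1 - i))
  a j := fmod n hn (1 + m + j)
  aft j := decide ((j : ℕ) + 1 < n - m)
  hb i k h := by
    have : (i : ℕ) < k := h
    rw [Fin.lt_def, fmod_val hn (by omega), fmod_val hn (by omega)]; omega
  bM i := by rw [mem_consec1 hn hmn, fmod_val hn (by omega)]; omega
  Mb z hz := by
    rw [mem_consec1 hn hmn] at hz
    refine ⟨⟨m - z, by omega⟩, ?_⟩
    rw [Fin.ext_iff, fmod_val hn (by dsimp only; omega)]; dsimp only; omega
  aM j := by
    rw [mem_consec1 hn hmn]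
    by_cases h : (j : ℕ) + 1 < n - m
    · rw [fmod1_lt hn hmn j h]; omega
    · rw [fmod1_last hn hmn j h]; omega
  Ma z hz := by
    rw [mem_consec1 hn hmn] at hz
    by_cases h0 : (z : ℕ) = 0
    · refine ⟨⟨n - m - 1, by omega⟩, ?_⟩
      rw [Fin.ext_iff, fmod1_last hn hmn _ (by dsimp only; omega)]; omega
    · refine ⟨⟨z - m - 1, by omega⟩, ?_⟩
      rw [Fin.ext_iff, fmod1_lt hn hmn _ (by dsimp only; omega)]; dsimp only; omega
  h_aft j h z hz := by
    rw [mem_consec1 hn hmn] at hz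
    rw [decide_eq_true_iff] at h
    rw [Fin.lt_def, fmod1_lt hn hmn j h]; omega
  h_bef j h z hz := by
    rw [mem_consec1 hn hmn] at hz
    rw [decide_eq_false_iff_not] at h
    rw [Fin.lt_def, fmod1_last hn hmn j h]; omega
  mono j l h e := by
    have h' : (j : ℕ) < l := h
    by_cases h1 : (j : ℕ) + 1 < n - m
    · have h2 : (l : ℕ) + 1 < n - m := by simpa [h1] using e
      rw [Fin.lt_def, fmod1_lt hn hmn j h1, fmod1_lt hn hmn l h2]; omega
    · omega
  mix j l h e := by
    have h' : (j : ℕ) < l := h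
    rw [decide_eq_true_iff] at e ⊢; omega

lemma bij_of_scaled {K V B T : Type*} [Field K] [AddCommGroup V] [Module K V] [AddCommGroup B] [Module K B] [AddCommGroup T] [Module K T]
    (P : V →ₗ[K] B) (hP : Function.Bijective P) (τ : B ≃ₗ[K] T) (Q : V →ₗ[K] T) (S : Set V) (hS : Submodule.span K S = ⊤)
    (h : ∀ f ∈ S, ∃ a : K, a ≠ 0 ∧ Q f = a • τ (P f)) : Function.Bijective Q := by
  let b := Module.Basis.ofSpan (K := K) (s := S) (le_of_eq hS.symm)
  have hb : ∀ i, b i ∈ S := fun i => Module.Basis.ofSpan_subset (le_of_eq hS.symm) (Set.mem_range_self i)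
  choose a ha hQ using fun i => h (b i) (hb i)
  let b' := b.unitsSMul (fun i => Units.mk0 (a i) (ha i))
  let δ := b.equiv b' (Equiv.refl _)
  have hQ' : Q = (τ.toLinearMap.comp P).comp δ.toLinearMap := by
    apply b.ext
    intro i
    have : δ (b i) = a i • b i := by
      rw [Module.Basis.equiv_apply]
      simp only [b', Module.Basis.unitsSMul_apply, Equiv.refl_apply]
      rfl
    simp [hQ, this]
  rw [hQ']
  exact (τ.bijective.comp hP).comp δ.bijective

end QG

namespace QG
variable {K : Type*} [Field K]

section cm
variable {n : ℕ} (hn : 0 < n) {p : K}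

lemma cmap_of_last (s t : Fin n → ℤ) (h : s (lastIdx n hn) = 0) : cmap K hn p s t = 1 := by
  unfold cmap
  apply Finset.prod_eq_one
  intro j _
  rw [h]; simp

lemma cmap_ne (hp : p ≠ 0) (s t : Fin n → ℤ) : cmap K hn p s t ≠ 0 := by
  unfold cmap
  exact Finset.prod_ne_zero_iff.2 fun j _ => zpow_ne_zero _ hp

lemma cmap_eq (hp : p ≠ 0) (s t : Fin n → ℤ) : cmap K hn p s t =
    p ^ (s (lastIdx n hn) * ((∑ j, t j) - t (lastIdx n hn))) := by
  have h : ∀ S : Finset (Fin n), ∏ j ∈ S, p ^ (s (lastIdx n hn) * t j) = p ^ (s (lastIdx n hn) * ∑ j ∈ S, t j) := by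
    intro S
    induction S using Finset.induction_on with
    | empty => simp
    | insert a S ha ih => rw [Finset.prod_insert ha, ih, Finset.sum_insert ha, mul_add, zpow_add₀ hp]
  unfold cmap
  rw [h, Finset.filter_ne', ← Finset.sum_erase_eq_sub (Finset.mem_univ _)]

lemma sum_single_val (r : ℕ) (hr : r < n) : (∑ l : Fin n, if (l : ℕ) = r then (1 : ℤ) else 0) = 1 := by
  rw [Finset.sum_eq_single ⟨r, hr⟩]
  · simp
  · intro b _ hb
    rw [if_neg]; intro h; exact hb (Fin.ext h)
  · simp

lemma sum_lt_val (m : ℕ) (hm : m ≤ n) : (∑ l : Fin n, if (l : ℕ) < m then (1 : ℤ) else 0) = m := by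
  rw [Fin.sum_univ_eq_sum_range (fun l => if l < m then (1 : ℤ) else 0) n, Finset.sum_ite]
  simp only [Finset.sum_const, Finset.sum_const_zero, add_zero, nsmul_eq_mul, mul_one]
  have : (Finset.range n).filter (fun x => x < m) = Finset.range m := by
    ext x; simp; omega
  rw [this, Finset.card_range]; simp

variable {m : ℕ} (hmn : m < n)

lemma yC_last (hmn : m < n) : yContent m n (lastIdx n hn) = 0 := by
  simp [yContent, lastIdx]; omega

lemma xC_last (i : Fin m) (j : Fin (n - m)) : xContent m n i j (lastIdx n hn) = if (j : ℕ) + 1 < n - m then 0 else 1 := by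
  have hj := j.2
  have h1 : ¬ (n - 1 = m - 1 - (i : ℕ)) := by omega
  simp only [xContent, lastIdx, h1, if_false]
  split_ifs <;> omega

lemma xC_sum (i : Fin m) (j : Fin (n - m)) : ∑ l, xContent m n i j l = 0 := by
  have hj := j.2
  simp only [xContent, Finset.sum_sub_distrib]
  rw [sum_single_val _ (by omega), sum_single_val _ (by omega)]; simp

lemma c_xx (hp : p ≠ 0) (i k : Fin m) (j l : Fin (n - m)) : cmap K hn p (xContent m n i j) (xContent m n k l) =
    if (j : ℕ) + 1 < n - m ∨ (l : ℕ) + 1 < n - m then 1 else p⁻¹ := by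
  rw [cmap_eq hn hp, xC_sum, xC_last, xC_last]
  split_ifs <;> first | omega | simp

lemma c_xy (hp : p ≠ 0) (hmn : m < n) (i : Fin m) (j : Fin (n - m)) : cmap K hn p (xContent m n i j) (yContent m n) =
    if (j : ℕ) + 1 < n - m then 1 else p ^ m := by
  rw [cmap_eq hn hp, xC_last, yC_last hn hmn]
  unfold yContent
  rw [sum_lt_val m hmn.le]
  split_ifs <;> simp
end cm

section tw
variable {n : ℕ} (hn : 0 < n) {p : K} {B T : Type*} [Ring B] [Algebra K B] [Ring T] [Algebra K T]
  {𝒜 : (Fin n → ℤ) → Submodule K B} [GradedAlgebra 𝒜] (tw : CocycleTwist K B 𝒜 (cmap K hn p) T)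

lemma tw_left (s : Fin n → ℤ) (hs : s (lastIdx n hn) = 0) (a : B) (ha : a ∈ 𝒜 s) (b : B) : tw.τ a * tw.τ b = tw.τ (a * b) := by
  classical
  induction b using DirectSum.Decomposition.inductionOn 𝒜 with
  | zero => simp
  | homogeneous b => rw [tw.mul_tw s _ a b ha b.2, cmap_of_last hn s _ hs, one_smul]
  | add b b' h h' => rw [map_add, mul_add, h, h', mul_add, map_add]

lemma tw_one : tw.τ 1 = 1 := by
  have h := fun b => tw_left hn tw 0 rfl 1 (SetLike.one_mem_graded 𝒜) b
  have := h (tw.τ.symm 1)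
  rw [one_mul, tw.τ.apply_symm_apply, mul_one] at this
  exact this

lemma inv_hom (y : Bˣ) (s : Fin n → ℤ) (hy : (y : B) ∈ 𝒜 s) : ((y⁻¹ : Bˣ) : B) ∈ 𝒜 (-s) := by
  classical
  let z : B := (DirectSum.decompose 𝒜 ((y⁻¹ : Bˣ) : B) (-s) : B)
  have h := DirectSum.coe_decompose_mul_add_of_left_mem 𝒜 (i := s) (j := -s) (a := (y : B)) (b := ((y⁻¹ : Bˣ) : B)) hy
  rw [Units.mul_inv, add_neg_cancel, DirectSum.decompose_of_mem_same 𝒜 (SetLike.one_mem_graded 𝒜)] at h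
  have : ((y⁻¹ : Bˣ) : B) = z := by
    rw [Units.inv_eq_of_mul_eq_one_right h.symm]
  rw [this]
  exact (DirectSum.decompose 𝒜 ((y⁻¹ : Bˣ) : B) (-s)).2

/-- twisted unit -/
noncomputable def twU (y : Bˣ) (s : Fin n → ℤ) (hs : s (lastIdx n hn) = 0) (hy : (y : B) ∈ 𝒜 s) : Tˣ where
  val := tw.τ y
  inv := tw.τ ((y⁻¹ : Bˣ) : B)
  val_inv := by rw [tw_left hn tw s hs _ hy, Units.mul_inv, tw_one]
  inv_val := by
    rw [tw_left hn tw (-s) (by simp [hs]) _ (inv_hom y s hy), Units.inv_mul, tw_one]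

lemma zpow_hom (y : Bˣ) (s : Fin n → ℤ) (hy : (y : B) ∈ 𝒜 s) (k : ℤ) : ((y ^ k : Bˣ) : B) ∈ 𝒜 (k • s) := by
  induction k using Int.induction_on with
  | zero => simpa using SetLike.one_mem_graded 𝒜
  | succ k ih =>
    rw [zpow_add_one, add_smul, one_smul, Units.val_mul]; exact SetLike.mul_mem_graded ih hy
  | pred k ih =>
    rw [zpow_sub_one, sub_smul, one_smul, Units.val_mul, sub_eq_add_neg]; exact SetLike.mul_mem_graded ih (inv_hom y s hy)

lemma twU_zpow (y : Bˣ) (s : Fin n → ℤ) (hs : s (lastIdx n hn) = 0) (hy : (y : B) ∈ 𝒜 s) (k : ℤ) :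
    ((twU hn tw y s hs hy ^ k : Tˣ) : T) = tw.τ ((y ^ k : Bˣ) : B) := by
  have hl : ∀ k : ℤ, (k • s) (lastIdx n hn) = 0 := by intro k; simp [hs]
  induction k using Int.induction_on with
  | zero => simp [tw_one]
  | succ k ih =>
    rw [zpow_add_one, Units.val_mul, ih]
    show _ * tw.τ y = _
    rw [tw_left hn tw _ (hl k) _ (zpow_hom y s hy k), zpow_add_one, Units.val_mul]
  | pred k ih =>
    rw [zpow_sub_one, Units.val_mul, ih]
    show _ * tw.τ ((y⁻¹ : Bˣ) : B) = _
    rw [tw_left hn tw _ (hl _) _ (zpow_hom y s hy _), zpow_sub_one, Units.val_mul]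

lemma isQM_tw {m : ℕ} {q : K} (hp : p ≠ 0) {x : Fin m → Fin (n - m) → B} (h : IsQM q x) (hx : ∀ i j, x i j ∈ 𝒜 (xContent m n i j)) :
    IsQM q (fun i j => tw.τ (x i j)) := by
  have key := fun i j k l => tw.mul_tw _ _ _ _ (hx i j) (hx k l)
  simp only [c_xx hn hp] at key
  constructor
  · intro i j l hjl
    have h1 : (j : ℕ) < l := hjl
    rw [key, key, if_pos (by omega), if_pos (by omega), one_smul, one_smul, h.row i j l hjl, map_smul]
  · intro i k j hik
    rw [key, key, h.col i k j hik, map_smul, smul_comm]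
  · intro i k j l hik hjl
    have h1 : (j : ℕ) < l := hjl
    rw [key, key, if_pos (by omega), if_pos (by omega), one_smul, one_smul, h.comm i k j l hik hjl]
  · intro i k j l hik hjl
    have h1 : (j : ℕ) < l := hjl
    rw [key, key, key, if_pos (by omega), if_pos (by omega), one_smul, one_smul, one_smul, ← map_sub, h.qrel i k j l hik hjl, map_smul]

end tw

/-- words -/
noncomputable def wd (q : K) {m N : ℕ} (l : List (Fin m × Fin N)) : QMat K q m N := (l.map fun p => X K q p.1 p.2).prod

lemma span_wd (q : K) (m N : ℕ) : Submodule.span K (Set.range fun p : ℤ × List (Fin m × Fin N) =>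
    (Finsupp.single p.1 (wd q p.2) : ℤ →₀ QMat K q m N)) = ⊤ := by
  have h1 : ∀ r : QMat K q m N, r ∈ Submodule.span K (Set.range (wd (m := m) (N := N) q)) := by
    intro r
    induction r using qmat_induction with
    | one => exact Submodule.subset_span ⟨[], by simp [wd]⟩
    | add v w hv hw => exact Submodule.add_mem _ hv hw
    | smul a v hv => exact Submodule.smul_mem _ a hv
    | mulX i j v hv =>
      induction hv using Submodule.span_induction with
      | mem w hw =>
        obtain ⟨l, rfl⟩ := hw
        exact Submodule.subset_span ⟨(i, j) :: l, by simp [wd]⟩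
      | zero => rw [mul_zero]; exact Submodule.zero_mem _
      | add v w _ _ hv hw => rw [mul_add]; exact Submodule.add_mem _ hv hw
      | smul t v _ hv => rw [mul_smul_comm]; exact Submodule.smul_mem _ t hv
  rw [eq_top_iff]
  intro f hf0
  clear hf0
  induction f using Finsupp.induction_linear with
  | zero => exact Submodule.zero_mem _
  | add f g hf hg => exact Submodule.add_mem _ hf hg
  | single k r =>
    have := h1 r
    induction this using Submodule.span_induction with
    | mem w hw =>
      obtain ⟨l, rfl⟩ := hw
      exact Submodule.subset_span ⟨(k, l), rfl⟩
    | zero => rw [Finsupp.single_zero]; exact Submodule.zero_mem _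
    | add v w _ _ hv hw => rw [Finsupp.single_add]; exact Submodule.add_mem _ hv hw
    | smul t v _ hv => rw [← Finsupp.smul_single]; exact Submodule.smul_mem _ t hv

end QG

namespace QG
variable {K : Type*} [Field K]

lemma bij_of_scaled' {R B T : Type*} [Ring R] [Algebra K R] [Ring B] [Algebra K B] [Ring T] [Algebra K T]
    (P : (ℤ →₀ R) →ₗ[K] B) (hP : Function.Bijective P) (τ : B ≃ₗ[K] T) (Q : (ℤ →₀ R) →ₗ[K] T) (S : Set (ℤ →₀ R))
    (hS : Submodule.span K S = ⊤)
    (h : ∀ f ∈ S, ∃ a : K, a ≠ 0 ∧ Q f = a • τ (P f)) : Function.Bijective Q :=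
  bij_of_scaled (V := ℤ →₀ R) P hP τ Q S hS h

lemma tw_bij {m n : ℕ} (hn : 0 < n) {p q : K} (hp : p ≠ 0) {B T : Type*} [Ring B] [Algebra K B] [Ring T] [Algebra K T]
    {𝒜 : (Fin n → ℤ) → Submodule K B} [GradedAlgebra 𝒜] (tw : CocycleTwist K B 𝒜 (cmap K hn p) T)
    (φ : QMat K q m (n - m) →ₐ[K] B) (y : Bˣ) (hb : Function.Bijective (Psi φ y))
    (hx : ∀ i j, φ (X K q i j) ∈ 𝒜 (xContent m n i j)) (s : Fin n → ℤ) (hs : s (lastIdx n hn) = 0) (hy : (y : B) ∈ 𝒜 s)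
    (φ' : QMat K q m (n - m) →ₐ[K] T) (hφ' : ∀ i j, φ' (X K q i j) = tw.τ (φ (X K q i j))) :
    Function.Bijective (Psi φ' (twU hn tw y s hs hy)) := by
  refine bij_of_scaled' (R := QMat K q m (n - m)) (Psi φ y) hb tw.τ _ _ (span_wd q m (n - m)) ?_
  rintro _ ⟨⟨k, l⟩, rfl⟩
  have key : ∀ l : List (Fin m × Fin (n - m)), ∃ d, φ (wd q l) ∈ 𝒜 d ∧ ∃ a : K, a ≠ 0 ∧ φ' (wd q l) = a • tw.τ (φ (wd q l)) := by
    intro l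
    induction l with
    | nil =>
      refine ⟨0, ?_, 1, one_ne_zero, ?_⟩
      · simpa [wd] using SetLike.one_mem_graded 𝒜
      · simp [wd, tw_one hn tw]
    | cons z l ih =>
      obtain ⟨d, hd, a, ha, h⟩ := ih
      have e : wd q (z :: l) = X K q z.1 z.2 * wd q l := by simp [wd]
      refine ⟨xContent m n z.1 z.2 + d, ?_, a * cmap K hn p (xContent m n z.1 z.2) d, mul_ne_zero ha (cmap_ne hn hp _ _), ?_⟩
      · rw [e, map_mul]; exact SetLike.mul_mem_graded (hx _ _) hd
      · rw [e, map_mul, map_mul, h, hφ', mul_smul_comm, tw.mul_tw _ _ _ _ (hx _ _) hd, smul_smul]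
  obtain ⟨d, hd, a, ha, h⟩ := key l
  refine ⟨a * cmap K hn p d (k • s), mul_ne_zero ha (cmap_ne hn hp _ _), ?_⟩
  dsimp only
  rw [Psi_single, Psi_single, twU_zpow, h, smul_mul_assoc, tw.mul_tw _ _ _ _ hd (zpow_hom y s hy k), smul_smul]

theorem final_aux
    (q : K) (hq : q ≠ 0) (hroot : ∀ k : ℕ, 0 < k → q ^ k ≠ 1)
    (m n : ℕ) (hm : 0 < m) (hmn : m < n) (hn : 0 < n)
    (p : K) (hp : p ^ m = q ^ 2)
    (B₁ : Type*) [Ring B₁] [Algebra K B₁]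
    (L₁ : NormalLoc K (↥(qGrass K q m n)) B₁
      (grE K q m (consecSet hn m 0)))
    (B₂ : Type*) [Ring B₂] [Algebra K B₂]
    (L₂ : NormalLoc K (↥(qGrass K q m n)) B₂
      (grE K q m (consecSet hn m 1)))
    (𝒜 : (Fin n → ℤ) → Submodule K B₁) [GradedAlgebra 𝒜]
    (hx : ∀ (i : Fin m) (j : Fin (n - m)),
      xElt K q m n hn 0 L₁ i j ∈ 𝒜 (xContent m n i j))
    (hy : L₁.emb (grE K q m (consecSet hn m 0)) ∈ 𝒜 (yContent m n))
    (T : Type*) [Ring T] [Algebra K T]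
    (tw : CocycleTwist K B₁ 𝒜 (cmap K hn p) T) :
    ∃ θ : T ≃ₐ[K] B₂,
      (∀ (i : Fin m) (j : Fin (n - m)),
        θ (tw.τ (xElt K q m n hn 0 L₁ i j)) =
          xElt K q m n hn 1 L₂ i j) ∧
      θ (tw.τ (L₁.emb (grE K q m (consecSet hn m 0)))) =
        L₂.emb (grE K q m (consecSet hn m 1)) := by
  have hp0 : p ≠ 0 := by
    rintro rfl
    rw [zero_pow hm.ne'] at hp
    exact pow_ne_zero 2 hq hp.symm
  let c0 : Cfg m (n - m) n := cfg0 hn hmn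
  let c1 : Cfg m (n - m) n := cfg1 hn hmn
  have hN : n - m + m = n := by omega
  let φ1 : QMat K q m (n - m) →ₐ[K] B₁ := c0.ph hq hroot L₁
  let φ2 : QMat K q m (n - m) →ₐ[K] B₂ := c1.ph hq hroot L₂
  have hφ1 : ∀ i j, φ1 (X K q i j) = xElt K q m n hn 0 L₁ i j := fun i j => c0.ph_X hq hroot L₁ i j
  have hφ2 : ∀ i j, φ2 (X K q i j) = xElt K q m n hn 1 L₂ i j := fun i j => c1.ph_X hq hroot L₂ i j
  have hx' : ∀ i j, φ1 (X K q i j) ∈ 𝒜 (xContent m n i j) := fun i j => by rw [hφ1]; exact hx i j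
  have hQ1 : IsQM q (fun i j => φ1 (X K q i j)) := (isQM_X q m (n - m)).map φ1
  have hQT := isQM_tw hn tw hp0 hQ1 hx'
  let φT : QMat K q m (n - m) →ₐ[K] T := liftQM hQT
  have hφT : ∀ i j, φT (X K q i j) = tw.τ (φ1 (X K q i j)) := fun i j => liftQM_X hQT i j
  let y1 : B₁ˣ := L₁.isUnit.unit
  have hy1 : (y1 : B₁) ∈ 𝒜 (yContent m n) := hy
  have hl := yC_last hn hmn
  let yT : Tˣ := twU hn tw y1 _ hl hy1
  have hyT : (yT : T) = tw.τ (L₁.emb (grE K q m (consecSet hn m 0))) := rfl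
  have hcT : ∀ r, (yT : T) * φT r = φT (scE q m (c1.s q) (c1.s_ne hq) r) * yT := by
    apply Cfg.comm_of_X
    intro i j
    have h1 : (y1 : B₁) * φ1 (X K q i j) = q • (φ1 (X K q i j) * y1) := by
      rw [hφ1]
      exact c0.u_xi (c0.gr_emb hq hroot L₁) L₁.isUnit.unit rfl i j
    rw [hφT]
    show tw.τ y1 * _ = _ • (_ * tw.τ y1)
    rw [tw_left hn tw _ hl _ hy1, h1, tw.mul_tw _ _ _ _ (hx' i j) hy1, c_xy hn hp0 hmn, smul_smul, map_smul]
    congr 1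
    have hs : c1.s q j = if (j : ℕ) + 1 < n - m then q else q⁻¹ := by
      simp [Cfg.s, c1, cfg1]
    rw [hs, hp]
    split_ifs
    · simp
    · field_simp
  obtain ⟨θ, h1, h2⟩ := Psi_equiv (scE q m (c1.s q) (c1.s_ne hq)) φ2 L₂.isUnit.unit (c1.ph_comm hq hroot L₂)
    (c1.ph_bij hq hroot hN hm L₂) φT yT hcT
    (tw_bij hn hp0 tw φ1 y1 (c0.ph_bij hq hroot hN hm L₁) hx' _ hl hy1 φT hφT)
  refine ⟨θ, fun i j => ?_, ?_⟩
  · rw [← hφ1, ← hφT, h1, hφ2]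
  · rw [← hyT, h2]; rfl

end QG

namespace QG

/-- The twist (by the cocycle `c`, with `p^m = q²`) of the
dehomogenisation of `O_q(G(m,n))` at the consecutive minor `M₁ = [1,…,m]` is isomorphic
to the dehomogenisation at `M₂ = [2,…,m+1]`, via a `K`-algebra isomorphism `θ` sending
`x'_{ij}` to `z_{ij}` and `y₁'` to `y₂` (the image of `M₂`). -/
theorem twist_of_dehomogenisation_iso
    (K : Type*) [Field K] (q : K) (hq : q ≠ 0) (hroot : ∀ k : ℕ, 0 < k → q ^ k ≠ 1)
    (m n : ℕ) (hm : 0 < m) (hmn : m < n)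
    (p : K) (hp : p ^ m = q ^ 2)
    (B₁ : Type*) [Ring B₁] [Algebra K B₁]
    (L₁ : NormalLoc K (↥(qGrass K q m n)) B₁
      (grE K q m (consecSet (show 0 < n by omega) m 0)))
    (B₂ : Type*) [Ring B₂] [Algebra K B₂]
    (L₂ : NormalLoc K (↥(qGrass K q m n)) B₂
      (grE K q m (consecSet (show 0 < n by omega) m 1)))
    (𝒜 : (Fin n → ℤ) → Submodule K B₁) [GradedAlgebra 𝒜]
    (hx : ∀ (i : Fin m) (j : Fin (n - m)),
      xElt K q m n (show 0 < n by omega) 0 L₁ i j ∈ 𝒜 (xContent m n i j))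
    (hy : L₁.emb (grE K q m (consecSet (show 0 < n by omega) m 0)) ∈ 𝒜 (yContent m n))
    (T : Type*) [Ring T] [Algebra K T]
    (tw : CocycleTwist K B₁ 𝒜 (cmap K (show 0 < n by omega) p) T) :
    ∃ θ : T ≃ₐ[K] B₂,
      (∀ (i : Fin m) (j : Fin (n - m)),
        θ (tw.τ (xElt K q m n (show 0 < n by omega) 0 L₁ i j)) =
          xElt K q m n (show 0 < n by omega) 1 L₂ i j) ∧
      θ (tw.τ (L₁.emb (grE K q m (consecSet (show 0 < n by omega) m 0)))) =
        L₂.emb (grE K q m (consecSet (show 0 < n by omega) m 1)) := by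
  exact final_aux q hq hroot m n hm hmn (by omega) p hp B₁ L₁ B₂ L₂ 𝒜 hx hy T tw

end QG
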